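/- arXiv:1102.2597 — 7 statements merged into one kernel-verified Lean document; each statement's English description precedes it below -/
import Mathlib

section
/- The function f : ℝ × ℝ² × ℝ² → ℝ defined by f(ρ,u,m) = |m − (1/2)ρu| + (1/4)(ρ² + |u|²) is convex. -/
/-- The state space ℝ × ℝ² × ℝ², with ℝ² carrying the Euclidean norm. -/
abbrev E2 : Type := EuclideanSpace ℝ (Fin 2)

/-- f(ρ,u,m) = |m − (1/2)ρu| + (1/4)(ρ² + |u|²) -/
noncomputable def fIPM (z : ℝ × E2 × E2) : ℝ :=
  ‖z.2.2 - (1 / 2 : ℝ) • (z.1 • z.2.1)‖ + (1 / 4) * (z.1 ^ 2 + ‖z.2.1‖ ^ 2)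

/-- The exact convexity defect of the squared norm of an inner product space. -/
lemma norm_sq_convex_combination {E : Type*} [NormedAddCommGroup E] [InnerProductSpace ℝ E]
    (u v : E) {a b : ℝ} (hab : a + b = 1) :
    ‖a • u + b • v‖ ^ 2 = a * ‖u‖ ^ 2 + b * ‖v‖ ^ 2 - a * b * ‖u - v‖ ^ 2 := by
  rw [norm_add_sq_real, norm_sub_sq_real, norm_smul, norm_smul, real_inner_smul_left,
    real_inner_smul_right, mul_pow, mul_pow, Real.norm_eq_abs, Real.norm_eq_abs, sq_abs, sq_abs]
  obtain rfl : b = 1 - a := by linarith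
  ring

theorem stmt0 : ConvexOn ℝ (Set.univ : Set (ℝ × E2 × E2)) fIPM := by
  refine ⟨convex_univ, ?_⟩
  rintro ⟨r, u, m⟩ - ⟨s, v, n⟩ - a b ha hb hab
  simp only [fIPM, Prod.smul_mk, Prod.mk_add_mk, smul_eq_mul]
  have hvec : a • m + b • n - (1 / 2 : ℝ) • ((a * r + b * s) • (a • u + b • v)) =
      a • (m - (1 / 2 : ℝ) • (r • u)) + b • (n - (1 / 2 : ℝ) • (s • v)) +
        (1 / 2 * (a * b) * (r - s)) • (u - v) := by
    obtain rfl : b = 1 - a := by linarith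
    module
  have hnorm : ‖a • m + b • n - (1 / 2 : ℝ) • ((a * r + b * s) • (a • u + b • v))‖ ≤
      a * ‖m - (1 / 2 : ℝ) • (r • u)‖ + b * ‖n - (1 / 2 : ℝ) • (s • v)‖ +
        1 / 2 * (a * b) * |r - s| * ‖u - v‖ := by
    rw [hvec]
    refine norm_add₃_le.trans_eq ?_
    simp only [norm_smul, Real.norm_eq_abs, abs_mul, abs_of_nonneg ha, abs_of_nonneg hb]
    norm_num
  have hsq : (a * r + b * s) ^ 2 = a * r ^ 2 + b * s ^ 2 - a * b * |r - s| ^ 2 := by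
    rw [sq_abs]
    obtain rfl : b = 1 - a := by linarith
    ring
  rw [hsq, norm_sq_convex_combination u v hab]
  have hdefect : 0 ≤ a * b * (|r - s| - ‖u - v‖) ^ 2 := by positivity
  linarith
end

section
/- The function g : ℝ × ℝ² × ℝ² → ℝ defined by g(ρ,u,m) = |m − (1/2)ρu| + (1/2)ρ² is Λ-convex: for every (ρ,u,m) ∈ ℝ × ℝ² × ℝ² and every (ρ̄,ū,m̄) ∈ Λ, the function t ↦ g(ρ + tρ̄, u + tū, m + tm̄) is convex on ℝ. -/
/-- The wave cone Λ = {(ρ,u,m) : ρ² = |u|²}. -/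
def LambdaIPM : Set (ℝ × E2 × E2) := {z | z.1 ^ 2 = ‖z.2.1‖ ^ 2}

/-- g(ρ,u,m) = |m − (1/2)ρu| + (1/2)ρ² -/
noncomputable def gIPM (z : ℝ × E2 × E2) : ℝ :=
  ‖z.2.2 - (1 / 2 : ℝ) • (z.1 • z.2.1)‖ + (1 / 2) * z.1 ^ 2

/-- g is Λ-convex: along every direction in the wave cone Λ, g restricts to a
convex function of the parameter t. -/
theorem stmt1 (z zbar : ℝ × E2 × E2) (hzbar : zbar ∈ LambdaIPM) :
    ConvexOn ℝ (Set.univ : Set ℝ) (fun t : ℝ => gIPM (z + t • zbar)) := by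
  obtain ⟨ρ, u, m⟩ := z
  obtain ⟨ρ', u', m'⟩ := zbar
  have hsq : ρ' ^ 2 = ‖u'‖ ^ 2 := hzbar
  have habs : |ρ'| = ‖u'‖ := by
    rw [← abs_norm u']
    exact (sq_eq_sq_iff_abs_eq_abs _ _).mp hsq
  refine ⟨convex_univ, fun x _ y _ a b ha hb hab => ?_⟩
  obtain rfl : b = 1 - a := by linarith
  simp only [gIPM, Prod.mk_add_mk, Prod.smul_mk, smul_eq_mul]
  set V : ℝ → E2 := fun t => m + t • m' - (1 / 2 : ℝ) • ((ρ + t * ρ') • (u + t • u')) with hV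
  have hcomb : V (a * x + (1 - a) * y) =
      a • V x + (1 - a) • V y + (1 / 2 * (a * (1 - a)) * (x - y) ^ 2 * ρ') • u' := by
    simp only [hV]
    module
  have hnorm : ‖V (a * x + (1 - a) * y)‖ ≤
      a * ‖V x‖ + (1 - a) * ‖V y‖ + 1 / 2 * (a * (1 - a)) * (x - y) ^ 2 * ρ' ^ 2 := by
    rw [hcomb]
    refine norm_add₃_le.trans_eq ?_
    have hc : 0 ≤ 1 / 2 * (a * (1 - a)) * (x - y) ^ 2 := by positivity
    rw [norm_smul, norm_smul, norm_smul, Real.norm_of_nonneg ha, Real.norm_of_nonneg hb,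
      Real.norm_eq_abs, abs_mul, abs_of_nonneg hc, ← habs, mul_assoc _ |ρ'|, abs_mul_abs_self,
      sq ρ']
  simp only [hV] at hnorm
  linear_combination hnorm
end

section
/- Let γ > 1. For every z in the topological boundary of U_γ with z ∉ K_γ, there exist z̄ ∈ Λ with z̄ ≠ 0 and t₀ > 0 such that z + t z̄ belongs to the closure of U_γ for all t ∈ [−t₀, t₀]. -/
/-- K_γ = {(ρ,u,m) : |ρ| = 1, m = (1/2)ρu, |u| ≤ γ}. -/
def Kgamma (γ : ℝ) : Set (ℝ × E2 × E2) :=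
  {z | |z.1| = 1 ∧ z.2.2 = (1 / 2 : ℝ) • (z.1 • z.2.1) ∧ ‖z.2.1‖ ≤ γ}

/-- U_γ : the five strict inequalities defining the interior of the Λ-convex hull of K_γ. -/
def Ugamma (γ : ℝ) : Set (ℝ × E2 × E2) :=
  {z | |z.1| < 1 ∧
       ‖z.2.1‖ ^ 2 < γ ^ 2 - (1 - z.1 ^ 2) ∧
       ‖z.2.2 - (1 / 2 : ℝ) • (z.1 • z.2.1)‖ < (1 / 2) * (1 - z.1 ^ 2) ∧
       ‖z.2.2 - (1 / 2 : ℝ) • z.2.1‖ < γ / 2 * (1 - z.1) ∧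
       ‖z.2.2 + (1 / 2 : ℝ) • z.2.1‖ < γ / 2 * (1 + z.1)}

open Filter Topology

/-- The non-strict inequalities defining the closure of `Ugamma γ`, away from `|ρ| = 1`. -/
def RelaxedIneqs (γ ρ : ℝ) (u m : E2) : Prop :=
  |ρ| < 1 ∧
    ‖u‖ ^ 2 ≤ γ ^ 2 - (1 - ρ ^ 2) ∧
    ‖m - (1 / 2 : ℝ) • (ρ • u)‖ ≤ (1 / 2) * (1 - ρ ^ 2) ∧
    ‖m - (1 / 2 : ℝ) • u‖ ≤ γ / 2 * (1 - ρ) ∧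
    ‖m + (1 / 2 : ℝ) • u‖ ≤ γ / 2 * (1 + ρ)

lemma norm_neg_sub_half_smul_neg (ρ : ℝ) (u m : E2) :
    ‖-m - (1 / 2 : ℝ) • (-ρ • u)‖ = ‖m - (1 / 2 : ℝ) • (ρ • u)‖ := by
  rw [show -m - (1 / 2 : ℝ) • (-ρ • u) = -(m - (1 / 2 : ℝ) • (ρ • u)) by module, norm_neg]

lemma norm_neg_add_half_smul (u m : E2) :
    ‖-m + (1 / 2 : ℝ) • u‖ = ‖m - (1 / 2 : ℝ) • u‖ := by
  rw [show -m + (1 / 2 : ℝ) • u = -(m - (1 / 2 : ℝ) • u) by module, norm_neg]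

lemma norm_neg_sub_half_smul (u m : E2) :
    ‖-m - (1 / 2 : ℝ) • u‖ = ‖m + (1 / 2 : ℝ) • u‖ := by
  rw [show -m - (1 / 2 : ℝ) • u = -(m + (1 / 2 : ℝ) • u) by module, norm_neg]

lemma RelaxedIneqs.neg {γ ρ : ℝ} {u m : E2} (h : RelaxedIneqs γ ρ u m) :
    RelaxedIneqs γ (-ρ) u (-m) := by
  obtain ⟨h1, h2, h3, h4, h5⟩ := h
  refine ⟨by rwa [abs_neg], by rwa [neg_sq], ?_, ?_, ?_⟩
  · rwa [norm_neg_sub_half_smul_neg, neg_sq]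
  · rwa [norm_neg_sub_half_smul, sub_neg_eq_add]
  · rwa [norm_neg_add_half_smul, ← sub_eq_add_neg]

lemma RelaxedIneqs.mem_closure {γ ρ : ℝ} {u m : E2} (hγ : 1 < γ) (h : RelaxedIneqs γ ρ u m) :
    (ρ, u, m) ∈ closure (Ugamma γ) := by
  obtain ⟨h1, h2, h3, h4, h5⟩ := h
  have hρ := abs_lt.mp h1
  have hscale : ∀ δ ∈ Set.Ioo (0 : ℝ) 1, ∀ (v : E2) (R : ℝ), 0 < R → ‖v‖ ≤ R →
      ‖(1 - δ) • v‖ < R := by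
    intro δ hδ v R hR hv
    rw [norm_smul, Real.norm_of_nonneg (by linarith [hδ.2])]
    nlinarith [hδ.1, hδ.2, norm_nonneg v]
  have hlim : Tendsto (fun δ : ℝ => (ρ, (1 - δ) • u, (1 - δ) • m)) (𝓝[>] 0) (𝓝 (ρ, u, m)) := by
    have hc : Continuous (fun δ : ℝ => (ρ, (1 - δ) • u, (1 - δ) • m)) := by fun_prop
    simpa using (hc.tendsto 0).mono_left nhdsWithin_le_nhds
  refine mem_closure_of_tendsto hlim ?_
  filter_upwards [Ioo_mem_nhdsGT (zero_lt_one' ℝ)] with δ hδ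
  have hρ2 : 0 < 1 - ρ ^ 2 := by nlinarith
  refine ⟨h1, ?_, ?_, ?_, ?_⟩
  · have hR : 0 < γ ^ 2 - (1 - ρ ^ 2) := by nlinarith [sq_nonneg ρ]
    have := hscale δ hδ u _ (Real.sqrt_pos.mpr hR) (Real.le_sqrt_of_sq_le h2)
    exact (Real.lt_sqrt (norm_nonneg _)).mp this
  · convert hscale δ hδ _ _ (by positivity) h3 using 2
    module
  · convert hscale δ hδ _ _ (mul_pos (by linarith) (by linarith)) h4 using 2
    module
  · convert hscale δ hδ _ _ (mul_pos (by linarith) (by linarith)) h5 using 2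
    module

lemma closure_Ugamma_subset (γ : ℝ) :
    closure (Ugamma γ) ⊆ {z : ℝ × E2 × E2 | |z.1| ≤ 1 ∧
      ‖z.2.1‖ ^ 2 ≤ γ ^ 2 - (1 - z.1 ^ 2) ∧
      ‖z.2.2 - (1 / 2 : ℝ) • (z.1 • z.2.1)‖ ≤ (1 / 2) * (1 - z.1 ^ 2) ∧
      ‖z.2.2 - (1 / 2 : ℝ) • z.2.1‖ ≤ γ / 2 * (1 - z.1) ∧
      ‖z.2.2 + (1 / 2 : ℝ) • z.2.1‖ ≤ γ / 2 * (1 + z.1)} := by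
  refine closure_minimal (fun z hz => ⟨hz.1.le, hz.2.1.le, hz.2.2.1.le, hz.2.2.2.1.le,
    hz.2.2.2.2.le⟩) ?_
  simp only [Set.ofPred_and]
  refine (isClosed_le ?_ ?_).inter <| (isClosed_le ?_ ?_).inter <| (isClosed_le ?_ ?_).inter <|
    (isClosed_le ?_ ?_).inter (isClosed_le ?_ ?_) <;> fun_prop

lemma mem_Kgamma_of_abs_eq_one {γ : ℝ} (hγ : 0 ≤ γ) {z : ℝ × E2 × E2}
    (hz : z ∈ closure (Ugamma γ)) (hρ : |z.1| = 1) : z ∈ Kgamma γ := by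
  obtain ⟨-, h2, h3, -, -⟩ := closure_Ugamma_subset γ hz
  have hsq : z.1 ^ 2 = 1 := by rw [← sq_abs, hρ, one_pow]
  rw [hsq] at h2 h3
  refine ⟨hρ, ?_, ?_⟩
  · rw [← sub_eq_zero, ← norm_le_zero_iff]
    linarith
  · exact (sq_le_sq₀ (norm_nonneg _) hγ).mp (by linarith)

lemma exists_unit_inner_eq {u : E2} (hu : u ≠ 0) {r : ℝ} (hr : r ^ 2 ≤ ‖u‖ ^ 2) :
    ∃ ν : E2, ‖ν‖ = 1 ∧ inner ℝ u ν = r := by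
  have hpos : 0 < ‖u‖ ^ 2 := by positivity
  have hN : ‖u‖ ^ 2 = u 0 ^ 2 + u 1 ^ 2 := by
    simp [EuclideanSpace.norm_sq_eq]
  rw [hN] at hpos hr
  set N := u 0 ^ 2 + u 1 ^ 2 with hNdef
  set s := Real.sqrt (N - r ^ 2)
  have hs : s ^ 2 = N - r ^ 2 := Real.sq_sqrt (by linarith)
  refine ⟨!₂[(r * u 0 - s * u 1) / N, (r * u 1 + s * u 0) / N], ?_, ?_⟩
  · rw [← sq_eq_sq₀ (norm_nonneg _) zero_le_one]
    simp only [EuclideanSpace.norm_sq_eq, Fin.sum_univ_two, Real.norm_eq_abs, sq_abs]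
    simp only [Matrix.cons_val_zero, Matrix.cons_val_one]
    field_simp
    linear_combination (u 0 ^ 2 + u 1 ^ 2) * hs - N * hNdef
  · simp only [PiLp.inner_apply, Fin.sum_univ_two, RCLike.inner_apply, conj_trivial]
    simp only [Matrix.cons_val_zero, Matrix.cons_val_one]
    field_simp
    linear_combination - r * hNdef

lemma exists_direction_of_norm_eq {γ ρ : ℝ} {u m : E2} (h : RelaxedIneqs γ ρ u m)
    (h3 : ‖m - (1 / 2 : ℝ) • (ρ • u)‖ = (1 / 2) * (1 - ρ ^ 2)) :
    ∃ ν w : E2, ‖ν‖ = 1 ∧ ∀ᶠ t : ℝ in 𝓝 0, RelaxedIneqs γ (ρ + t) (u + t • ν) (m + t • w) := by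
  obtain ⟨h1, -, -, h4, h5⟩ := h
  have hρ := abs_lt.mp h1
  have hρ2 : 0 < 1 - ρ ^ 2 := by nlinarith
  have hm : 0 < 1 - ρ := by linarith
  have hp : 0 < 1 + ρ := by linarith
  obtain ⟨e, he⟩ : ∃ e : E2, e = (2 / (1 - ρ ^ 2)) • (m - (1 / 2 : ℝ) • (ρ • u)) := ⟨_, rfl⟩
  have hme : m = (ρ / 2) • u + ((1 - ρ ^ 2) / 2) • e := by
    rw [he]
    match_scalars <;> field_simp
    ring
  have hnorm : ‖e‖ = 1 := by
    rw [he, norm_smul, h3, Real.norm_of_nonneg (by positivity)]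
    field_simp
  clear he h3
  subst hme
  have ha : ‖u - (1 + ρ) • e‖ ≤ γ := by
    have : (ρ / 2) • u + ((1 - ρ ^ 2) / 2) • e - (1 / 2 : ℝ) • u
        = -(((1 - ρ) / 2) • (u - (1 + ρ) • e)) := by module
    rw [this, norm_neg, norm_smul, Real.norm_of_nonneg (by positivity)] at h4
    nlinarith
  have hb : ‖u + (1 - ρ) • e‖ ≤ γ := by
    have : (ρ / 2) • u + ((1 - ρ ^ 2) / 2) • e + (1 / 2 : ℝ) • u
        = ((1 + ρ) / 2) • (u + (1 - ρ) • e) := by module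
    rw [this, norm_smul, Real.norm_of_nonneg (by positivity)] at h5
    nlinarith
  have e1 : ∀ᶠ t : ℝ in 𝓝 0, |ρ + t| < 1 :=
    ContinuousAt.eventually_lt (by fun_prop) (by fun_prop) (by simpa using h1)
  refine ⟨e, (1 / 2 : ℝ) • (u - ρ • e), hnorm, ?_⟩
  filter_upwards [e1] with t t1
  have ht := abs_lt.mp t1
  have htm : 0 < 1 - (ρ + t) := by linarith
  have htp : 0 < 1 + (ρ + t) := by linarith
  refine ⟨t1, ?_, ?_, ?_, ?_⟩
  · have qa : ‖u - (1 + ρ) • e‖ ^ 2 ≤ γ ^ 2 := by gcongr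
    have qb : ‖u + (1 - ρ) • e‖ ^ 2 ≤ γ ^ 2 := by gcongr
    simp only [norm_add_sq_real, norm_sub_sq_real, norm_smul, inner_smul_right, mul_pow,
      Real.norm_eq_abs, sq_abs, hnorm] at qa qb ⊢
    linarith [mul_le_mul_of_nonneg_left qa htm.le, mul_le_mul_of_nonneg_left qb htp.le]
  · have : (ρ / 2) • u + ((1 - ρ ^ 2) / 2) • e + t • (1 / 2 : ℝ) • (u - ρ • e)
        - (1 / 2 : ℝ) • ((ρ + t) • (u + t • e)) = ((1 - (ρ + t) ^ 2) / 2) • e := by module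
    rw [this, norm_smul, hnorm, Real.norm_of_nonneg (by nlinarith)]
    linarith
  · have : (ρ / 2) • u + ((1 - ρ ^ 2) / 2) • e + t • (1 / 2 : ℝ) • (u - ρ • e)
        - (1 / 2 : ℝ) • (u + t • e) = -(((1 - (ρ + t)) / 2) • (u - (1 + ρ) • e)) := by module
    rw [this, norm_neg, norm_smul, Real.norm_of_nonneg (by positivity)]
    nlinarith
  · have : (ρ / 2) • u + ((1 - ρ ^ 2) / 2) • e + t • (1 / 2 : ℝ) • (u - ρ • e)
        + (1 / 2 : ℝ) • (u + t • e) = ((1 + (ρ + t)) / 2) • (u + (1 - ρ) • e) := by module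
    rw [this, norm_smul, Real.norm_of_nonneg (by positivity)]
    nlinarith

lemma eventually_norm_add_smul_sq_le {γ ρ : ℝ} {u ν : E2} (hν : ‖ν‖ = 1)
    (h2 : ‖u‖ ^ 2 < γ ^ 2 - (1 - ρ ^ 2) ∨
      ‖u‖ ^ 2 = γ ^ 2 - (1 - ρ ^ 2) ∧ inner ℝ u ν = ρ) :
    ∀ᶠ t : ℝ in 𝓝 0, ‖u + t • ν‖ ^ 2 ≤ γ ^ 2 - (1 - (ρ + t) ^ 2) := by
  rcases h2 with h2 | ⟨h2, hin⟩
  · have : ∀ᶠ t : ℝ in 𝓝 0, ‖u + t • ν‖ ^ 2 < γ ^ 2 - (1 - (ρ + t) ^ 2) :=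
      ContinuousAt.eventually_lt (by fun_prop) (by fun_prop) (by simpa using h2)
    exact this.mono fun t ht => ht.le
  · refine .of_forall fun t => ?_
    rw [norm_add_sq_real, inner_smul_right, norm_smul, hin, hν, h2, mul_one, Real.norm_eq_abs,
      sq_abs]
    linarith

lemma exists_unit_compatible {γ ρ : ℝ} (hγ : 1 < γ) {u : E2}
    (h2 : ‖u‖ ^ 2 ≤ γ ^ 2 - (1 - ρ ^ 2)) :
    ∃ ν : E2, ‖ν‖ = 1 ∧ (‖u‖ ^ 2 < γ ^ 2 - (1 - ρ ^ 2) ∨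
      ‖u‖ ^ 2 = γ ^ 2 - (1 - ρ ^ 2) ∧ inner ℝ u ν = ρ) := by
  rcases h2.lt_or_eq with h2 | h2
  · obtain ⟨ν, hν⟩ := exists_norm_eq E2 zero_le_one
    exact ⟨ν, hν, .inl h2⟩
  · have hu : u ≠ 0 := by
      rintro rfl
      rw [norm_zero] at h2
      nlinarith [sq_nonneg ρ]
    obtain ⟨ν, hν, hin⟩ := exists_unit_inner_eq hu (r := ρ) (by nlinarith)
    exact ⟨ν, hν, .inr ⟨h2, hin⟩⟩

lemma exists_direction_of_lt {γ ρ : ℝ} (hγ : 1 < γ) {u m : E2} (h : RelaxedIneqs γ ρ u m)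
    (h3 : ‖m - (1 / 2 : ℝ) • (ρ • u)‖ < (1 / 2) * (1 - ρ ^ 2))
    (h5 : ‖m + (1 / 2 : ℝ) • u‖ < γ / 2 * (1 + ρ)) :
    ∃ ν w : E2, ‖ν‖ = 1 ∧ ∀ᶠ t : ℝ in 𝓝 0, RelaxedIneqs γ (ρ + t) (u + t • ν) (m + t • w) := by
  obtain ⟨h1, h2, -, h4, -⟩ := h
  obtain ⟨ν, hν, h2'⟩ := exists_unit_compatible hγ h2
  have hρ : 0 < 1 - ρ := by linarith [(abs_lt.mp h1).2]
  set w : E2 := (1 / 2 : ℝ) • ν - (1 - ρ)⁻¹ • (m - (1 / 2 : ℝ) • u) with hw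
  have e1 : ∀ᶠ t : ℝ in 𝓝 0, |ρ + t| < 1 :=
    ContinuousAt.eventually_lt (by fun_prop) (by fun_prop) (by simpa using h1)
  have e3 : ∀ᶠ t : ℝ in 𝓝 0, ‖(m + t • w) - (1 / 2 : ℝ) • ((ρ + t) • (u + t • ν))‖
      < (1 / 2) * (1 - (ρ + t) ^ 2) :=
    ContinuousAt.eventually_lt (by fun_prop) (by fun_prop) (by simpa using h3)
  have e5 : ∀ᶠ t : ℝ in 𝓝 0, ‖(m + t • w) + (1 / 2 : ℝ) • (u + t • ν)‖
      < γ / 2 * (1 + (ρ + t)) :=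
    ContinuousAt.eventually_lt (by fun_prop) (by fun_prop) (by simpa using h5)
  refine ⟨ν, w, hν, ?_⟩
  filter_upwards [e1, eventually_norm_add_smul_sq_le hν h2', e3, e5] with t t1 t2 t3 t5
  refine ⟨t1, t2, t3.le, ?_, t5.le⟩
  have ht : 0 ≤ 1 - (ρ + t) := by linarith [(abs_lt.mp t1).2]
  have key : (m + t • w) - (1 / 2 : ℝ) • (u + t • ν)
      = ((1 - (ρ + t)) / (1 - ρ)) • (m - (1 / 2 : ℝ) • u) := by
    rw [hw]
    match_scalars <;> field_simp <;> ring
  rw [key, norm_smul, Real.norm_of_nonneg (by positivity), div_mul_eq_mul_div, div_le_iff₀ hρ]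
  nlinarith

lemma not_both_eq {γ ρ : ℝ} {u m : E2} (h : RelaxedIneqs γ ρ u m)
    (h3 : ‖m - (1 / 2 : ℝ) • (ρ • u)‖ < (1 / 2) * (1 - ρ ^ 2))
    (h4 : ‖m - (1 / 2 : ℝ) • u‖ = γ / 2 * (1 - ρ)) :
    ‖m + (1 / 2 : ℝ) • u‖ < γ / 2 * (1 + ρ) := by
  refine h.2.2.2.2.lt_of_ne fun h5 => ?_
  obtain ⟨h1, h2, -, -, -⟩ := h
  have hρ := abs_lt.mp h1
  have hρ2 : 0 < 1 - ρ ^ 2 := by nlinarith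
  have q3 : ‖m - (1 / 2 : ℝ) • (ρ • u)‖ ^ 2 < ((1 / 2) * (1 - ρ ^ 2)) ^ 2 := by gcongr
  have q4 := congrArg (· ^ 2) h4
  have q5 := congrArg (· ^ 2) h5
  simp only [norm_add_sq_real, norm_sub_sq_real, norm_smul, inner_smul_right, mul_pow,
    Real.norm_eq_abs, sq_abs] at q3 q4 q5
  nlinarith

lemma exists_direction {γ ρ : ℝ} (hγ : 1 < γ) {u m : E2} (h : RelaxedIneqs γ ρ u m) :
    ∃ (r : ℝ) (ν w : E2), r ^ 2 = ‖ν‖ ^ 2 ∧ (r, ν, w) ≠ 0 ∧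
      ∀ᶠ t : ℝ in 𝓝 0, RelaxedIneqs γ (ρ + t * r) (u + t • ν) (m + t • w) := by
  have unit_case : ∀ {ρ : ℝ} {u m : E2}, (∃ ν w : E2, ‖ν‖ = 1 ∧
      ∀ᶠ t : ℝ in 𝓝 0, RelaxedIneqs γ (ρ + t) (u + t • ν) (m + t • w)) →
      ∃ (r : ℝ) (ν w : E2), r ^ 2 = ‖ν‖ ^ 2 ∧ (r, ν, w) ≠ 0 ∧
        ∀ᶠ t : ℝ in 𝓝 0, RelaxedIneqs γ (ρ + t * r) (u + t • ν) (m + t • w) := by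
    rintro ρ u m ⟨ν, w, hν, ht⟩
    exact ⟨1, ν, w, by rw [hν], by simp, by simpa using ht⟩
  rcases h.2.2.1.lt_or_eq with h3 | h3
  swap
  · exact unit_case (exists_direction_of_norm_eq h h3)
  by_cases h5 : ‖m + (1 / 2 : ℝ) • u‖ < γ / 2 * (1 + ρ)
  · exact unit_case (exists_direction_of_lt hγ h h3 h5)
  have h4 : ‖m - (1 / 2 : ℝ) • u‖ < γ / 2 * (1 - ρ) :=
    h.2.2.2.1.lt_of_ne fun h4 => h5 (not_both_eq h h3 h4)
  obtain ⟨r, ν, w, hr, hne, ht⟩ := unit_case (exists_direction_of_lt hγ h.neg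
    (by rwa [norm_neg_sub_half_smul_neg, neg_sq])
    (by rwa [norm_neg_add_half_smul, ← sub_eq_add_neg]))
  refine ⟨-r, ν, -w, by rwa [neg_sq], by simpa using hne, ht.mono fun t ht => ?_⟩
  convert ht.neg using 1
  · ring
  · module

theorem stmt4 (γ : ℝ) (hγ : 1 < γ) (z : ℝ × E2 × E2)
    (hz : z ∈ frontier (Ugamma γ)) (hzK : z ∉ Kgamma γ) :
    ∃ zbar ∈ LambdaIPM, zbar ≠ 0 ∧ ∃ t₀ > (0 : ℝ),
      ∀ t ∈ Set.Icc (-t₀) t₀, z + t • zbar ∈ closure (Ugamma γ) := by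
  have hcl := frontier_subset_closure hz
  obtain ⟨h1, hrest⟩ := closure_Ugamma_subset γ hcl
  have hlt : |z.1| < 1 :=
    h1.lt_of_ne fun h => hzK (mem_Kgamma_of_abs_eq_one (by linarith) hcl h)
  obtain ⟨r, ν, w, hr, hne, ht⟩ :=
    exists_direction (ρ := z.1) (u := z.2.1) (m := z.2.2) hγ ⟨hlt, hrest⟩
  obtain ⟨ε, hε, hball⟩ := Metric.eventually_nhds_iff.mp ht
  refine ⟨(r, ν, w), hr, hne, ε / 2, by positivity, fun t htmem => ?_⟩
  have habs : |t| < ε := (abs_le.mpr htmem).trans_lt (by linarith)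
  exact (hball (by rwa [Real.dist_0_eq_abs])).mem_closure hγ
end

section
/- Let γ ∈ ℝ, ρ ∈ ℝ with ρ ≠ 1, u, m ∈ ℝ², and e ∈ ℝ² with |e| = 1 and u·e = ρ. Define m̄ = (1/2)e − (1/(1−ρ))(m − (1/2)u), and for t ∈ ℝ set ρ_t = ρ + t, u_t = u + te, m_t = m + tm̄. Then: (i) if |u|² = γ² − (1 − ρ²), then |u_t|² = γ² − (1 − ρ_t²) for all t ∈ ℝ; and (ii) if |m − (1/2)u| = (γ/2)(1 − ρ) with γ ≥ 0, then |m_t − (1/2)u_t| = (γ/2)(1 − ρ_t) for all t ≤ 1 − ρ. -/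
open scoped RealInnerProductSpace

theorem stmt5 (γ ρ : ℝ) (hρ : ρ ≠ 1) (u m e : E2) (he : ‖e‖ = 1) (hue : ⟪u, e⟫ = ρ)
    (mbar : E2) (hmbar : mbar = (1 / 2 : ℝ) • e - (1 / (1 - ρ)) • (m - (1 / 2 : ℝ) • u)) :
    ((‖u‖ ^ 2 = γ ^ 2 - (1 - ρ ^ 2)) →
      ∀ t : ℝ, ‖u + t • e‖ ^ 2 = γ ^ 2 - (1 - (ρ + t) ^ 2)) ∧
    (0 ≤ γ → ‖m - (1 / 2 : ℝ) • u‖ = γ / 2 * (1 - ρ) →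
      ∀ t : ℝ, t ≤ 1 - ρ →
        ‖(m + t • mbar) - (1 / 2 : ℝ) • (u + t • e)‖ = γ / 2 * (1 - (ρ + t))) := by
  have hne : 1 - ρ ≠ 0 := sub_ne_zero.mpr hρ.symm
  refine ⟨fun h t => ?_, fun hγ h t ht => ?_⟩
  · rw [norm_add_sq_real, real_inner_smul_right, hue, norm_smul, he, mul_one,
      Real.norm_eq_abs, sq_abs, h]
    ring
  · have hvec : (m + t • mbar) - (1 / 2 : ℝ) • (u + t • e)
        = (1 - t / (1 - ρ)) • (m - (1 / 2 : ℝ) • u) := by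
      rw [hmbar]
      module
    rw [hvec, norm_smul, h, Real.norm_eq_abs]
    rcases lt_or_gt_of_ne hρ with hlt | hgt
    · have hpos : 0 < 1 - ρ := by linarith
      have hle : t / (1 - ρ) ≤ 1 := (div_le_one hpos).mpr ht
      rw [abs_of_nonneg (by linarith)]
      field_simp
      ring
    · have hnorm := norm_nonneg (m - (1 / 2 : ℝ) • u)
      rw [h] at hnorm
      have hγ0 : γ = 0 := by nlinarith
      simp [hγ0]
end

section
/- There exists a constant c > 0 with the following property: for every (ρ,u,m) ∈ U there exists (ρ̄,ū,m̄) ∈ Λ with ρ̄² + |m̄|² = 1 such that (ρ,u,m) + t(ρ̄,ū,m̄) ∈ U for all t ∈ ℝ with |t| < c(1 − ρ²). -/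
/-- U = the interior of the Λ-convex hull of K:
{(ρ,u,m) : |ρ| < 1, |m − (1/2)ρu| < (1/2)(1−ρ²)}. -/
def UIPM : Set (ℝ × E2 × E2) :=
  {z | |z.1| < 1 ∧ ‖z.2.2 - (1 / 2 : ℝ) • (z.1 • z.2.1)‖ < (1 / 2) * (1 - z.1 ^ 2)}

/-- Polar decomposition `w = ‖w‖ • e` with a unit vector `e`, including at `w = 0`. -/
theorem exists_unit_eq_norm_smul {E : Type*} [NormedAddCommGroup E] [NormedSpace ℝ E]
    [Nontrivial E] (w : E) : ∃ e : E, ‖e‖ = 1 ∧ w = ‖w‖ • e := by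
  by_cases hw : w = 0
  · obtain ⟨e, he⟩ := exists_norm_eq E zero_le_one
    exact ⟨e, he, by simp [hw]⟩
  · have hn : ‖w‖ ≠ 0 := norm_ne_zero_iff.mpr hw
    exact ⟨‖w‖⁻¹ • w, by simp [norm_smul, hn], by rw [smul_smul, mul_inv_cancel₀ hn, one_smul]⟩

/-- Along the direction `a • (1, e, (u - ρ e) / 2)` the difference of the two sides of the
inequality defining `UIPM` is constant as long as the left-hand side points along `e`. -/
theorem ipm_defect_along_direction {ρ r a t : ℝ} {u m e : E2}
    (h : m - (1 / 2 : ℝ) • (ρ • u) = r • e) :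
    m + t • (a • ((1 / 2 : ℝ) • (u - ρ • e))) -
        (1 / 2 : ℝ) • ((ρ + t * a) • (u + t • (a • e))) =
      (r - t * a * ρ - (t * a) ^ 2 / 2) • e := by
  rw [sub_eq_iff_eq_add] at h
  subst h
  module

theorem stmt6 :
    ∃ c > (0 : ℝ), ∀ z ∈ UIPM, ∃ zbar ∈ LambdaIPM,
      zbar.1 ^ 2 + ‖zbar.2.2‖ ^ 2 = 1 ∧
      ∀ t : ℝ, |t| < c * (1 - z.1 ^ 2) → z + t • zbar ∈ UIPM := by
  refine ⟨1 / 8, by norm_num, ?_⟩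
  rintro ⟨ρ, u, m⟩ ⟨hρ, hw⟩
  dsimp only at hρ hw
  obtain ⟨e, he, hwe⟩ := exists_unit_eq_norm_smul (m - (1 / 2 : ℝ) • (ρ • u))
  generalize hr : ‖m - (1 / 2 : ℝ) • (ρ • u)‖ = r at hw hwe
  have hr0 : 0 ≤ r := hr ▸ norm_nonneg _
  set v : E2 := (1 / 2 : ℝ) • (u - ρ • e) with hv
  obtain ⟨a, ha0, ha⟩ : ∃ a : ℝ, 0 ≤ a ∧ a ^ 2 * (1 + ‖v‖ ^ 2) = 1 := by
    refine ⟨(√(1 + ‖v‖ ^ 2))⁻¹, by positivity, ?_⟩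
    have h : 0 < 1 + ‖v‖ ^ 2 := by positivity
    rw [inv_pow, Real.sq_sqrt h.le, inv_mul_cancel₀ h.ne']
  have ha1 : a ≤ 1 := by nlinarith [mul_nonneg (sq_nonneg a) (sq_nonneg ‖v‖)]
  refine ⟨(a, a • e, a • v), ?_, ?_, fun t ht => ?_⟩
  · simp [LambdaIPM, norm_smul, he]
  · simp only [norm_smul, mul_pow, Real.norm_eq_abs, sq_abs]
    linarith
  have hs : |t * a| < 1 / 8 * (1 - ρ ^ 2) := by
    rw [abs_mul, abs_of_nonneg ha0]
    exact (mul_le_of_le_one_right (abs_nonneg t) ha1).trans_lt ht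
  change |ρ + t * a| < 1 ∧ ‖m + t • (a • v) -
    (1 / 2 : ℝ) • ((ρ + t * a) • (u + t • (a • e)))‖ < 1 / 2 * (1 - (ρ + t * a) ^ 2)
  rw [hv, ipm_defect_along_direction hwe, norm_smul, he, mul_one, Real.norm_eq_abs]
  generalize t * a = s at hs
  rw [abs_lt] at hρ hs
  obtain ⟨h1, h2⟩ := hρ
  obtain ⟨h3, h4⟩ := hs
  have hsρ : s * ρ < 1 / 8 * (1 - ρ ^ 2) := by
    have := abs_lt.mpr ⟨h3, h4⟩
    calc s * ρ ≤ |s| * |ρ| := (le_abs_self _).trans_eq (abs_mul s ρ)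
      _ ≤ |s| := mul_le_of_le_one_right (abs_nonneg s) (abs_le.mpr ⟨h1.le, h2.le⟩)
      _ < _ := this
  have hss : s ^ 2 < 1 / 8 * (1 - ρ ^ 2) := by
    nlinarith [sq_nonneg ρ, abs_nonneg s, abs_lt.mpr ⟨h3, h4⟩, sq_abs s]
  refine ⟨abs_lt.mpr ⟨by nlinarith, by nlinarith⟩, abs_lt.mpr ⟨by nlinarith, by nlinarith⟩⟩
end

section
/- Let γ > 2. For every α > 0 there exists β > 0, depending only on α and γ, such that for every z ∈ U_γ with dist(z, K_γ) ≥ α there exists z̄ ∈ Λ with |z̄| = 1 such that z + t z̄ ∈ U_γ whenever |t| < β. -/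
/-- The Euclidean distance on the 5-dimensional state space ℝ × ℝ² × ℝ². -/
noncomputable def dist5 (z w : ℝ × E2 × E2) : ℝ :=
  Real.sqrt ((z.1 - w.1) ^ 2 + ‖z.2.1 - w.2.1‖ ^ 2 + ‖z.2.2 - w.2.2‖ ^ 2)

open scoped RealInnerProductSpace

/-- The point of the state space lying on the segment from `(-1, q, -q/2)` to `(1, p, p/2)`,
with weight `l` on the second endpoint. -/
noncomputable def segmentPoint (l : ℝ) (p q : E2) : ℝ × E2 × E2 :=
  (2 * l - 1, l • p + (1 - l) • q, (1 / 2 : ℝ) • (l • p - (1 - l) • q))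

/-- The reflection exchanging the two endpoints `ρ = 1` and `ρ = -1`. -/
def reflect (z : ℝ × E2 × E2) : ℝ × E2 × E2 := (-z.1, z.2.1, -z.2.2)

theorem segmentPoint_mem_Ugamma_iff {γ l : ℝ} {p q : E2} (h0 : 0 < l) (h1 : l < 1) :
    segmentPoint l p q ∈ Ugamma γ ↔
      ‖p‖ < γ ∧ ‖q‖ < γ ∧ ‖p - q‖ < 2 ∧
        ‖l • p + (1 - l) • q‖ ^ 2 < γ ^ 2 - 4 * (l * (1 - l)) := by
  have hl : 0 < 1 - l := by linarith
  have hll : 0 < l * (1 - l) := mul_pos h0 hl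
  have e3 : (1 / 2 : ℝ) • (l • p - (1 - l) • q) -
      (1 / 2 : ℝ) • ((2 * l - 1) • (l • p + (1 - l) • q)) = (l * (1 - l)) • (p - q) := by
    module
  have e4 : (1 / 2 : ℝ) • (l • p - (1 - l) • q) - (1 / 2 : ℝ) • (l • p + (1 - l) • q) =
      (-(1 - l)) • q := by module
  have e5 : (1 / 2 : ℝ) • (l • p - (1 - l) • q) + (1 / 2 : ℝ) • (l • p + (1 - l) • q) =
      l • p := by module
  simp only [Ugamma, segmentPoint, Set.mem_ofPred_eq, e3, e4, e5, norm_smul, Real.norm_eq_abs,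
    abs_neg, abs_of_pos h0, abs_of_pos hl, abs_of_pos hll]
  have r2 : γ ^ 2 - (1 - (2 * l - 1) ^ 2) = γ ^ 2 - 4 * (l * (1 - l)) := by ring
  have r3 : 1 / 2 * (1 - (2 * l - 1) ^ 2) = l * (1 - l) * 2 := by ring
  have r4 : γ / 2 * (1 - (2 * l - 1)) = (1 - l) * γ := by ring
  have r5 : γ / 2 * (1 + (2 * l - 1)) = l * γ := by ring
  rw [r2, r3, r4, r5, mul_lt_mul_iff_right₀ hll, mul_lt_mul_iff_right₀ hl,
    mul_lt_mul_iff_right₀ h0]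
  have : |2 * l - 1| < 1 := abs_lt.2 ⟨by linarith, by linarith⟩
  tauto

theorem exists_eq_segmentPoint {γ : ℝ} {z : ℝ × E2 × E2} (hz : z ∈ Ugamma γ) :
    ∃ l p q, 0 < l ∧ l < 1 ∧ z = segmentPoint l p q := by
  obtain ⟨ρ, u, m⟩ := z
  have hρ := abs_lt.1 hz.1
  simp only at hρ
  have h1 : 1 + ρ ≠ 0 := by linarith
  have h2 : 1 - ρ ≠ 0 := by linarith
  refine ⟨(1 + ρ) / 2, (2 / (1 + ρ)) • (m + (1 / 2 : ℝ) • u),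
    (2 / (1 - ρ)) • ((1 / 2 : ℝ) • u - m), by linarith, by linarith, ?_⟩
  have a1 : (1 + ρ) / 2 * (2 / (1 + ρ)) = 1 := by field_simp
  have a2 : (1 - (1 + ρ) / 2) * (2 / (1 - ρ)) = 1 := by field_simp; ring
  simp only [segmentPoint, smul_smul, a1, a2, one_smul, Prod.mk.injEq]
  refine ⟨by ring, by module, by module⟩

theorem reflect_mem_Ugamma {γ : ℝ} {z : ℝ × E2 × E2} (hz : z ∈ Ugamma γ) :
    reflect z ∈ Ugamma γ := by
  obtain ⟨h1, h2, h3, h4, h5⟩ := hz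
  refine ⟨?_, ?_, ?_, ?_, ?_⟩ <;> simp only [reflect]
  · rwa [abs_neg]
  · rwa [neg_sq]
  · rw [← norm_neg, neg_sq]
    convert h3 using 1
    congr 1
    module
  · rw [← norm_neg, sub_neg_eq_add]
    convert h5 using 1
    · congr 1
      module
  · rw [← norm_neg, ← sub_eq_add_neg]
    convert h4 using 1
    congr 1
    module

theorem reflect_segmentPoint (l : ℝ) (p q : E2) :
    reflect (segmentPoint l p q) = segmentPoint (1 - l) q p := by
  simp only [reflect, segmentPoint, Prod.mk.injEq]
  refine ⟨by ring, by module, by module⟩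

theorem reflect_mem_Kgamma {γ : ℝ} {z : ℝ × E2 × E2} (hz : z ∈ Kgamma γ) :
    reflect z ∈ Kgamma γ := by
  obtain ⟨h1, h2, h3⟩ := hz
  refine ⟨?_, ?_, h3⟩ <;> simp only [reflect]
  · rwa [abs_neg]
  · rw [h2]
    module

theorem dist5_reflect (z w : ℝ × E2 × E2) : dist5 (reflect z) (reflect w) = dist5 z w := by
  have : -z.2.2 - -w.2.2 = -(z.2.2 - w.2.2) := by abel
  simp only [dist5, reflect, this, norm_neg]
  congr 3
  ring

theorem le_mul_of_le_dist5_Kgamma {γ α l : ℝ} {p q : E2} (hγ : 0 < γ) (h0 : 0 < l)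
    (hp : ‖p‖ < γ) (hq : ‖q‖ < γ) (hpq : ‖p - q‖ < 2)
    (h : ∀ w ∈ Kgamma γ, α ≤ dist5 (segmentPoint l p q) w) : α ≤ l * (γ + 3) := by
  have hw : ((-1, q, (-(1 / 2) : ℝ) • q) : ℝ × E2 × E2) ∈ Kgamma γ := by
    refine ⟨by norm_num, ?_, hq.le⟩
    simp only
    module
  refine (h _ hw).trans ?_
  have e1 : l • p + (1 - l) • q - q = l • (p - q) := by module
  have e2 : (1 / 2 : ℝ) • (l • p - (1 - l) • q) - (-(1 / 2) : ℝ) • q = (l / 2) • (p + q) := by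
    module
  simp only [dist5, segmentPoint, e1, e2, norm_smul, Real.norm_eq_abs, abs_of_pos h0,
    abs_of_pos (half_pos h0)]
  refine Real.sqrt_le_iff.2 ⟨by positivity, ?_⟩
  have hs : ‖p + q‖ ≤ 2 * γ := (norm_add_le p q).trans (by linarith)
  have h4 : ‖p - q‖ ^ 2 ≤ 2 ^ 2 := by gcongr
  have h5 : ‖p + q‖ ^ 2 ≤ (2 * γ) ^ 2 := by gcongr
  have h6 : (0 : ℝ) ≤ l ^ 2 := sq_nonneg l
  nlinarith [mul_le_mul_of_nonneg_left h4 h6, mul_le_mul_of_nonneg_left h5 h6,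
    mul_nonneg h6 hγ.le]

theorem E2.norm_sq (v : E2) : ‖v‖ ^ 2 = v 0 ^ 2 + v 1 ^ 2 := by
  simp [EuclideanSpace.norm_sq_eq, Fin.sum_univ_two]

theorem E2.inner_eq (v w : E2) : ⟪v, w⟫ = v 0 * w 0 + v 1 * w 1 := by
  simp [PiLp.inner_apply, Fin.sum_univ_two]
  ring

/-- A unit vector `v` can be turned into one with prescribed component `ρ` along `u`, at a cost
proportional to the error in that component. -/
theorem exists_unit_inner_eq_s7 {u v : E2} {ρ B : ℝ} (hv : ‖v‖ = 1) (hk : 1 ≤ ‖u‖ ^ 2 - ρ ^ 2)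
    (hB : |⟪u, v⟫ + ρ| ≤ B) :
    ∃ e : E2, ‖e‖ = 1 ∧ ⟪u, e⟫ = ρ ∧ ‖e - v‖ ≤ (1 + B) * |⟪u, v⟫ - ρ| := by
  set x := ⟪u, v⟫ with hx
  set y := u 0 * v 1 - u 1 * v 0 with hy
  have hu1 : 1 ≤ ‖u‖ ^ 2 := by nlinarith [sq_nonneg ρ]
  have hN := E2.norm_sq u
  have hV : v 0 ^ 2 + v 1 ^ 2 = 1 := by rw [← E2.norm_sq, hv]; norm_num
  have hx' : x = u 0 * v 0 + u 1 * v 1 := E2.inner_eq u v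
  have hxy : x ^ 2 + y ^ 2 = ‖u‖ ^ 2 := by
    rw [hx', hy, hN]
    linear_combination (u 0 ^ 2 + u 1 ^ 2) * hV
  obtain ⟨y', hy', hyy⟩ : ∃ y' : ℝ, y' ^ 2 = ‖u‖ ^ 2 - ρ ^ 2 ∧ 0 ≤ y' * y := by
    have hs : √(‖u‖ ^ 2 - ρ ^ 2) ^ 2 = ‖u‖ ^ 2 - ρ ^ 2 := Real.sq_sqrt (by linarith)
    rcases le_total 0 y with h | h
    · exact ⟨_, hs, mul_nonneg (Real.sqrt_nonneg _) h⟩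
    · exact ⟨-√(‖u‖ ^ 2 - ρ ^ 2), by rw [neg_sq, hs],
        mul_nonneg_of_nonpos_of_nonpos (neg_nonpos.2 (Real.sqrt_nonneg _)) h⟩
  set N := ‖u‖ ^ 2 with hNdef
  have hN0 : N ≠ 0 := by linarith
  have hydiff : (y' - y) ^ 2 ≤ (x ^ 2 - ρ ^ 2) ^ 2 := by
    have h1 : x ^ 2 - ρ ^ 2 = (y' - y) * (y' + y) := by linear_combination hxy - hy'
    have h2 : 1 ≤ (y' + y) ^ 2 := by nlinarith [sq_nonneg y]
    rw [h1, mul_pow]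
    nlinarith [mul_le_mul_of_nonneg_left h2 (sq_nonneg (y' - y))]
  have hB0 : 0 ≤ B := (abs_nonneg _).trans hB
  refine ⟨!₂[(ρ * u 0 - y' * u 1) / N, (ρ * u 1 + y' * u 0) / N], ?_, ?_, ?_⟩
  · rw [← sq_eq_sq₀ (norm_nonneg _) zero_le_one, E2.norm_sq]
    simp
    field_simp
    linear_combination N * hy' - (ρ ^ 2 + y' ^ 2) * hN
  · rw [E2.inner_eq]
    simp
    field_simp
    linear_combination - ρ * hN
  · refine abs_le_of_sq_le_sq' ?_ (by positivity) |>.2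
    have hE : ‖!₂[(ρ * u 0 - y' * u 1) / N, (ρ * u 1 + y' * u 0) / N] - v‖ ^ 2 * N =
        (x - ρ) ^ 2 + (y' - y) ^ 2 := by
      rw [E2.norm_sq]
      simp
      have v0 : v 0 = (x * u 0 - y * u 1) / N := by
        rw [eq_div_iff hN0, hx', hy]; linear_combination v 0 * hN
      have v1 : v 1 = (x * u 1 + y * u 0) / N := by
        rw [eq_div_iff hN0, hx', hy]; linear_combination v 1 * hN
      rw [v0, v1]
      field_simp
      linear_combination -((x - ρ) ^ 2 + (y' - y) ^ 2) * hN
    have hE2 : ‖!₂[(ρ * u 0 - y' * u 1) / N, (ρ * u 1 + y' * u 0) / N] - v‖ ^ 2 ≤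
        (x - ρ) ^ 2 + (y' - y) ^ 2 := by
      rw [← hE]
      exact le_mul_of_one_le_right (sq_nonneg _) hu1
    have hsum : (x + ρ) ^ 2 ≤ B ^ 2 := sq_le_sq' (abs_le.1 hB).1 (abs_le.1 hB).2
    have h4 : (x ^ 2 - ρ ^ 2) ^ 2 ≤ (x - ρ) ^ 2 * B ^ 2 := by
      have : (x ^ 2 - ρ ^ 2) ^ 2 = (x - ρ) ^ 2 * (x + ρ) ^ 2 := by ring
      rw [this]
      gcongr
    rw [mul_pow, sq_abs]
    nlinarith [mul_nonneg hB0 (sq_nonneg (x - ρ))]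

theorem E2.exists_unit_smul_eq (n : E2) : ∃ v : E2, ‖v‖ = 1 ∧ n = ‖n‖ • v := by
  rcases eq_or_ne n 0 with rfl | h
  · exact ⟨EuclideanSpace.single 0 1, by simp, by simp⟩
  · have h' : ‖n‖ ≠ 0 := norm_ne_zero_iff.2 h
    exact ⟨‖n‖⁻¹ • n, by rw [norm_smul, norm_inv, norm_norm, inv_mul_cancel₀ h'],
      by rw [smul_smul, mul_inv_cancel₀ h', one_smul]⟩

theorem norm_sq_convex_comb (l : ℝ) (p q : E2) :
    ‖l • p + (1 - l) • q‖ ^ 2 =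
      l * ‖p‖ ^ 2 + (1 - l) * ‖q‖ ^ 2 - l * (1 - l) * ‖p - q‖ ^ 2 := by
  simp only [E2.norm_sq, PiLp.add_apply, PiLp.sub_apply, PiLp.smul_apply, smul_eq_mul]
  ring

theorem mul_abs_sub_le_convex_comb {c l a b : ℝ} (hc : 0 < c) (hcl : c ≤ l) (hcl' : c ≤ 1 - l)
    (ha : 0 ≤ a) (hb : 0 ≤ b) : c * |a - b| ≤ l * a + (1 - l) * b := by
  have h1 := mul_le_mul_of_nonneg_right hcl ha
  have h2 := mul_le_mul_of_nonneg_right hcl' hb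
  have h3 := mul_nonneg hc.le ha
  have h4 := mul_nonneg hc.le hb
  rcases abs_cases (a - b) with ⟨h, -⟩ | ⟨h, -⟩ <;> rw [h] <;> linarith

theorem mul_one_sub_le_quarter (l : ℝ) : l * (1 - l) ≤ 1 / 4 := by
  nlinarith [sq_nonneg (l - 1 / 2)]

theorem half_le_mul_one_sub {c l : ℝ} (hc : 0 < c) (hcl : c ≤ l) (hcl' : c ≤ 1 - l) :
    c / 2 ≤ l * (1 - l) := by
  rcases le_total l (1 / 2) with h | h <;> nlinarith

/-- The direction `e` of the velocity variation: it nearly aligns `p - q` with `2 e`, while the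
constraint on `|u|² - ρ²` changes at a rate controlled by its own slack. -/
theorem exists_velocity_direction {γ c l : ℝ} {p q : E2} (hγ : 2 < γ) (hc : 0 < c)
    (hcl : c ≤ l) (hcl' : c ≤ 1 - l) (hp : ‖p‖ < γ) (hq : ‖q‖ < γ) (hpq : ‖p - q‖ < 2)
    (hF : ‖l • p + (1 - l) • q‖ ^ 2 < γ ^ 2 - 4 * (l * (1 - l))) :
    ∃ e : E2, ‖e‖ = 1 ∧
      ‖p - q - (2 : ℝ) • e‖ ≤
        (1 + 2 * (γ + 2) * (1 / c + γ + 1)) * (4 - ‖p - q‖ ^ 2) ∧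
      |⟪l • p + (1 - l) • q, e⟫ - (2 * l - 1)| ≤
        (1 / c) * (γ ^ 2 - 4 * (l * (1 - l)) - ‖l • p + (1 - l) • q‖ ^ 2) := by
  obtain ⟨v, hv, hn⟩ := E2.exists_unit_smul_eq (p - q)
  have hcomb := norm_sq_convex_comb l p q
  have hrx : ‖p - q‖ * ⟪l • p + (1 - l) • q, v⟫ =
      (‖p‖ ^ 2 - ‖q‖ ^ 2) / 2 + (2 * l - 1) * ‖p - q‖ ^ 2 / 2 := by
    rw [← real_inner_smul_right, ← hn]
    simp only [E2.norm_sq, E2.inner_eq, PiLp.add_apply, PiLp.sub_apply, PiLp.smul_apply,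
      smul_eq_mul]
    ring
  have hu : ‖l • p + (1 - l) • q‖ < γ := by
    refine abs_lt_of_sq_lt_sq' ?_ (by linarith) |>.2
    nlinarith
  have hxu : |⟪l • p + (1 - l) • q, v⟫| ≤ ‖l • p + (1 - l) • q‖ := by
    simpa [hv] using abs_real_inner_le_norm (l • p + (1 - l) • q) v
  have hwv : ‖p - q - (2 : ℝ) • v‖ = 2 - ‖p - q‖ := by
    have : p - q - (2 : ℝ) • v = (‖p - q‖ - 2) • v := by
      nth_rewrite 1 [hn]
      module
    rw [this, norm_smul, hv, Real.norm_eq_abs, abs_of_neg (by linarith)]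
    ring
  set u := l • p + (1 - l) • q
  set R := ‖p - q‖
  set x := ⟪u, v⟫
  set ρ := 2 * l - 1 with hρdef
  set F := γ ^ 2 - 4 * (l * (1 - l)) - ‖u‖ ^ 2 with hFdef
  have hF0 : 0 < F := by linarith
  have hR0 : 0 ≤ R := norm_nonneg _
  have hd : 2 - R ≤ 4 - R ^ 2 := by nlinarith
  have hd0 : 0 < 4 - R ^ 2 := by linarith
  have hC0 : 0 ≤ 2 * (γ + 2) * (1 / c + γ + 1) := by positivity
  have hρ : |ρ| ≤ 1 := abs_le.2 ⟨by linarith, by linarith⟩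
  have hxρ : |x - ρ| ≤ γ + 1 := (abs_sub _ _).trans (by linarith)
  rcases le_total |x - ρ| (1 / c * F) with hsmall | hlarge
  · refine ⟨v, hv, ?_, hsmall⟩
    rw [hwv]
    nlinarith [mul_nonneg hC0 hd0.le]
  · have hFx : F ≤ c * |x - ρ| := by
      calc F = c * (1 / c * F) := by field_simp
        _ ≤ _ := by gcongr
    have hD : |x - ρ| ≤ (1 / c + γ + 1) * (4 - R ^ 2) := by
      rcases le_total R 1 with hR | hR
      · have h1 : γ + 1 ≤ 1 / c + γ + 1 := by linarith [one_div_pos.2 hc]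
        have h2 : 1 ≤ 4 - R ^ 2 := by nlinarith only [hR, hR0]
        exact hxρ.trans (h1.trans (le_mul_of_one_le_right (by linarith) h2))
      · have hcab : c * |‖p‖ ^ 2 - ‖q‖ ^ 2| ≤ F + (4 - R ^ 2) / 4 := by
          have ha : 0 ≤ γ ^ 2 - ‖p‖ ^ 2 := sub_nonneg.2 (by gcongr)
          have hb : 0 ≤ γ ^ 2 - ‖q‖ ^ 2 := sub_nonneg.2 (by gcongr)
          have hFe : F = l * (γ ^ 2 - ‖p‖ ^ 2) + (1 - l) * (γ ^ 2 - ‖q‖ ^ 2) -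
              l * (1 - l) * (4 - R ^ 2) := by rw [hFdef, hcomb]; ring
          have hq4 : l * (1 - l) * (4 - R ^ 2) ≤ 1 / 4 * (4 - R ^ 2) := by
            gcongr
            exact mul_one_sub_le_quarter l
          have h := mul_abs_sub_le_convex_comb hc hcl hcl' ha hb
          rw [sub_sub_sub_cancel_left, abs_sub_comm] at h
          linarith
        have hkey : R * (x - ρ) = (‖p‖ ^ 2 - ‖q‖ ^ 2) / 2 - ρ * R * (2 - R) / 2 := by
          linear_combination hrx
        have hkey' : R * |x - ρ| ≤ |‖p‖ ^ 2 - ‖q‖ ^ 2| / 2 + (4 - R ^ 2) / 2 := by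
          rw [← abs_of_nonneg hR0, ← abs_mul, abs_of_nonneg hR0, hkey]
          refine (abs_sub _ _).trans ?_
          rw [abs_div, abs_div, abs_mul, abs_mul, abs_of_nonneg hR0,
            abs_of_pos (show 0 < 2 - R by linarith), abs_two]
          have : |ρ| * R * (2 - R) ≤ 1 * R * (2 - R) := by
            gcongr
          linarith only [this, show 1 * R * (2 - R) ≤ 4 - R ^ 2 by nlinarith only [hpq]]
        have hT : c * |x - ρ| ≤ (1 + c) * (4 - R ^ 2) := by
          have : |x - ρ| ≤ R * |x - ρ| := le_mul_of_one_le_left (abs_nonneg _) hR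
          have h2 := mul_le_mul_of_nonneg_left (this.trans hkey') hc.le
          have h3 : 0 ≤ c * (4 - R ^ 2) := by positivity
          linarith only [h2, hcab, hFx, h3, hd0]
        have : |x - ρ| ≤ (1 / c + 1) * (4 - R ^ 2) := by
          have : (1 / c + 1) * (4 - R ^ 2) = (1 + c) * (4 - R ^ 2) / c := by field_simp
          rw [this, le_div_iff₀ hc]
          linarith
        refine this.trans ?_
        gcongr
        linarith
    have hk : 1 ≤ ‖u‖ ^ 2 - ρ ^ 2 := by
      have h1 : ‖u‖ ^ 2 - ρ ^ 2 = γ ^ 2 - 1 - F := by rw [hFdef, hρdef]; ring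
      have h2 : F ≤ 1 / 2 * (γ + 1) := hFx.trans (by gcongr; linarith)
      rw [h1]
      nlinarith only [h2, hγ]
    obtain ⟨e, he, hue, hev⟩ := exists_unit_inner_eq_s7 (B := γ + 1) hv hk
      ((abs_add_le _ _).trans (by linarith))
    refine ⟨e, he, ?_, ?_⟩
    · have hsplit : p - q - (2 : ℝ) • e = (p - q - (2 : ℝ) • v) - (2 : ℝ) • (e - v) := by module
      rw [hsplit]
      refine (norm_sub_le _ _).trans ?_
      rw [hwv, norm_smul, Real.norm_eq_abs, abs_two]
      have : ‖e - v‖ ≤ (γ + 2) * ((1 / c + γ + 1) * (4 - R ^ 2)) :=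
        hev.trans (by rw [show 1 + (γ + 1) = γ + 2 by ring]; gcongr)
      linarith
    · rw [hue, sub_self, abs_zero]
      positivity

/-- Moving along `(2, 2e, p - e)` keeps `p` fixed and moves `q` slightly. -/
theorem segmentPoint_add_smul {l s : ℝ} (p q e : E2) (h : 1 - l - s ≠ 0) :
    segmentPoint l p q + s • ((2, (2 : ℝ) • e, p - e) : ℝ × E2 × E2) =
      segmentPoint (l + s) p (q - (s / (1 - l - s)) • (p - q - (2 : ℝ) • e)) := by
  have h' : (1 - (l + s)) * (s / (1 - l - s)) = s := by
    rw [show 1 - (l + s) = 1 - l - s by ring, mul_div_cancel₀ _ h]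
  simp only [segmentPoint, Prod.smul_mk, Prod.mk_add_mk, Prod.mk.injEq, smul_sub (1 - (l + s)),
    smul_smul, h', smul_eq_mul]
  refine ⟨by ring, by module, by module⟩

theorem segmentPoint_add_smul_mem {γ c C l s : ℝ} {p q e : E2} (hγ : 2 < γ) (hc : 0 < c)
    (hC : 1 / c ≤ C) (hcl : c ≤ l) (hcl' : c ≤ 1 - l) (hqp : ‖q‖ ≤ ‖p‖)
    (hp : ‖p‖ < γ) (hq : ‖q‖ < γ) (hpq : ‖p - q‖ < 2)
    (hF : ‖l • p + (1 - l) • q‖ ^ 2 < γ ^ 2 - 4 * (l * (1 - l))) (he : ‖e‖ = 1)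
    (hw : ‖p - q - (2 : ℝ) • e‖ ≤ C * (4 - ‖p - q‖ ^ 2))
    (hue : |⟪l • p + (1 - l) • q, e⟫ - (2 * l - 1)| ≤
      (1 / c) * (γ ^ 2 - 4 * (l * (1 - l)) - ‖l • p + (1 - l) • q‖ ^ 2))
    (hs : |s| < c ^ 2 / (8 * γ * C)) :
    segmentPoint l p q + s • ((2, (2 : ℝ) • e, p - e) : ℝ × E2 × E2) ∈ Ugamma γ := by
  have hc2 : c ≤ 1 / 2 := by linarith
  have hcC : 1 ≤ C * c := (div_le_iff₀ hc).1 hC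
  have hC2 : 2 ≤ C := by nlinarith
  have hs1 : |s| * (8 * γ * C) < c ^ 2 := (lt_div_iff₀ (by positivity)).1 hs
  have hsC : |s| * C < c ^ 2 / (8 * γ) := by
    rw [lt_div_iff₀ (by positivity)]; linarith
  have hsC' : |s| * C < c / 32 := by
    have : 0 ≤ |s| * C := by positivity
    nlinarith
  have hs2 : |s| < c / 2 := by nlinarith [abs_nonneg s]
  obtain ⟨hs3, hs4⟩ := abs_lt.1 hs2
  have hden : c / 2 ≤ 1 - l - s := by linarith
  have hden0 : 0 < 1 - l - s := by linarith
  rw [segmentPoint_add_smul p q e hden0.ne',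
    segmentPoint_mem_Ugamma_iff (by linarith) (by linarith)]
  have hu : (l + s) • p + (1 - (l + s)) • (q - (s / (1 - l - s)) • (p - q - (2 : ℝ) • e)) =
      l • p + (1 - l) • q + (2 * s) • e := by
    have := congrArg (fun z => z.2.1) (segmentPoint_add_smul p q e hden0.ne')
    simp only [segmentPoint, Prod.snd_add, Prod.fst_add, Prod.smul_mk] at this
    rw [← this]
    module
  have hd0 : 0 < 4 - ‖p - q‖ ^ 2 := by nlinarith [norm_nonneg (p - q)]
  have hσ : |s / (1 - l - s)| * C < c / (4 * γ) := by
    rw [abs_div, abs_of_pos hden0, div_mul_eq_mul_div, div_lt_iff₀ hden0]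
    calc |s| * C < c ^ 2 / (8 * γ) := hsC
      _ = c / (4 * γ) * (c / 2) := by ring
      _ ≤ _ := by gcongr
  have hσw : ‖(s / (1 - l - s)) • (p - q - (2 : ℝ) • e)‖ <
      c / (4 * γ) * (4 - ‖p - q‖ ^ 2) := by
    rw [norm_smul, Real.norm_eq_abs]
    calc _ ≤ |s / (1 - l - s)| * (C * (4 - ‖p - q‖ ^ 2)) := by gcongr
      _ = |s / (1 - l - s)| * C * (4 - ‖p - q‖ ^ 2) := by ring
      _ < _ := by gcongr
  refine ⟨hp, ?_, ?_, ?_⟩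
  · refine (norm_sub_le _ _).trans_lt ?_
    have hcomb := norm_sq_convex_comb l p q
    have hb : c / 2 * (4 - ‖p - q‖ ^ 2) ≤ γ ^ 2 - ‖q‖ ^ 2 := by
      have h1 := mul_le_mul_of_nonneg_right (half_le_mul_one_sub hc hcl hcl') hd0.le
      have h2 : l * ‖q‖ ^ 2 ≤ l * ‖p‖ ^ 2 :=
        mul_le_mul_of_nonneg_left (by gcongr) (hc.le.trans hcl)
      linarith only [h1, h2, hcomb, hF]
    have hb' : c / (4 * γ) * (4 - ‖p - q‖ ^ 2) ≤ γ - ‖q‖ := by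
      have : c / (4 * γ) * (4 - ‖p - q‖ ^ 2) = c / 2 * (4 - ‖p - q‖ ^ 2) / (2 * γ) := by
        field_simp
        ring
      rw [this, div_le_iff₀ (by positivity)]
      refine hb.trans ?_
      nlinarith only [hq]
    linarith
  · rw [sub_sub_eq_add_sub, add_sub_right_comm]
    refine (norm_add_le _ _).trans_lt ?_
    have h1 : c / (4 * γ) ≤ 1 / 4 := by
      rw [div_le_iff₀ (by positivity)]; linarith
    nlinarith only [hσw, hpq, norm_nonneg (p - q), mul_le_mul_of_nonneg_right h1 hd0.le]
  · rw [hu, norm_add_sq_real, real_inner_smul_right, norm_smul, he, Real.norm_eq_abs, mul_one,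
      sq_abs]
    set u := l • p + (1 - l) • q
    set F := γ ^ 2 - 4 * (l * (1 - l)) - ‖u‖ ^ 2 with hFdef
    have hF0 : 0 < F := by linarith
    have h1 : |s * (⟪u, e⟫ - (2 * l - 1))| < F / 4 := by
      rw [abs_mul]
      calc |s| * |⟪u, e⟫ - (2 * l - 1)| ≤ |s| * (C * F) := by
            gcongr
            exact hue.trans (by gcongr)
        _ = |s| * C * F := by ring
        _ < 1 / 4 * F := by gcongr; linarith
        _ = F / 4 := by ring
    have h2 := (abs_lt.1 h1).2
    linarith only [h2, hFdef]

/-- A direction in the wave cone can be normalised without shortening the admissible segment. -/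
theorem exists_normalized_direction {γ β : ℝ} {z : ℝ × E2 × E2} {a : ℝ} {b m : E2}
    (ha : 1 ≤ a) (hab : a ^ 2 = ‖b‖ ^ 2)
    (h : ∀ s : ℝ, |s| < β → z + s • ((a, b, m) : ℝ × E2 × E2) ∈ Ugamma γ) :
    ∃ zbar ∈ LambdaIPM, dist5 zbar 0 = 1 ∧
      ∀ t : ℝ, |t| < β → z + t • zbar ∈ Ugamma γ := by
  set N := √(a ^ 2 + ‖b‖ ^ 2 + ‖m‖ ^ 2) with hN
  have hN1 : 1 ≤ N := Real.one_le_sqrt.2 (by nlinarith [sq_nonneg ‖b‖, sq_nonneg ‖m‖])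
  have hN0 : 0 < N := by linarith
  refine ⟨N⁻¹ • (a, b, m), ?_, ?_, fun t ht => ?_⟩
  · simp only [LambdaIPM, Set.mem_ofPred_eq, Prod.smul_mk, smul_eq_mul, norm_smul, norm_inv,
      Real.norm_eq_abs, abs_of_pos hN0, mul_pow, hab]
  · have : (N⁻¹ * a) ^ 2 + (N⁻¹ * ‖b‖) ^ 2 + (N⁻¹ * ‖m‖) ^ 2 = 1 := by
      have hsq : N ^ 2 = a ^ 2 + ‖b‖ ^ 2 + ‖m‖ ^ 2 := Real.sq_sqrt (by positivity)
      field_simp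
      exact hsq.symm
    simp [dist5, norm_smul, abs_of_pos hN0, this]
  · rw [smul_smul]
    refine h _ (lt_of_le_of_lt ?_ ht)
    rw [abs_mul, abs_inv, abs_of_pos hN0]
    exact mul_le_of_le_one_right (abs_nonneg t) (inv_le_one_of_one_le₀ hN1)

theorem exists_direction_of_norm_le {γ α l : ℝ} {p q : E2} (hγ : 2 < γ) (hα : 0 < α)
    (h0 : 0 < l) (h1 : l < 1) (hqp : ‖q‖ ≤ ‖p‖) (hz : segmentPoint l p q ∈ Ugamma γ)
    (hK : ∀ w ∈ Kgamma γ, α ≤ dist5 (segmentPoint l p q) w) :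
    ∃ zbar ∈ LambdaIPM, dist5 zbar 0 = 1 ∧ ∀ t : ℝ,
      |t| < (α / (γ + 3)) ^ 2 /
        (8 * γ * (1 + 2 * (γ + 2) * (1 / (α / (γ + 3)) + γ + 1))) →
      segmentPoint l p q + t • zbar ∈ Ugamma γ := by
  obtain ⟨hp, hq, hpq, hF⟩ := (segmentPoint_mem_Ugamma_iff h0 h1).1 hz
  have hcl : α / (γ + 3) ≤ l :=
    (div_le_iff₀ (by linarith)).2 (le_mul_of_le_dist5_Kgamma (by linarith) h0 hp hq hpq hK)
  have hcl' : α / (γ + 3) ≤ 1 - l := by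
    refine (div_le_iff₀ (by linarith)).2 (le_mul_of_le_dist5_Kgamma (p := q) (q := p)
      (by linarith) (by linarith) hq hp (by rwa [norm_sub_rev]) fun w hw => ?_)
    rw [← reflect_segmentPoint, ← dist5_reflect]
    have hrr : reflect (reflect (segmentPoint l p q)) = segmentPoint l p q := by simp [reflect]
    rw [hrr]
    exact hK _ (reflect_mem_Kgamma hw)
  set c := α / (γ + 3)
  have hc : 0 < c := by positivity
  obtain ⟨e, he, hw, hue⟩ := exists_velocity_direction hγ hc hcl hcl' hp hq hpq hF
  have hC : 1 / c ≤ 1 + 2 * (γ + 2) * (1 / c + γ + 1) := by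
    have : 0 < 1 / c := by positivity
    nlinarith
  refine exists_normalized_direction (a := 2) (b := (2 : ℝ) • e) (m := p - e) (by norm_num)
    (by rw [norm_smul, he]; norm_num) fun s hs => ?_
  exact segmentPoint_add_smul_mem hγ hc hC hcl hcl' hqp hp hq hpq hF he hw hue hs

theorem stmt7 (γ : ℝ) (hγ : 2 < γ) :
    ∀ α > (0 : ℝ), ∃ β > (0 : ℝ), ∀ z ∈ Ugamma γ,
      (∀ w ∈ Kgamma γ, α ≤ dist5 z w) →
      ∃ zbar ∈ LambdaIPM, dist5 zbar 0 = 1 ∧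
        ∀ t : ℝ, |t| < β → z + t • zbar ∈ Ugamma γ := by
  intro α hα
  refine ⟨(α / (γ + 3)) ^ 2 /
    (8 * γ * (1 + 2 * (γ + 2) * (1 / (α / (γ + 3)) + γ + 1))), by positivity, fun z hz hK => ?_⟩
  obtain ⟨l, p, q, h0, h1, rfl⟩ := exists_eq_segmentPoint hz
  rcases le_total ‖q‖ ‖p‖ with h | h
  · exact exists_direction_of_norm_le hγ hα h0 h1 h hz hK
  · have hrr (z : ℝ × E2 × E2) : reflect (reflect z) = z := by simp [reflect]
    obtain ⟨y, hy, hy1, hyt⟩ := exists_direction_of_norm_le (l := 1 - l) (p := q) (q := p) hγ hα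
      (by linarith) (by linarith) h (by rw [← reflect_segmentPoint]; exact reflect_mem_Ugamma hz)
      fun w hw => by
        rw [← reflect_segmentPoint, ← dist5_reflect, hrr]
        exact hK _ (reflect_mem_Kgamma hw)
    refine ⟨reflect y, ?_, ?_, fun t ht => ?_⟩
    · simpa [LambdaIPM, reflect] using hy
    · have h0 : reflect 0 = 0 := by simp [reflect]
      rw [← hy1, ← dist5_reflect y, h0]
    · have := reflect_mem_Ugamma (hyt t ht)
      rw [← reflect_segmentPoint] at this
      convert this using 1
      ext <;> simp [reflect] <;> ring
end

section
/- For every T > 0 there exist infinitely many pairs (ρ, v) with ρ ∈ L^∞(𝕋² × ℝ) and v ∈ L^∞(𝕋² × ℝ; ℝ²) that are weak solutions of the incompressible porous media equation on 𝕋² × ℝ and satisfy: |ρ(x,t)| = 1 for a.e. (x,t) ∈ 𝕋² × (0,T), and ρ(x,t) = 0 and v(x,t) = 0 for a.e. (x,t) with t < 0 or t > T. -/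
open MeasureTheory Filter

/-- Partial derivative in x₁ of a function of (x₁, x₂, t). -/
noncomputable def dx1 (f : ℝ × ℝ × ℝ → ℝ) (p : ℝ × ℝ × ℝ) : ℝ :=
  deriv (fun s => f (s, p.2.1, p.2.2)) p.1

/-- Partial derivative in x₂ of a function of (x₁, x₂, t). -/
noncomputable def dx2 (f : ℝ × ℝ × ℝ → ℝ) (p : ℝ × ℝ × ℝ) : ℝ :=
  deriv (fun s => f (p.1, s, p.2.2)) p.2.1

/-- Partial derivative in t of a function of (x₁, x₂, t). -/
noncomputable def dt (f : ℝ × ℝ × ℝ → ℝ) (p : ℝ × ℝ × ℝ) : ℝ :=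
  deriv (fun s => f (p.1, p.2.1, s)) p.2.2

/-- A function on ℝ² × ℝ is 1-periodic in both spatial variables, i.e. lives on 𝕋² × ℝ. -/
def SpacePeriodic {α : Type*} (f : ℝ × ℝ × ℝ → α) : Prop :=
  ∀ p : ℝ × ℝ × ℝ, f (p.1 + 1, p.2.1, p.2.2) = f p ∧ f (p.1, p.2.1 + 1, p.2.2) = f p

/-- Test functions for the weak formulation on 𝕋² × ℝ: smooth, 1-periodic in
space, and compactly supported in time. -/
def TestPer (φ : ℝ × ℝ × ℝ → ℝ) : Prop :=
  ContDiff ℝ (⊤ : ℕ∞) φ ∧ SpacePeriodic φ ∧ ∃ R : ℝ, ∀ p : ℝ × ℝ × ℝ, R ≤ |p.2.2| → φ p = 0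

/-- A fundamental domain 𝕋² × ℝ ≅ (0,1)² × ℝ for the periodic problem. -/
def QT : Set (ℝ × ℝ × ℝ) := Set.Ioo (0 : ℝ) 1 ×ˢ (Set.Ioo (0 : ℝ) 1 ×ˢ (Set.univ : Set ℝ))

/-- (ρ, v) is a weak solution of the incompressible porous media equation on 𝕋² × ℝ:
for every smooth spatially periodic test function φ compactly supported in time,
(i) ∫∫ ρ(∂_t φ + v·∇_x φ) = 0, (ii) ∫∫ v·∇_x φ = 0, and
(iii) ∫∫ (v + (0,ρ))·∇_x^⊥ φ = 0, where ∇^⊥ = (−∂_{x₂}, ∂_{x₁}). -/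
def WeakIPMTorus (ρ : ℝ × ℝ × ℝ → ℝ) (v : ℝ × ℝ × ℝ → ℝ × ℝ) : Prop :=
  ∀ φ : ℝ × ℝ × ℝ → ℝ, TestPer φ →
    (∫ p in QT, ρ p * (dt φ p + (v p).1 * dx1 φ p + (v p).2 * dx2 φ p)) = 0 ∧
    (∫ p in QT, ((v p).1 * dx1 φ p + (v p).2 * dx2 φ p)) = 0 ∧
    (∫ p in QT, ((v p).1 * (-(dx2 φ p)) + ((v p).2 + ρ p) * dx1 φ p)) = 0

/-- State vectors `(ρ, v₁, v₂, m₁, m₂)`. -/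
abbrev IPMState := EuclideanSpace ℝ (Fin 5)

/-- A bounded open part of the relaxation hull. -/
def ipmHull : Set IPMState :=
  {u | u 0 ^ 2 < 1 ∧ (u 1 + u 3) ^ 2 + (u 2 + u 4) ^ 2 < (1 + u 0) ^ 2 ∧
    (u 3 - u 0 * u 1) ^ 2 + (u 4 - u 0 * u 2 + (1 - u 0 ^ 2) / 2) ^ 2 < ((1 - u 0 ^ 2) / 2) ^ 2}

theorem isOpen_ipmHull : IsOpen ipmHull := by
  refine IsOpen.and ?_ (IsOpen.and ?_ ?_) <;> exact isOpen_lt (by fun_prop) (by fun_prop)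

theorem exists_waveNumber {a b : ℝ} (h : a ^ 2 + b ^ 2 = 1) :
    ∃ k₁ k₂ : ℝ, k₁ ^ 2 + k₂ ^ 2 = 1 ∧ 2 * (k₁ * k₂) = a ∧ 1 - 2 * k₁ ^ 2 = b := by
  rcases eq_or_ne b 1 with rfl | hb
  · refine ⟨0, 1, by norm_num, ?_, by norm_num⟩
    have : a = 0 := by nlinarith
    simp [this]
  · have hb1 : b < 1 := lt_of_le_of_ne (by nlinarith) hb
    have hk : 0 < √((1 - b) / 2) := Real.sqrt_pos.2 (by linarith)
    have hk2 : √((1 - b) / 2) ^ 2 = (1 - b) / 2 := Real.sq_sqrt (by linarith)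
    refine ⟨√((1 - b) / 2), a / (2 * √((1 - b) / 2)), ?_, by field_simp, by rw [hk2]; ring⟩
    rw [div_pow, mul_pow, hk2, show a ^ 2 = (1 - b) * (1 + b) by linarith]
    have : 1 - b ≠ 0 := by linarith
    field_simp; ring

theorem exists_unit_smul (a b : ℝ) :
    ∃ d a' b' : ℝ, 0 ≤ d ∧ a' ^ 2 + b' ^ 2 = 1 ∧ a = d * a' ∧ b = d * b' := by
  rcases eq_or_ne (a ^ 2 + b ^ 2) 0 with h | h
  · exact ⟨0, 1, 0, le_rfl, by norm_num, by nlinarith [sq_nonneg a, sq_nonneg b],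
      by nlinarith [sq_nonneg a, sq_nonneg b]⟩
  · have hp : 0 < a ^ 2 + b ^ 2 := lt_of_le_of_ne (by positivity) h.symm
    have hs : 0 < √(a ^ 2 + b ^ 2) := Real.sqrt_pos.2 hp
    refine ⟨√(a ^ 2 + b ^ 2), a / √(a ^ 2 + b ^ 2), b / √(a ^ 2 + b ^ 2), hs.le, ?_,
      by field_simp, by field_simp⟩
    rw [div_pow, div_pow, Real.sq_sqrt hp.le]; field_simp

/-- In the hull the two phase velocities `v ± m` and their difference are controlled. -/
theorem hull_coordinates {ρ v₁ v₂ m₁ m₂ : ℝ} (h0 : ρ ^ 2 < 1)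
    (h1 : (v₁ + m₁) ^ 2 + (v₂ + m₂) ^ 2 < (1 + ρ) ^ 2)
    (h2 : (m₁ - ρ * v₁) ^ 2 + (m₂ - ρ * v₂ + (1 - ρ ^ 2) / 2) ^ 2 < ((1 - ρ ^ 2) / 2) ^ 2) :
    ∃ p q x y : ℝ, p ^ 2 + q ^ 2 < 1 ∧ x ^ 2 + y ^ 2 < 1 ∧
      v₁ = p - x * (1 - ρ) / 2 ∧ v₂ = q - (y - 1) * (1 - ρ) / 2 ∧
      m₁ = (1 + ρ) * p - v₁ ∧ m₂ = (1 + ρ) * q - v₂ := by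
  obtain ⟨hl1, hl2⟩ := abs_lt.1 ((sq_lt_one_iff_abs_lt_one ρ).1 h0)
  have hp : 0 < 1 + ρ := by linarith
  have hB : 0 < (1 - ρ ^ 2) / 2 := by linarith
  obtain ⟨p, hp1⟩ : ∃ p, v₁ + m₁ = (1 + ρ) * p := ⟨(v₁ + m₁) / (1 + ρ), by field_simp⟩
  obtain ⟨q, hq1⟩ : ∃ q, v₂ + m₂ = (1 + ρ) * q := ⟨(v₂ + m₂) / (1 + ρ), by field_simp⟩
  obtain ⟨x, hx⟩ : ∃ x, m₁ - ρ * v₁ = (1 - ρ ^ 2) / 2 * x :=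
    ⟨(m₁ - ρ * v₁) / ((1 - ρ ^ 2) / 2), (mul_div_cancel₀ _ hB.ne').symm⟩
  obtain ⟨y, hy⟩ : ∃ y, m₂ - ρ * v₂ + (1 - ρ ^ 2) / 2 = (1 - ρ ^ 2) / 2 * y :=
    ⟨(m₂ - ρ * v₂ + (1 - ρ ^ 2) / 2) / ((1 - ρ ^ 2) / 2),
      (mul_div_cancel₀ _ hB.ne').symm⟩
  refine ⟨p, q, x, y, ?_, ?_, ?_, ?_, by linarith, by linarith⟩
  · rw [hp1, hq1] at h1
    have : 0 < (1 + ρ) ^ 2 := by positivity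
    nlinarith
  · rw [hx, hy] at h2
    have : 0 < ((1 - ρ ^ 2) / 2) ^ 2 := by positivity
    nlinarith
  · refine mul_left_cancel₀ hp.ne' ?_
    linear_combination hp1 - hx
  · refine mul_left_cancel₀ hp.ne' ?_
    linear_combination hq1 - hy

theorem norm_le_of_mem_ipmHull {u : IPMState} (hu : u ∈ ipmHull) :
    u 1 ^ 2 + u 2 ^ 2 ≤ 9 ∧ ‖u‖ ≤ 10 := by
  obtain ⟨h0, h1, h2⟩ := hu
  obtain ⟨p, q, x, y, hpq, hxy, e1, e2, e3, e4⟩ := hull_coordinates h0 h1 h2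
  have hv : u 1 ^ 2 + u 2 ^ 2 ≤ 9 := by
    obtain ⟨hl1, hl2⟩ := abs_lt.1 ((sq_lt_one_iff_abs_lt_one (u 0)).1 h0)
    obtain ⟨l, hl⟩ : ∃ l, l = (1 - u 0) / 2 := ⟨_, rfl⟩
    have hll : l ^ 2 ≤ 1 := by rw [hl]; nlinarith
    have f1 : u 1 = p - l * x := by rw [e1, hl]; ring
    have f2 : u 2 = q - l * (y - 1) := by rw [e2, hl]; ring
    have hy : x ^ 2 + (y - 1) ^ 2 ≤ 4 := by nlinarith
    have g : l ^ 2 * (x ^ 2 + (y - 1) ^ 2) ≤ 1 * 4 := by gcongr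
    rw [f1, f2]
    nlinarith [sq_nonneg (2 * p + l * x), sq_nonneg (2 * q + l * (y - 1))]
  refine ⟨hv, ?_⟩
  have : ‖u‖ ^ 2 ≤ 10 ^ 2 := by
    rw [EuclideanSpace.norm_sq_eq, Fin.sum_univ_five]
    simp only [Real.norm_eq_abs, sq_abs]
    have h3 : (1 + u 0) ^ 2 ≤ 4 := by nlinarith
    nlinarith [sq_nonneg (u 1 + (u 1 + u 3)), sq_nonneg (u 2 + (u 2 + u 4))]
  exact le_of_sq_le_sq this (by norm_num)

theorem hull_segment {ρ d a b p q τ : ℝ} (hd : 0 ≤ d) (hd1 : d < 1) (hab : a ^ 2 + b ^ 2 = 1)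
    (hpq : p ^ 2 + q ^ 2 < 1) (hτ : |τ| ≤ (1 - |ρ|) / 4) (hl : |ρ| < 1) :
    (ρ + τ) ^ 2 < 1 ∧ ((1 + (ρ + τ)) * p) ^ 2 + ((1 + (ρ + τ)) * q) ^ 2 < (1 + (ρ + τ)) ^ 2 ∧
      ((1 + ρ + τ) * ((1 - ρ) * d - τ) / 2 * a) ^ 2 +
        ((1 + ρ + τ) * ((1 - ρ) * d - τ) / 2 * b) ^ 2 < ((1 - (ρ + τ) ^ 2) / 2) ^ 2 := by
  obtain ⟨ht1, ht2⟩ := abs_le.1 hτ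
  have hr1 : ρ ≤ |ρ| := le_abs_self ρ
  have hr2 : -ρ ≤ |ρ| := neg_le_abs ρ
  have hη : (ρ + τ) ^ 2 < 1 :=
    (sq_lt_one_iff_abs_lt_one (ρ + τ)).2 (abs_lt.2 ⟨by linarith, by linarith⟩)
  have hm : 0 < 1 + ρ + τ := by linarith
  refine ⟨hη, ?_, ?_⟩
  · have : 0 < (1 + (ρ + τ)) ^ 2 := by rw [← add_assoc]; positivity
    nlinarith
  · set c := (1 + ρ + τ) * ((1 - ρ) * d - τ) / 2 with hc
    have : (c * a) ^ 2 + (c * b) ^ 2 = c ^ 2 := by linear_combination c ^ 2 * hab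
    rw [this, sq_lt_sq, abs_of_pos (by linarith : 0 < (1 - (ρ + τ) ^ 2) / 2), abs_lt]
    have : (1 - (ρ + τ) ^ 2) / 2 = (1 + ρ + τ) * (1 - ρ - τ) / 2 := by ring
    rw [this, hc]
    have k1 : (1 - ρ) * d - τ < 1 - ρ - τ := by nlinarith
    have k2 : -(1 - ρ - τ) < (1 - ρ) * d - τ := by nlinarith
    constructor <;> nlinarith

/-- Every state of the hull is the midpoint of a segment in the wave cone. -/
theorem exists_wave_direction {u : IPMState} (hu : u ∈ ipmHull) :
    ∃ (w : IPMState) (k₁ k₂ : ℝ), k₁ ^ 2 + k₂ ^ 2 = 1 ∧ w 1 = w 0 * (k₁ * k₂) ∧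
      w 2 = -(w 0 * k₁ ^ 2) ∧ (1 - u 0 ^ 2) / 8 ≤ w 0 ∧
      ∀ s ∈ Set.Icc (-1 : ℝ) 1, u + s • w ∈ ipmHull := by
  obtain ⟨h0, h1, h2⟩ := hu
  have hl : |u 0| < 1 := by rwa [← sq_lt_one_iff_abs_lt_one]
  obtain ⟨p, q, x, y, hpq, hxy, e1, e2, e3, e4⟩ := hull_coordinates h0 h1 h2
  obtain ⟨d, a, b, hd, hab, rfl, rfl⟩ := exists_unit_smul x y
  obtain ⟨k₁, k₂, hk, hk1, hk2⟩ := exists_waveNumber hab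
  have hd1 : d < 1 := by
    have : d ^ 2 * (a ^ 2 + b ^ 2) < 1 := by linarith
    rw [hab] at this
    nlinarith
  generalize hρ : u 0 = ρ at *
  obtain ⟨σ, hσ⟩ : ∃ σ, σ = (1 - |ρ|) / 4 := ⟨_, rfl⟩
  have hσ0 : 0 < σ := by rw [hσ]; linarith
  refine ⟨!₂[σ, σ * (a / 2), σ * ((b - 1) / 2), σ * p - σ * (a / 2), σ * q - σ * ((b - 1) / 2)],
    k₁, k₂, hk, ?_, ?_, ?_, ?_⟩
  · change σ * (a / 2) = σ * (k₁ * k₂)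
    rw [← hk1]; ring
  · change σ * ((b - 1) / 2) = -(σ * k₁ ^ 2)
    rw [← hk2]; ring
  · change (1 - ρ ^ 2) / 8 ≤ σ
    have h5 : ρ ^ 2 = |ρ| ^ 2 := (sq_abs ρ).symm
    rw [hσ, h5]; nlinarith [sq_nonneg (1 - |ρ|)]
  · rintro s ⟨hs1, hs2⟩
    have hsσ : |s * σ| ≤ (1 - |ρ|) / 4 := by
      rw [abs_mul, abs_of_pos hσ0, ← hσ]
      have : |s| ≤ 1 := abs_le.2 ⟨hs1, hs2⟩
      nlinarith
    obtain ⟨c1, c2, c3⟩ := hull_segment hd hd1 hab hpq hsσ hl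
    refine ⟨?_, ?_, ?_⟩
    · change (u 0 + s * σ) ^ 2 < 1
      rwa [hρ]
    · change (u 1 + s * (σ * (a / 2)) + (u 3 + s * (σ * p - σ * (a / 2)))) ^ 2 +
        (u 2 + s * (σ * ((b - 1) / 2)) + (u 4 + s * (σ * q - σ * ((b - 1) / 2)))) ^ 2 <
          (1 + (u 0 + s * σ)) ^ 2
      rw [hρ]
      convert c2 using 3
      · rw [e3, e1]; ring
      · rw [e4, e2]; ring
    · change (u 3 + s * (σ * p - σ * (a / 2)) - (u 0 + s * σ) * (u 1 + s * (σ * (a / 2)))) ^ 2 +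
        (u 4 + s * (σ * q - σ * ((b - 1) / 2)) -
          (u 0 + s * σ) * (u 2 + s * (σ * ((b - 1) / 2))) + (1 - (u 0 + s * σ) ^ 2) / 2) ^ 2 <
          ((1 - (u 0 + s * σ) ^ 2) / 2) ^ 2
      rw [hρ]
      convert c3 using 3
      · rw [e3, e1]; ring
      · rw [e4, e2]; ring

instance isAddHaarMeasure_volume_plane : (volume : Measure (ℝ × ℝ)).IsAddHaarMeasure :=
  Measure.prod.instIsAddHaarMeasure volume volume

instance isAddHaarMeasure_volume_spaceTime : (volume : Measure (ℝ × ℝ × ℝ)).IsAddHaarMeasure :=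
  Measure.prod.instIsAddHaarMeasure volume volume

/-- Derivative of `f` in the direction `w`. -/
noncomputable def dirDeriv (w : ℝ × ℝ × ℝ) (f : ℝ × ℝ × ℝ → ℝ) (p : ℝ × ℝ × ℝ) : ℝ :=
  fderiv ℝ f p w

section dirDeriv

variable {f g : ℝ × ℝ × ℝ → ℝ} {u w : ℝ × ℝ × ℝ}

theorem ContDiff.dirDeriv (hf : ContDiff ℝ (⊤ : ℕ∞) f) : ContDiff ℝ (⊤ : ℕ∞) (dirDeriv w f) :=
  (hf.fderiv_right (m := (⊤ : ℕ∞)) (by norm_cast)).clm_apply contDiff_const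

theorem HasCompactSupport.dirDeriv (hf : HasCompactSupport f) :
    HasCompactSupport (dirDeriv w f) :=
  hf.fderiv_apply (𝕜 := ℝ) w

theorem support_dirDeriv_subset : Function.support (dirDeriv w f) ⊆ tsupport f :=
  subset_closure.trans (tsupport_fderiv_apply_subset ℝ w)

theorem dirDeriv_comm (hf : ContDiff ℝ (⊤ : ℕ∞) f) (p : ℝ × ℝ × ℝ) :
    dirDeriv u (dirDeriv w f) p = dirDeriv w (dirDeriv u f) p := by
  have key : ∀ a b, dirDeriv a (dirDeriv b f) p = fderiv ℝ (fderiv ℝ f) p a b := by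
    intro a b
    have hd : DifferentiableAt ℝ (fderiv ℝ f) p :=
      ((hf.fderiv_right (m := (⊤ : ℕ∞)) (by norm_cast)).differentiable (by simp)) p
    change fderiv ℝ (fun q => fderiv ℝ f q b) p a = _
    rw [fderiv_clm_apply hd (differentiableAt_const b)]
    simp
  rw [key, key]
  exact (hf.contDiffAt.isSymmSndFDerivAt (by simp; norm_cast)) u w

theorem dx1_eq_dirDeriv (hf : ContDiff ℝ (⊤ : ℕ∞) f) : dx1 f = dirDeriv (1, 0, 0) f := by
  ext p
  have hd : HasFDerivAt f (fderiv ℝ f p) (p.1, p.2.1, p.2.2) :=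
    ((hf.differentiable (by simp)) p).hasFDerivAt
  have h2 : HasDerivAt (fun s : ℝ => (s, p.2.1, p.2.2)) ((1 : ℝ), (0 : ℝ), (0 : ℝ)) p.1 :=
    (hasDerivAt_id p.1).prodMk ((hasDerivAt_const _ _).prodMk (hasDerivAt_const _ _))
  exact (hd.comp_hasDerivAt p.1 h2).deriv

theorem dx2_eq_dirDeriv (hf : ContDiff ℝ (⊤ : ℕ∞) f) : dx2 f = dirDeriv (0, 1, 0) f := by
  ext p
  have hd : HasFDerivAt f (fderiv ℝ f p) (p.1, p.2.1, p.2.2) :=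
    ((hf.differentiable (by simp)) p).hasFDerivAt
  have h2 : HasDerivAt (fun s : ℝ => (p.1, s, p.2.2)) ((0 : ℝ), (1 : ℝ), (0 : ℝ)) p.2.1 :=
    (hasDerivAt_const _ _).prodMk ((hasDerivAt_id _).prodMk (hasDerivAt_const _ _))
  exact (hd.comp_hasDerivAt p.2.1 h2).deriv

theorem dt_eq_dirDeriv (hf : ContDiff ℝ (⊤ : ℕ∞) f) : dt f = dirDeriv (0, 0, 1) f := by
  ext p
  have hd : HasFDerivAt f (fderiv ℝ f p) (p.1, p.2.1, p.2.2) :=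
    ((hf.differentiable (by simp)) p).hasFDerivAt
  have h2 : HasDerivAt (fun s : ℝ => (p.1, p.2.1, s)) ((0 : ℝ), (0 : ℝ), (1 : ℝ)) p.2.2 :=
    (hasDerivAt_const _ _).prodMk ((hasDerivAt_const _ _).prodMk (hasDerivAt_id _))
  exact (hd.comp_hasDerivAt p.2.2 h2).deriv

theorem integrable_dirDeriv_mul_dirDeriv (hf : ContDiff ℝ (⊤ : ℕ∞) f) (hfc : HasCompactSupport f)
    (hg : ContDiff ℝ (⊤ : ℕ∞) g) :
    Integrable (fun p => dirDeriv u f p * dirDeriv w g p) :=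
  (hf.dirDeriv.continuous.mul hg.dirDeriv.continuous).integrable_of_hasCompactSupport
    hfc.dirDeriv.mul_right

theorem integral_dirDeriv_mul_dirDeriv_comm (hf : ContDiff ℝ (⊤ : ℕ∞) f)
    (hfc : HasCompactSupport f) (hg : ContDiff ℝ (⊤ : ℕ∞) g) :
    ∫ p, dirDeriv u f p * dirDeriv w g p = ∫ p, dirDeriv w f p * dirDeriv u g p := by
  have key : ∀ a b, ∫ p, f p * dirDeriv a (dirDeriv b g) p =
      -∫ p, dirDeriv a f p * dirDeriv b g p := by
    intro a b
    refine integral_mul_fderiv_eq_neg_fderiv_mul_of_integrable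
      (integrable_dirDeriv_mul_dirDeriv hf hfc hg) ?_ ?_
      (fun x _ => (hf.differentiable (by simp)) x)
      (fun x _ => (hg.dirDeriv.differentiable (by simp)) x)
    · exact (hf.continuous.mul hg.dirDeriv.dirDeriv.continuous).integrable_of_hasCompactSupport
        hfc.mul_right
    · exact (hf.continuous.mul hg.dirDeriv.continuous).integrable_of_hasCompactSupport
        hfc.mul_right
  have h1 := key u w
  have h2 := key w u
  simp_rw [dirDeriv_comm (u := u) (w := w) hg] at h1
  linarith

theorem dirDeriv_mul_cos (hf : ContDiff ℝ (⊤ : ℕ∞) f) (n : ℝ) (l : StrongDual ℝ (ℝ × ℝ × ℝ)) :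
    dirDeriv w (fun p => f p * Real.cos (n * l p)) =
      fun p => dirDeriv w f p * Real.cos (n * l p) - n * l w * (f p * Real.sin (n * l p)) := by
  ext p
  have h1 : HasFDerivAt (fun p => n * l p) (n • l) p := l.hasFDerivAt.const_mul n
  have h2 := ((hf.differentiable (by simp)) p).hasFDerivAt.mul h1.cos
  change fderiv ℝ (f * fun p => Real.cos (n * l p)) p w = _
  rw [h2.fderiv]
  simp [dirDeriv]
  ring

theorem dirDeriv_mul_sin (hf : ContDiff ℝ (⊤ : ℕ∞) f) (n : ℝ) (l : StrongDual ℝ (ℝ × ℝ × ℝ)) :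
    dirDeriv w (fun p => f p * Real.sin (n * l p)) =
      fun p => dirDeriv w f p * Real.sin (n * l p) + n * l w * (f p * Real.cos (n * l p)) := by
  ext p
  have h1 : HasFDerivAt (fun p => n * l p) (n • l) p := l.hasFDerivAt.const_mul n
  have h2 := ((hf.differentiable (by simp)) p).hasFDerivAt.mul h1.sin
  change fderiv ℝ (f * fun p => Real.sin (n * l p)) p w = _
  rw [h2.fderiv]
  simp [dirDeriv]
  ring

theorem dirDeriv_const_mul (hf : ContDiff ℝ (⊤ : ℕ∞) f) (c : ℝ) :
    dirDeriv w (fun p => c * f p) = fun p => c * dirDeriv w f p := by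
  ext p
  change fderiv ℝ (fun p => c * f p) p w = _
  rw [fderiv_const_mul ((hf.differentiable (by simp)) p)]
  simp [dirDeriv]

theorem dirDeriv_sub (hf : ContDiff ℝ (⊤ : ℕ∞) f) (hg : ContDiff ℝ (⊤ : ℕ∞) g) :
    dirDeriv w (fun p => f p - g p) = fun p => dirDeriv w f p - dirDeriv w g p := by
  ext p
  change fderiv ℝ (fun p => f p - g p) p w = _
  rw [fderiv_fun_sub ((hf.differentiable (by simp)) p) ((hg.differentiable (by simp)) p)]
  simp [dirDeriv]

theorem contDiff_cos_mul (n : ℝ) (l : StrongDual ℝ (ℝ × ℝ × ℝ)) :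
    ContDiff ℝ (⊤ : ℕ∞) (fun p => Real.cos (n * l p)) :=
  Real.contDiff_cos.comp (contDiff_const.mul l.contDiff)

theorem contDiff_sin_mul (n : ℝ) (l : StrongDual ℝ (ℝ × ℝ × ℝ)) :
    ContDiff ℝ (⊤ : ℕ∞) (fun p => Real.sin (n * l p)) :=
  Real.contDiff_sin.comp (contDiff_const.mul l.contDiff)

theorem exists_norm_le (hf : Continuous f) (hfc : HasCompactSupport f) :
    ∃ C, 0 ≤ C ∧ ∀ p, |f p| ≤ C := by
  obtain ⟨C, hC⟩ := hfc.exists_bound_of_continuous hf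
  exact ⟨C, (abs_nonneg _).trans (hC 0), hC⟩

/-- The Hessian of `n⁻² f cos (n l)` is `-f l ⊗ l cos (n l)` up to order `1 / n`. -/
theorem exists_second_dirDeriv_cos_le (hf : ContDiff ℝ (⊤ : ℕ∞) f) (hfc : HasCompactSupport f)
    (l : StrongDual ℝ (ℝ × ℝ × ℝ)) :
    ∃ C, ∀ n : ℝ, 1 ≤ n → ∀ p,
      |dirDeriv u (dirDeriv w (fun p => (n ^ 2)⁻¹ * (f p * Real.cos (n * l p)))) p +
        f p * Real.cos (n * l p) * (l u * l w)| ≤ C / n := by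
  obtain ⟨C₁, hC₁, h₁⟩ := exists_norm_le hf.dirDeriv.continuous (hfc.dirDeriv (w := u))
  obtain ⟨C₂, hC₂, h₂⟩ := exists_norm_le hf.dirDeriv.continuous (hfc.dirDeriv (w := w))
  obtain ⟨C₃, hC₃, h₃⟩ := exists_norm_le (hf.dirDeriv (w := w)).dirDeriv.continuous
    (hfc.dirDeriv.dirDeriv (w := u))
  refine ⟨C₃ + |l u| * C₂ + |l w| * C₁, fun n hn p => ?_⟩
  have hn0 : 0 < n := by linarith
  have hcos : ContDiff ℝ (⊤ : ℕ∞) (fun p => f p * Real.cos (n * l p)) :=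
    hf.mul (contDiff_cos_mul n l)
  have hsin : ContDiff ℝ (⊤ : ℕ∞) (fun p => f p * Real.sin (n * l p)) :=
    hf.mul (contDiff_sin_mul n l)
  rw [dirDeriv_const_mul hcos, dirDeriv_const_mul hcos.dirDeriv, dirDeriv_mul_cos hf,
    dirDeriv_sub (hf.dirDeriv.mul (contDiff_cos_mul n l)) (contDiff_const.mul hsin),
    dirDeriv_mul_cos hf.dirDeriv, dirDeriv_const_mul hsin, dirDeriv_mul_sin hf]
  have e : (n ^ 2)⁻¹ * (dirDeriv u (dirDeriv w f) p * Real.cos (n * l p) -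
      n * l u * (dirDeriv w f p * Real.sin (n * l p)) - n * l w *
      (dirDeriv u f p * Real.sin (n * l p) + n * l u * (f p * Real.cos (n * l p)))) +
      f p * Real.cos (n * l p) * (l u * l w) =
      (n⁻¹ * (dirDeriv u (dirDeriv w f) p * Real.cos (n * l p)) -
      l u * (dirDeriv w f p * Real.sin (n * l p)) - l w *
      (dirDeriv u f p * Real.sin (n * l p))) * n⁻¹ := by
    field_simp; ring
  rw [e, abs_mul, abs_of_pos (inv_pos.2 hn0), div_eq_mul_inv]
  have hb : ∀ a b C : ℝ, 0 ≤ C → |a| ≤ C → |b| ≤ 1 → |a * b| ≤ C := fun a b C hC ha hb => by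
    rw [abs_mul]
    calc |a| * |b| ≤ C * 1 := by gcongr
      _ = C := mul_one C
  have hninv : |n⁻¹| ≤ 1 := by rw [abs_of_pos (inv_pos.2 hn0)]; exact inv_le_one_of_one_le₀ hn
  gcongr
  refine (abs_sub _ _).trans (add_le_add ((abs_sub _ _).trans (add_le_add ?_ ?_)) ?_)
  · rw [mul_comm]
    exact hb _ _ _ hC₃ (hb _ _ _ hC₃ (h₃ p) (Real.abs_cos_le_one _)) hninv
  · rw [abs_mul]
    gcongr
    exact hb _ _ _ hC₂ (h₂ p) (Real.abs_sin_le_one _)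
  · rw [abs_mul]
    gcongr
    exact hb _ _ _ hC₁ (h₁ p) (Real.abs_sin_le_one _)

theorem exists_dirDeriv_sin_le (hf : ContDiff ℝ (⊤ : ℕ∞) f) (hfc : HasCompactSupport f)
    (l : StrongDual ℝ (ℝ × ℝ × ℝ)) :
    ∃ C, ∀ n : ℝ, 1 ≤ n → ∀ p,
      |dirDeriv w (fun p => n⁻¹ * (f p * Real.sin (n * l p))) p -
        f p * Real.cos (n * l p) * l w| ≤ C / n := by
  obtain ⟨C, hC, h⟩ := exists_norm_le hf.dirDeriv.continuous (hfc.dirDeriv (w := w))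
  refine ⟨C, fun n hn p => ?_⟩
  have hn0 : 0 < n := by linarith
  rw [dirDeriv_const_mul (hf.mul (contDiff_sin_mul n l)), dirDeriv_mul_sin hf]
  have e : n⁻¹ * (dirDeriv w f p * Real.sin (n * l p) + n * l w * (f p * Real.cos (n * l p))) -
      f p * Real.cos (n * l p) * l w = dirDeriv w f p * Real.sin (n * l p) * n⁻¹ := by
    field_simp; ring
  rw [e, abs_mul, abs_mul, abs_of_pos (inv_pos.2 hn0), div_eq_mul_inv]
  gcongr
  calc _ ≤ C * 1 := by gcongr; exacts [h p, Real.abs_sin_le_one _]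
    _ = C := mul_one C

end dirDeriv

/-- Continuous compactly supported weak solutions `(ρ, v, m)` of the linear system
`∂ₜρ + div m = 0`, `div v = 0`, `curl (v + (0, ρ)) = 0`. -/
structure IsLinearSolution (W : ℝ × ℝ × ℝ → IPMState) : Prop where
  continuous : Continuous W
  hasCompactSupport : HasCompactSupport W
  transport : ∀ g : ℝ × ℝ × ℝ → ℝ, ContDiff ℝ (⊤ : ℕ∞) g →
    ∫ p, (W p 0 * dt g p + W p 3 * dx1 g p + W p 4 * dx2 g p) = 0
  div_free : ∀ g : ℝ × ℝ × ℝ → ℝ, ContDiff ℝ (⊤ : ℕ∞) g →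
    ∫ p, (W p 1 * dx1 g p + W p 2 * dx2 g p) = 0
  darcy : ∀ g : ℝ × ℝ × ℝ → ℝ, ContDiff ℝ (⊤ : ℕ∞) g →
    ∫ p, (W p 1 * -(dx2 g p) + (W p 2 + W p 0) * dx1 g p) = 0

theorem integral_eq_zero_of_eq_add {α : Type*} [MeasurableSpace α] {μ : Measure α} {F f g : α → ℝ}
    (hf0 : ∫ p, f p ∂μ = 0) (hg0 : ∫ p, g p ∂μ = 0) (hf : Integrable f μ) (hg : Integrable g μ)
    (h : ∀ p, F p = f p + g p) : ∫ p, F p ∂μ = 0 := by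
  simp_rw [h]
  rw [integral_add hf hg, hf0, hg0, add_zero]

theorem continuous_dt {g : ℝ × ℝ × ℝ → ℝ} (hg : ContDiff ℝ (⊤ : ℕ∞) g) : Continuous (dt g) := by
  rw [dt_eq_dirDeriv hg]; exact hg.dirDeriv.continuous

theorem continuous_dx1 {g : ℝ × ℝ × ℝ → ℝ} (hg : ContDiff ℝ (⊤ : ℕ∞) g) : Continuous (dx1 g) := by
  rw [dx1_eq_dirDeriv hg]; exact hg.dirDeriv.continuous

theorem continuous_dx2 {g : ℝ × ℝ × ℝ → ℝ} (hg : ContDiff ℝ (⊤ : ℕ∞) g) : Continuous (dx2 g) := by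
  rw [dx2_eq_dirDeriv hg]; exact hg.dirDeriv.continuous

namespace IsLinearSolution

variable {W W' : ℝ × ℝ × ℝ → IPMState}

theorem integrable_of_eq_zero (hW : IsLinearSolution W) {F : ℝ × ℝ × ℝ → ℝ} (hF : Continuous F)
    (h : ∀ p, W p = 0 → F p = 0) : Integrable F :=
  hF.integrable_of_hasCompactSupport <| hW.hasCompactSupport.mono fun p hp hp' => hp (h p hp')

theorem continuous_apply (hW : IsLinearSolution W) (i : Fin 5) : Continuous fun p => W p i :=
  (EuclideanSpace.proj (𝕜 := ℝ) i).continuous.comp hW.continuous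

theorem add (hW : IsLinearSolution W) (hW' : IsLinearSolution W') :
    IsLinearSolution (fun p => W p + W' p) where
  continuous := hW.continuous.add hW'.continuous
  hasCompactSupport := hW.hasCompactSupport.add hW'.hasCompactSupport
  transport g hg := by
    have h1 := continuous_dt hg
    have h2 := continuous_dx1 hg
    have h3 := continuous_dx2 hg
    have c := hW.continuous_apply
    have c' := hW'.continuous_apply
    refine integral_eq_zero_of_eq_add (hW.transport g hg) (hW'.transport g hg)
      (hW.integrable_of_eq_zero ?_ fun p hp => by simp [hp])
      (hW'.integrable_of_eq_zero ?_ fun p hp => by simp [hp])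
      fun p => by simp only [PiLp.add_apply]; ring
    · exact (((c 0).mul h1).add ((c 3).mul h2)).add ((c 4).mul h3)
    · exact (((c' 0).mul h1).add ((c' 3).mul h2)).add ((c' 4).mul h3)
  div_free g hg := by
    have h2 := continuous_dx1 hg
    have h3 := continuous_dx2 hg
    have c := hW.continuous_apply
    have c' := hW'.continuous_apply
    refine integral_eq_zero_of_eq_add (hW.div_free g hg) (hW'.div_free g hg)
      (hW.integrable_of_eq_zero ?_ fun p hp => by simp [hp])
      (hW'.integrable_of_eq_zero ?_ fun p hp => by simp [hp])
      fun p => by simp only [PiLp.add_apply]; ring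
    · exact ((c 1).mul h2).add ((c 2).mul h3)
    · exact ((c' 1).mul h2).add ((c' 2).mul h3)
  darcy g hg := by
    have h2 := continuous_dx1 hg
    have h3 := continuous_dx2 hg
    have c := hW.continuous_apply
    have c' := hW'.continuous_apply
    refine integral_eq_zero_of_eq_add (hW.darcy g hg) (hW'.darcy g hg)
      (hW.integrable_of_eq_zero ?_ fun p hp => by simp [hp])
      (hW'.integrable_of_eq_zero ?_ fun p hp => by simp [hp])
      fun p => by simp only [PiLp.add_apply]; ring
    · exact ((c 1).mul h3.neg).add (((c 2).add (c 0)).mul h2)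
    · exact ((c' 1).mul h3.neg).add (((c' 2).add (c' 0)).mul h2)

theorem zero : IsLinearSolution (fun _ => 0) where
  continuous := continuous_const
  hasCompactSupport := HasCompactSupport.zero
  transport g _ := by simp
  div_free g _ := by simp
  darcy g _ := by simp

theorem sum {ι : Type*} {w : ι → ℝ × ℝ × ℝ → IPMState} (s : Finset ι)
    (h : ∀ i ∈ s, IsLinearSolution (w i)) : IsLinearSolution (fun p => ∑ i ∈ s, w i p) := by
  classical
  induction s using Finset.induction_on with
  | empty => simpa using zero
  | insert a s ha ih =>
    simp_rw [Finset.sum_insert ha]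
    exact (h a (Finset.mem_insert_self a s)).add
      (ih fun i hi => h i (Finset.mem_insert_of_mem hi))

end IsLinearSolution

/-- The solution of the linear system with potentials `φ` and `θ`. -/
noncomputable def ofPotentials (φ θ : ℝ × ℝ × ℝ → ℝ) (p : ℝ × ℝ × ℝ) : IPMState :=
  !₂[dirDeriv (1, 0, 0) (dirDeriv (1, 0, 0) φ) p + dirDeriv (0, 1, 0) (dirDeriv (0, 1, 0) φ) p,
    dirDeriv (0, 1, 0) (dirDeriv (1, 0, 0) φ) p,
    -dirDeriv (1, 0, 0) (dirDeriv (1, 0, 0) φ) p,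
    -dirDeriv (0, 0, 1) (dirDeriv (1, 0, 0) φ) p - dirDeriv (0, 1, 0) θ p,
    -dirDeriv (0, 0, 1) (dirDeriv (0, 1, 0) φ) p + dirDeriv (1, 0, 0) θ p]

theorem ofPotentials_eq_zero {φ θ : ℝ × ℝ × ℝ → ℝ} {p : ℝ × ℝ × ℝ} (h₁ : p ∉ tsupport φ)
    (h₂ : p ∉ tsupport θ) : ofPotentials φ θ p = 0 := by
  have key : ∀ u w, dirDeriv u (dirDeriv w φ) p = 0 := fun u w => by
    have : p ∉ tsupport (dirDeriv w φ) := fun h => h₁ (tsupport_fderiv_apply_subset ℝ w h)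
    exact Function.notMem_support.1 fun h => this (support_dirDeriv_subset h)
  have key' : ∀ w, dirDeriv w θ p = 0 := fun w =>
    Function.notMem_support.1 fun h => h₂ (support_dirDeriv_subset h)
  ext i
  fin_cases i <;> simp [ofPotentials, key, key']

theorem isLinearSolution_ofPotentials {φ θ : ℝ × ℝ × ℝ → ℝ} (hφ : ContDiff ℝ (⊤ : ℕ∞) φ)
    (hφc : HasCompactSupport φ) (hθ : ContDiff ℝ (⊤ : ℕ∞) θ) (hθc : HasCompactSupport θ) :
    IsLinearSolution (ofPotentials φ θ) where
  continuous := by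
    refine (PiLp.continuous_toLp 2 _).comp (continuous_pi fun i => ?_)
    have h2 : ∀ u w, Continuous (dirDeriv u (dirDeriv w φ)) := fun u w =>
      hφ.dirDeriv.dirDeriv.continuous
    have h1 : ∀ w, Continuous (dirDeriv w θ) := fun w => hθ.dirDeriv.continuous
    fin_cases i
    · exact (h2 _ _).add (h2 _ _)
    · exact h2 _ _
    · exact (h2 _ _).neg
    · exact (h2 _ _).neg.sub (h1 _)
    · exact (h2 _ _).neg.add (h1 _)
  hasCompactSupport := by
    refine HasCompactSupport.intro (hφc.isCompact.union hθc.isCompact) fun p hp => ?_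
    exact ofPotentials_eq_zero (fun h => hp (Or.inl h)) (fun h => hp (Or.inr h))
  transport g hg := by
    rw [dt_eq_dirDeriv hg, dx1_eq_dirDeriv hg, dx2_eq_dirDeriv hg]
    have I : ∀ u w z, Integrable (fun p => dirDeriv u (dirDeriv z φ) p * dirDeriv w g p) :=
      fun u w z => integrable_dirDeriv_mul_dirDeriv hφ.dirDeriv hφc.dirDeriv hg
    have J : ∀ u w, Integrable (fun p => dirDeriv u θ p * dirDeriv w g p) :=
      fun u w => integrable_dirDeriv_mul_dirDeriv hθ hθc hg
    have d : ∀ {f f' : ℝ × ℝ × ℝ → ℝ}, Integrable f → Integrable f' → ∫ p, f p = ∫ p, f' p →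
        ∫ p, (f p - f' p) = 0 := fun hf hf' h => by rw [integral_sub hf hf', h, sub_self]
    refine integral_eq_zero_of_eq_add
      (integral_eq_zero_of_eq_add
        (d (I (1, 0, 0) (0, 0, 1) (1, 0, 0)) (I (0, 0, 1) (1, 0, 0) (1, 0, 0))
          (integral_dirDeriv_mul_dirDeriv_comm hφ.dirDeriv hφc.dirDeriv hg))
        (d (I (0, 1, 0) (0, 0, 1) (0, 1, 0)) (I (0, 0, 1) (0, 1, 0) (0, 1, 0))
          (integral_dirDeriv_mul_dirDeriv_comm hφ.dirDeriv hφc.dirDeriv hg))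
        ((I _ _ _).sub (I _ _ _)) ((I _ _ _).sub (I _ _ _)) fun p => rfl)
      (d (J (1, 0, 0) (0, 1, 0)) (J (0, 1, 0) (1, 0, 0))
        (integral_dirDeriv_mul_dirDeriv_comm hθ hθc hg))
      (((I _ _ _).sub (I _ _ _)).add ((I _ _ _).sub (I _ _ _))) ((J _ _).sub (J _ _)) fun p => ?_
    simp only [ofPotentials, PiLp.toLp_apply, Matrix.cons_val]
    ring
  div_free g hg := by
    rw [dx1_eq_dirDeriv hg, dx2_eq_dirDeriv hg]
    have I : ∀ u w z, Integrable (fun p => dirDeriv u (dirDeriv z φ) p * dirDeriv w g p) :=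
      fun u w z => integrable_dirDeriv_mul_dirDeriv hφ.dirDeriv hφc.dirDeriv hg
    have e : ∀ p, ofPotentials φ θ p 1 * dirDeriv (1, 0, 0) g p +
        ofPotentials φ θ p 2 * dirDeriv (0, 1, 0) g p =
        dirDeriv (0, 1, 0) (dirDeriv (1, 0, 0) φ) p * dirDeriv (1, 0, 0) g p -
          dirDeriv (1, 0, 0) (dirDeriv (1, 0, 0) φ) p * dirDeriv (0, 1, 0) g p := fun p => by
      simp only [ofPotentials, PiLp.toLp_apply, Matrix.cons_val]; ring
    simp_rw [e]
    rw [integral_sub (I _ _ _) (I _ _ _),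
      integral_dirDeriv_mul_dirDeriv_comm hφ.dirDeriv hφc.dirDeriv hg (u := (0, 1, 0)), sub_self]
  darcy g hg := by
    rw [dx1_eq_dirDeriv hg, dx2_eq_dirDeriv hg]
    have I : ∀ u w z, Integrable (fun p => dirDeriv u (dirDeriv z φ) p * dirDeriv w g p) :=
      fun u w z => integrable_dirDeriv_mul_dirDeriv hφ.dirDeriv hφc.dirDeriv hg
    have e : ∀ p, ofPotentials φ θ p 1 * -dirDeriv (0, 1, 0) g p +
        (ofPotentials φ θ p 2 + ofPotentials φ θ p 0) * dirDeriv (1, 0, 0) g p =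
        dirDeriv (0, 1, 0) (dirDeriv (0, 1, 0) φ) p * dirDeriv (1, 0, 0) g p -
          dirDeriv (1, 0, 0) (dirDeriv (0, 1, 0) φ) p * dirDeriv (0, 1, 0) g p := fun p => by
      rw [dirDeriv_comm (u := (1, 0, 0)) (w := (0, 1, 0)) hφ]
      simp only [ofPotentials, PiLp.toLp_apply, Matrix.cons_val]; ring
    simp_rw [e]
    rw [integral_sub (I _ _ _) (I _ _ _),
      integral_dirDeriv_mul_dirDeriv_comm hφ.dirDeriv hφc.dirDeriv hg (u := (0, 1, 0)), sub_self]

theorem norm_le_sum_abs (x : IPMState) :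
    ‖x‖ ≤ |x 0| + |x 1| + |x 2| + |x 3| + |x 4| := by
  refine le_of_sq_le_sq ?_ (by positivity)
  rw [EuclideanSpace.norm_sq_eq, Fin.sum_univ_five]
  simp only [Real.norm_eq_abs]
  have h0 := abs_nonneg (x 0)
  have h1 := abs_nonneg (x 1)
  have h2 := abs_nonneg (x 2)
  have h3 := abs_nonneg (x 3)
  have h4 := abs_nonneg (x 4)
  have e : (|x 0| + |x 1| + |x 2| + |x 3| + |x 4|) ^ 2 =
    |x 0| ^ 2 + |x 1| ^ 2 + |x 2| ^ 2 + |x 3| ^ 2 + |x 4| ^ 2 + 2 * (|x 0| * |x 1| +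
      (|x 0| + |x 1|) * |x 2| + (|x 0| + |x 1| + |x 2|) * |x 3| +
      (|x 0| + |x 1| + |x 2| + |x 3|) * |x 4|) := by ring
  rw [e]
  exact le_add_of_nonneg_right (by positivity)

/-- Localized plane waves in the directions of the wave cone. -/
theorem exists_localized_wave {χ : ℝ × ℝ × ℝ → ℝ} (hχ : ContDiff ℝ (⊤ : ℕ∞) χ)
    (hχc : HasCompactSupport χ) {w : IPMState} {k₁ k₂ : ℝ} (hk : k₁ ^ 2 + k₂ ^ 2 = 1)
    (h0 : w 0 ≠ 0) (h1 : w 1 = w 0 * (k₁ * k₂)) (h2 : w 2 = -(w 0 * k₁ ^ 2)) :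
    ∃ (l : StrongDual ℝ (ℝ × ℝ × ℝ)) (W : ℝ → ℝ × ℝ × ℝ → IPMState) (C : ℝ), l ≠ 0 ∧
      (∀ n, IsLinearSolution (W n)) ∧ (∀ n p, p ∉ tsupport χ → W n p = 0) ∧
      ∀ n, 1 ≤ n → ∀ p, ‖W n p - (χ p * Real.cos (n * l p)) • w‖ ≤ C / n := by
  obtain ⟨τ, hτ⟩ : ∃ τ, τ = -(w 3 * k₁ + w 4 * k₂) / w 0 := ⟨_, rfl⟩
  obtain ⟨κ, hκ⟩ : ∃ κ, κ = w 4 * k₁ - w 3 * k₂ := ⟨_, rfl⟩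
  obtain ⟨l, hl1, hl2, hl3⟩ : ∃ l : StrongDual ℝ (ℝ × ℝ × ℝ),
      l (1, 0, 0) = k₁ ∧ l (0, 1, 0) = k₂ ∧ l (0, 0, 1) = τ := by
    refine ⟨k₁ • ContinuousLinearMap.fst ℝ ℝ (ℝ × ℝ) +
      (k₂ • ContinuousLinearMap.fst ℝ ℝ ℝ + τ • ContinuousLinearMap.snd ℝ ℝ ℝ).comp
        (ContinuousLinearMap.snd ℝ ℝ (ℝ × ℝ)), ?_, ?_, ?_⟩ <;> simp
  have hτ' : w 0 * τ = -(w 3 * k₁ + w 4 * k₂) := by rw [hτ]; field_simp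
  have h3 : w 3 = -(w 0 * (k₁ * τ)) - κ * k₂ := by
    rw [hκ]; linear_combination k₁ * hτ' - w 3 * hk
  have h4 : w 4 = -(w 0 * (k₂ * τ)) + κ * k₁ := by
    rw [hκ]; linear_combination k₂ * hτ' - w 4 * hk
  have hf : ContDiff ℝ (⊤ : ℕ∞) (fun p => -w 0 * χ p) := contDiff_const.mul hχ
  have hfc : HasCompactSupport (fun p => -w 0 * χ p) := hχc.mul_left
  have hg : ContDiff ℝ (⊤ : ℕ∞) (fun p => κ * χ p) := contDiff_const.mul hχ
  have hgc : HasCompactSupport (fun p => κ * χ p) := hχc.mul_left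
  obtain ⟨C₁, hC₁⟩ := exists_second_dirDeriv_cos_le (u := (1, 0, 0)) (w := (1, 0, 0)) hf hfc l
  obtain ⟨C₂, hC₂⟩ := exists_second_dirDeriv_cos_le (u := (0, 1, 0)) (w := (0, 1, 0)) hf hfc l
  obtain ⟨C₃, hC₃⟩ := exists_second_dirDeriv_cos_le (u := (0, 1, 0)) (w := (1, 0, 0)) hf hfc l
  obtain ⟨C₄, hC₄⟩ := exists_second_dirDeriv_cos_le (u := (0, 0, 1)) (w := (1, 0, 0)) hf hfc l
  obtain ⟨C₅, hC₅⟩ := exists_second_dirDeriv_cos_le (u := (0, 0, 1)) (w := (0, 1, 0)) hf hfc l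
  obtain ⟨C₆, hC₆⟩ := exists_dirDeriv_sin_le (w := (1, 0, 0)) hg hgc l
  obtain ⟨C₇, hC₇⟩ := exists_dirDeriv_sin_le (w := (0, 1, 0)) hg hgc l
  simp only [hl1, hl2, hl3] at hC₁ hC₂ hC₃ hC₄ hC₅ hC₆ hC₇
  set φ : ℝ → ℝ × ℝ × ℝ → ℝ :=
    fun n p => (n ^ 2)⁻¹ * (-w 0 * χ p * Real.cos (n * l p)) with hφ
  set θ : ℝ → ℝ × ℝ × ℝ → ℝ := fun n p => n⁻¹ * (κ * χ p * Real.sin (n * l p)) with hθ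
  have sφ : ∀ n p, χ p = 0 → φ n p = 0 := fun n p h => by simp [hφ, h]
  have sθ : ∀ n p, χ p = 0 → θ n p = 0 := fun n p h => by simp [hθ, h]
  refine ⟨l, fun n => ofPotentials (φ n) (θ n),
    (C₁ + C₂) + C₃ + C₁ + (C₄ + C₇) + (C₅ + C₆), ?_, fun n => ?_, fun n p hp => ?_,
    fun n hn p => ?_⟩
  · rintro rfl
    simp at hl1 hl2
    simp [← hl1, ← hl2] at hk
  · exact isLinearSolution_ofPotentials (contDiff_const.mul (hf.mul (contDiff_cos_mul n l)))
      hfc.mul_right.mul_left (contDiff_const.mul (hg.mul (contDiff_sin_mul n l)))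
      hgc.mul_right.mul_left
  · refine ofPotentials_eq_zero (fun h => hp ?_) (fun h => hp ?_)
    · exact closure_mono (s := Function.support _) (t := Function.support χ)
        (fun q (hq : φ n q ≠ 0) (hq' : χ q = 0) => hq (sφ n q hq')) h
    · exact closure_mono (s := Function.support _) (t := Function.support χ)
        (fun q (hq : θ n q ≠ 0) (hq' : χ q = 0) => hq (sθ n q hq')) h
  · refine (norm_le_sum_abs _).trans ?_
    simp only [add_div]
    have b1 := hC₁ n hn p
    have b2 := hC₂ n hn p
    have b3 := hC₃ n hn p
    have b4 := hC₄ n hn p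
    have b5 := hC₅ n hn p
    have b6 := hC₆ n hn p
    have b7 := hC₇ n hn p
    simp only [PiLp.sub_apply, PiLp.smul_apply, smul_eq_mul, ofPotentials,
      Matrix.cons_val]
    refine add_le_add (add_le_add (add_le_add (add_le_add ?_ ?_) ?_) ?_) ?_
    · refine le_trans (le_of_eq ?_) ((abs_add_le _ _).trans (add_le_add b1 b2))
      congr 1
      linear_combination χ p * Real.cos (n * l p) * w 0 * hk
    · refine le_trans (le_of_eq ?_) b3
      congr 1
      rw [h1]; ring
    · rw [← abs_neg]
      refine le_trans (le_of_eq ?_) b1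
      congr 1
      rw [h2]; ring
    · rw [← abs_neg]
      refine le_trans (le_of_eq ?_) ((abs_add_le _ _).trans (add_le_add b4 b7))
      congr 1
      rw [h3]; ring
    · refine le_trans (le_of_eq ?_) ((abs_sub _ _).trans (add_le_add b6 b5) |>.trans_eq
        (add_comm _ _))
      congr 1
      rw [h4]; ring

theorem tendsto_integral_cos_mul {l : StrongDual ℝ (ℝ × ℝ × ℝ)} (hl : l ≠ 0)
    {g : ℝ × ℝ × ℝ → ℝ} (hg : Integrable g) :
    Tendsto (fun n : ℝ => ∫ p, Real.cos (n * l p) * g p) atTop (nhds 0) := by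
  have h1 : Tendsto (fun n : ℝ => (n / (2 * Real.pi)) • l) atTop
      (cocompact (StrongDual ℝ (ℝ × ℝ × ℝ))) := by
    rw [← Metric.cobounded_eq_cocompact, ← tendsto_norm_atTop_iff_cobounded]
    have : Tendsto (fun n : ℝ => n * (‖l‖ / (2 * Real.pi))) atTop atTop :=
      tendsto_id.atTop_mul_const (by positivity)
    refine this.congr' ?_
    filter_upwards [eventually_ge_atTop 0] with n hn
    rw [norm_smul, Real.norm_eq_abs, abs_of_nonneg (by positivity)]
    ring
  have h2 := (tendsto_integral_exp_smul_cocompact (fun p => (g p : ℂ)) volume).comp h1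
  have h3 := (Complex.continuous_re.tendsto 0).comp h2
  rw [Complex.zero_re] at h3
  refine h3.congr fun n => ?_
  have hi : Integrable (fun p => Real.fourierChar (-((n / (2 * Real.pi)) • l) p) • (g p : ℂ)) := by
    refine (Integrable.ofReal hg (𝕜 := ℂ)).mono ?_ ?_
    · simp only [Circle.smul_def]
      have hc : Continuous fun p =>
          ((Real.fourierChar (-((n / (2 * Real.pi)) • l) p) : Circle) : ℂ) :=
        continuous_subtype_val.comp (Real.continuous_fourierChar.comp (by fun_prop))
      exact hc.aestronglyMeasurable.smul (Integrable.ofReal hg (𝕜 := ℂ)).1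
    · simp
  refine (integral_re hi).symm.trans (integral_congr_ae (Eventually.of_forall fun p => ?_))
  have : Real.fourierChar (-((n / (2 * Real.pi)) • l) p) • (g p : ℂ) =
      Complex.exp (((-(n * l p) : ℝ) : ℂ) * Complex.I) * (g p : ℂ) := by
    rw [Circle.smul_def, Real.fourierChar_apply, smul_eq_mul]
    congr 3
    push_cast
    simp
    field_simp
  simp only [this]
  change (_ * ((g p : ℝ) : ℂ)).re = _
  rw [Complex.re_mul_ofReal, Complex.exp_ofReal_mul_I_re, Real.cos_neg]

theorem volume_closedBall_half (x : ℝ × ℝ × ℝ) {r : ℝ} (hr : 0 ≤ r) :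
    volume.real (Metric.closedBall x (r / 2)) = volume.real (Metric.closedBall x r) / 8 := by
  rw [Measure.addHaar_real_closedBall' _ _ hr, Measure.addHaar_real_closedBall' _ _ (by positivity)]
  simp
  ring

theorem tendsto_integral_inner_of_oscillation {l : StrongDual ℝ (ℝ × ℝ × ℝ)} (hl : l ≠ 0)
    {χ : ℝ × ℝ × ℝ → ℝ} (hχ : Continuous χ) {K : Set (ℝ × ℝ × ℝ)} (hK : IsCompact K)
    (hχK : ∀ p, p ∉ K → χ p = 0)
    {w : IPMState} {W : ℝ → ℝ × ℝ × ℝ → IPMState} {C : ℝ} (hWc : ∀ n, Continuous (W n))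
    (hWK : ∀ n p, p ∉ K → W n p = 0)
    (hW : ∀ n, 1 ≤ n → ∀ p, ‖W n p - (χ p * Real.cos (n * l p)) • w‖ ≤ C / n)
    {g : ℝ × ℝ × ℝ → IPMState} (hg : Continuous g) :
    Tendsto (fun n => ∫ p, inner ℝ (W n p) (g p)) atTop (nhds 0) := by
  obtain ⟨M, hM⟩ := hK.exists_bound_of_continuousOn hg.continuousOn
  have hgw : Continuous fun p => χ p * inner ℝ w (g p) := by fun_prop
  have hgi : Integrable fun p => χ p * inner ℝ w (g p) :=
    hgw.integrable_of_hasCompactSupport (.intro hK fun p hp => by simp [hχK p hp])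
  have h1 := tendsto_integral_cos_mul hl hgi
  have hd : ∀ n, Continuous fun p =>
      inner ℝ (W n p - (χ p * Real.cos (n * l p)) • w) (g p) := fun n => by
    have := hWc n
    fun_prop
  have h0 : ∀ n p, p ∉ K → inner ℝ (W n p - (χ p * Real.cos (n * l p)) • w) (g p) = 0 :=
    fun n p hp => by simp [hχK p hp, hWK n p hp]
  have h2 : Tendsto (fun n => ∫ p, inner ℝ (W n p - (χ p * Real.cos (n * l p)) • w) (g p)) atTop
      (nhds 0) := by
    have h3 : Tendsto (fun n : ℝ => C / n * M * volume.real K) atTop (nhds 0) := by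
      simpa using ((tendsto_const_nhds.div_atTop tendsto_id).mul_const M).mul_const (volume.real K)
    refine squeeze_zero_norm' ?_ h3
    filter_upwards [eventually_ge_atTop 1] with n hn
    rw [← setIntegral_eq_integral_of_forall_compl_eq_zero (h0 n)]
    refine norm_setIntegral_le_of_norm_le_const hK.measure_lt_top fun p hp => ?_
    refine (norm_inner_le_norm _ _).trans ?_
    exact mul_le_mul (hW n hn p) (hM p hp) (norm_nonneg _) ((norm_nonneg _).trans (hW n hn p))
  have h4 := h2.add h1
  rw [add_zero] at h4
  refine h4.congr fun n => ?_
  have i1 : Integrable fun p => inner ℝ (W n p - (χ p * Real.cos (n * l p)) • w) (g p) :=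
    (hd n).integrable_of_hasCompactSupport (.intro hK (h0 n))
  have i2 : Integrable fun p => Real.cos (n * l p) * (χ p * inner ℝ w (g p)) :=
    Continuous.integrable_of_hasCompactSupport (by fun_prop)
      (.intro hK fun p hp => by simp [hχK p hp])
  rw [← integral_add i1 i2]
  refine integral_congr_ae (Eventually.of_forall fun p => ?_)
  simp only [inner_sub_left, real_inner_smul_left]
  ring

theorem exists_eventually_mem_hull {U : ℝ × ℝ × ℝ → IPMState} (hU : Continuous U)
    {x : ℝ × ℝ × ℝ} {w : IPMState} (hw : ∀ s ∈ Set.Icc (-1 : ℝ) 1, U x + s • w ∈ ipmHull) :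
    ∃ R > 0, ∃ δ > 0, ∀ p ∈ Metric.closedBall x R, ∀ s ∈ Set.Icc (-1 : ℝ) 1, ∀ z : IPMState,
      ‖z - s • w‖ < δ → U p + z ∈ ipmHull := by
  have hc : IsCompact ((fun s : ℝ => U x + s • w) '' Set.Icc (-1) 1) :=
    isCompact_Icc.image (by fun_prop)
  obtain ⟨δ, hδ, h⟩ := hc.exists_thickening_subset_open isOpen_ipmHull (by
    rintro _ ⟨s, hs, rfl⟩; exact hw s hs)
  obtain ⟨R, hR, hRU⟩ := Metric.continuous_iff'.1 hU x (δ / 2) (half_pos hδ) |>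
    Metric.nhds_basis_closedBall.eventually_iff.1
  refine ⟨R, hR, δ / 2, half_pos hδ, fun p hp s hs z hz => h ?_⟩
  refine Metric.mem_thickening_iff.2 ⟨_, ⟨s, hs, rfl⟩, ?_⟩
  have h1 := hRU hp
  rw [dist_eq_norm] at h1 ⊢
  calc ‖U p + z - (U x + s • w)‖ = ‖(U p - U x) + (z - s • w)‖ := by congr 1; abel
    _ ≤ ‖U p - U x‖ + ‖z - s • w‖ := norm_add_le _ _
    _ < δ := by linarith

theorem exists_local_perturbation {U : ℝ × ℝ × ℝ → IPMState} (hU : Continuous U)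
    {x : ℝ × ℝ × ℝ} (hx : U x ∈ ipmHull) :
    ∃ R > 0, ∀ r, 0 < r → r ≤ R → ∃ W : ℝ → ℝ × ℝ × ℝ → IPMState,
      (∀ n, IsLinearSolution (W n)) ∧
      (∀ n p, p ∉ Metric.closedBall x r → W n p = 0) ∧
      (∀ᶠ n in atTop, ∀ p ∈ Metric.closedBall x r, U p + W n p ∈ ipmHull) ∧
      (∀ g : ℝ × ℝ × ℝ → IPMState, Continuous g →
        Tendsto (fun n => ∫ p, inner ℝ (W n p) (g p)) atTop (nhds 0)) ∧
      ∀ᶠ n in atTop, ∫ p in Metric.closedBall x r,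
        ((U p 0) ^ 2 + 1 / 4096 * (1 - (U p 0) ^ 2) ^ 2) ≤
          ∫ p in Metric.closedBall x r, ((U p + W n p) 0) ^ 2 := by
  have hU0 : Continuous fun p => U p 0 := (EuclideanSpace.proj (𝕜 := ℝ) (0 : Fin 5)).continuous.comp hU
  obtain ⟨w, k₁, k₂, hk, h1, h2, hw0, hw⟩ := exists_wave_direction hx
  have hρ : 0 < 1 - U x 0 ^ 2 := by have := hx.1; linarith
  obtain ⟨R₁, hR₁, δ, hδ, hhull⟩ := exists_eventually_mem_hull hU hw
  have hcont : ContinuousAt (fun p => (1 - (U p 0) ^ 2) ^ 2) x := by fun_prop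
  obtain ⟨R₂, hR₂, hb⟩ := (hcont.eventually_lt continuousAt_const
    (show (1 - (U x 0) ^ 2) ^ 2 < 2 * (1 - (U x 0) ^ 2) ^ 2 by nlinarith)) |>
    Metric.nhds_basis_closedBall.eventually_iff.1
  refine ⟨min R₁ R₂, lt_min hR₁ hR₂, fun r hr hrR => ?_⟩
  let χ : ContDiffBump x := ⟨r / 2, r, by positivity, by linarith⟩
  obtain ⟨l, W, C, hl, hWs, hW0, hWC⟩ := exists_localized_wave (χ := χ) χ.contDiff
    χ.hasCompactSupport hk (by linarith) h1 h2
  rw [χ.tsupport_eq] at hW0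
  have hχ0 : ∀ p, p ∉ Metric.closedBall x r → χ p = 0 := fun p hp =>
    image_eq_zero_of_notMem_tsupport (by rwa [χ.tsupport_eq])
  have hKc : IsCompact (Metric.closedBall x r) := isCompact_closedBall x r
  have hweak : ∀ g : ℝ × ℝ × ℝ → IPMState, Continuous g →
      Tendsto (fun n => ∫ p, inner ℝ (W n p) (g p)) atTop (nhds 0) := fun g hg =>
    tendsto_integral_inner_of_oscillation hl χ.continuous hKc hχ0
      (fun n => (hWs n).continuous) hW0 hWC hg
  refine ⟨W, hWs, hW0, ?_, hweak, ?_⟩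
  · have ht : Tendsto (fun n : ℝ => C / n) atTop (nhds 0) := tendsto_const_nhds.div_atTop tendsto_id
    filter_upwards [ht.eventually (gt_mem_nhds hδ), eventually_ge_atTop 1] with n hn hn1 p hp
    refine hhull p (Metric.closedBall_subset_closedBall (hrR.trans (min_le_left _ _)) hp)
      (χ p * Real.cos (n * l p)) (abs_le.1 ?_) _ ((hWC n hn1 p).trans_lt hn)
    rw [abs_mul, abs_of_nonneg χ.nonneg]
    exact mul_le_one₀ χ.le_one (abs_nonneg _) (Real.abs_cos_le_one _)
  set K := Metric.closedBall x r with hK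
  have hKm : MeasurableSet K := Metric.isClosed_closedBall.measurableSet
  have hint : ∀ {f : ℝ × ℝ × ℝ → ℝ}, Continuous f → IntegrableOn f K := fun hf =>
    hf.continuousOn.integrableOn_compact hKc
  have hV : 0 < volume.real K :=
    ENNReal.toReal_pos (Metric.measure_closedBall_pos _ _ hr).ne' hKc.measure_lt_top.ne
  have hχ2 : volume.real K / 8 ≤ ∫ p in K, χ p ^ 2 := by
    rw [hK, ← volume_closedBall_half x hr.le]
    calc volume.real (Metric.closedBall x (r / 2))
        = ∫ p in Metric.closedBall x (r / 2), (1 : ℝ) := by simp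
      _ = ∫ p in Metric.closedBall x (r / 2), χ p ^ 2 :=
        setIntegral_congr_fun Metric.isClosed_closedBall.measurableSet fun p hp => by
          simp [χ.one_of_mem_closedBall hp]
      _ ≤ ∫ p in Metric.closedBall x r, χ p ^ 2 :=
        setIntegral_mono_set (hint (χ.continuous.pow 2)) (Eventually.of_forall fun p => sq_nonneg _)
          (Metric.closedBall_subset_closedBall (by linarith)).eventuallyLE
  have hdef : ∫ p in K, (1 - (U p 0) ^ 2) ^ 2 ≤ 2 * (1 - (U x 0) ^ 2) ^ 2 * volume.real K := by
    calc ∫ p in K, (1 - (U p 0) ^ 2) ^ 2 ≤ ∫ p in K, 2 * (1 - (U x 0) ^ 2) ^ 2 :=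
          setIntegral_mono_on (hint (by fun_prop)) (hint continuous_const) hKm fun p hp =>
            (hb (Metric.closedBall_subset_closedBall (hrR.trans (min_le_right _ _)) hp)).le
      _ = _ := by simp [mul_comm]
  have hcross := hweak (fun p => EuclideanSpace.single 0 (2 * U p 0))
    ((PiLp.continuous_toLp 2 _).comp (continuous_pi fun i => by
      by_cases h : i = 0
      · subst h; simpa using hU0.const_mul 2
      · simpa [h] using continuous_const))
  have hcos := tendsto_integral_cos_mul (l := (2 : ℝ) • l) (by simpa using hl)
    (g := fun p => χ p ^ 2) ((χ.continuous.pow 2).integrable_of_hasCompactSupport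
      (.intro hKc fun p hp => by simp [hχ0 p hp]))
  have herr : Tendsto (fun n : ℝ => 2 * w 0 * (C / n) * volume.real K) atTop (nhds 0) := by
    have ht : Tendsto (fun n : ℝ => C / n) atTop (nhds 0) :=
      tendsto_const_nhds.div_atTop tendsto_id
    simpa using (ht.const_mul (2 * w 0)).mul_const (volume.real K)
  have hall := (hcross.add (hcos.const_mul (w 0 ^ 2 / 2))).sub herr
  simp only [mul_zero, add_zero, sub_zero] at hall
  have hη : -((1 - (U x 0) ^ 2) ^ 2 * volume.real K / 2048) < 0 := by
    have : 0 < (1 - (U x 0) ^ 2) ^ 2 * volume.real K := by positivity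
    linarith
  filter_upwards [hall.eventually (lt_mem_nhds hη), eventually_ge_atTop 1] with n hn hn1
  have hWc0 := (hWs n).continuous_apply 0
  have hWn := (hWs n).continuous
  have hχc : Continuous χ := χ.continuous
  have hpt : ∀ p ∈ K, (U p 0) ^ 2 + inner ℝ (W n p) (EuclideanSpace.single 0 (2 * U p 0)) +
      w 0 ^ 2 / 2 * χ p ^ 2 + w 0 ^ 2 / 2 * (Real.cos (n * ((2 : ℝ) • l) p) * χ p ^ 2) -
      2 * w 0 * (C / n) ≤ ((U p + W n p) 0) ^ 2 := by
    intro p hp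
    have hE : |W n p 0 - χ p * Real.cos (n * l p) * w 0| ≤ C / n := by
      refine le_trans ?_ (hWC n hn1 p)
      simpa using PiLp.norm_apply_le (W n p - (χ p * Real.cos (n * l p)) • w) 0
    have hs : |χ p * Real.cos (n * l p)| ≤ 1 := by
      rw [abs_mul, abs_of_nonneg χ.nonneg]
      exact mul_le_one₀ χ.le_one (abs_nonneg _) (Real.abs_cos_le_one _)
    have hc2 : Real.cos (n * ((2 : ℝ) • l) p) = 2 * Real.cos (n * l p) ^ 2 - 1 := by
      rw [← Real.cos_two_mul]; congr 1; simp; ring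
    have hin : inner ℝ (W n p) (EuclideanSpace.single 0 (2 * U p 0)) = 2 * U p 0 * W n p 0 := by
      simp [EuclideanSpace.inner_single_right]
    rw [hin, hc2, PiLp.add_apply]
    generalize W n p 0 = a at *
    have hprod : |χ p * Real.cos (n * l p) * (a - χ p * Real.cos (n * l p) * w 0)| ≤ 1 * (C / n) := by
      rw [abs_mul]
      exact mul_le_mul hs hE (abs_nonneg _) zero_le_one
    have hw0' : 0 ≤ w 0 := by linarith
    have := mul_le_mul_of_nonneg_left (neg_le_of_abs_le hprod) hw0'
    nlinarith [sq_nonneg (a - χ p * Real.cos (n * l p) * w 0)]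
  have hinner : Continuous fun p => inner ℝ (W n p) (EuclideanSpace.single 0 (2 * U p 0) : IPMState) := by
    simp only [EuclideanSpace.inner_single_right, conj_trivial]
    exact (hU0.const_mul 2).mul hWc0
  have hcosc : Continuous fun p => Real.cos (n * ((2 : ℝ) • l) p) * χ p ^ 2 := by fun_prop
  have hU0' : Continuous fun p => (U p 0) ^ 2 := hU0.pow 2
  have hineq := setIntegral_mono_on (hint (by fun_prop)) (hint (by
    simp only [PiLp.add_apply]; exact (hU0.add hWc0).pow 2)) hKm hpt
  have hK1 : ∫ p in K, inner ℝ (W n p) (EuclideanSpace.single 0 (2 * U p 0) : IPMState) =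
      ∫ p, inner ℝ (W n p) (EuclideanSpace.single 0 (2 * U p 0) : IPMState) :=
    setIntegral_eq_integral_of_forall_compl_eq_zero fun p hp => by simp [hW0 n p hp]
  have hK2 : ∫ p in K, Real.cos (n * ((2 : ℝ) • l) p) * χ p ^ 2 =
      ∫ p, Real.cos (n * ((2 : ℝ) • l) p) * χ p ^ 2 :=
    setIntegral_eq_integral_of_forall_compl_eq_zero fun p hp => by simp [hχ0 p hp]
  have e1 : ∫ p in K, ((U p 0) ^ 2 +
      inner ℝ (W n p) (EuclideanSpace.single 0 (2 * U p 0) : IPMState) +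
      w 0 ^ 2 / 2 * χ p ^ 2 + w 0 ^ 2 / 2 * (Real.cos (n * ((2 : ℝ) • l) p) * χ p ^ 2) -
      2 * w 0 * (C / n)) = (∫ p in K, (U p 0) ^ 2) +
      (∫ p, inner ℝ (W n p) (EuclideanSpace.single 0 (2 * U p 0) : IPMState)) +
      w 0 ^ 2 / 2 * (∫ p in K, χ p ^ 2) +
      w 0 ^ 2 / 2 * (∫ p, Real.cos (n * ((2 : ℝ) • l) p) * χ p ^ 2) -
      2 * w 0 * (C / n) * volume.real K := by
    rw [integral_sub (hint (by fun_prop)) (hint continuous_const),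
      integral_add (hint (by fun_prop)) (hint (by fun_prop)),
      integral_add (hint (by fun_prop)) (hint (by fun_prop)),
      integral_add (hint (by fun_prop)) (hint (by fun_prop)), integral_const_mul,
      integral_const_mul, hK1, hK2, setIntegral_const, smul_eq_mul, mul_comm (volume.real K)]
  have e2 : ∫ p in K, ((U p 0) ^ 2 + 1 / 4096 * (1 - (U p 0) ^ 2) ^ 2) =
      (∫ p in K, (U p 0) ^ 2) + 1 / 4096 * ∫ p in K, (1 - (U p 0) ^ 2) ^ 2 := by
    rw [integral_add (hint (by fun_prop)) (hint (by fun_prop)), integral_const_mul]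
  rw [e1] at hineq
  rw [e2]
  refine le_trans ?_ hineq
  have hw2 : ((1 - U x 0 ^ 2) / 8) ^ 2 ≤ w 0 ^ 2 := by
    exact pow_le_pow_left₀ (by positivity) hw0 2
  have hgain : ((1 - U x 0 ^ 2) / 8) ^ 2 / 2 * (volume.real K / 8) ≤
      w 0 ^ 2 / 2 * ∫ p in K, χ p ^ 2 :=
    mul_le_mul (by linarith) hχ2 (by positivity) (by positivity)
  nlinarith

/-- The space-time box `(0,1)² × (0,T)`. -/
def spaceTimeBox (T : ℝ) : Set (ℝ × ℝ × ℝ) :=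
  Set.Ioo (0 : ℝ) 1 ×ˢ (Set.Ioo (0 : ℝ) 1 ×ˢ Set.Ioo (0 : ℝ) T)

theorem isOpen_spaceTimeBox (T : ℝ) : IsOpen (spaceTimeBox T) :=
  isOpen_Ioo.prod (isOpen_Ioo.prod isOpen_Ioo)

theorem measurableSet_spaceTimeBox (T : ℝ) : MeasurableSet (spaceTimeBox T) :=
  (isOpen_spaceTimeBox T).measurableSet

theorem exists_isCompact_spaceTimeBox_subset (T : ℝ) : ∃ K, IsCompact K ∧ spaceTimeBox T ⊆ K :=
  ⟨_, isCompact_Icc.prod (isCompact_Icc.prod isCompact_Icc), Set.prod_mono Set.Ioo_subset_Icc_self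
    (Set.prod_mono Set.Ioo_subset_Icc_self Set.Ioo_subset_Icc_self)⟩

theorem volume_spaceTimeBox_lt_top (T : ℝ) : volume (spaceTimeBox T) < ⊤ :=
  let ⟨_, hK, h⟩ := exists_isCompact_spaceTimeBox_subset T
  (measure_mono h).trans_lt hK.measure_lt_top

theorem Continuous.integrableOn_spaceTimeBox {E : Type*} [NormedAddCommGroup E]
    {f : ℝ × ℝ × ℝ → E} (hf : Continuous f) (T : ℝ) : IntegrableOn f (spaceTimeBox T) :=
  let ⟨_, hK, h⟩ := exists_isCompact_spaceTimeBox_subset T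
  (hf.continuousOn.integrableOn_compact hK).mono_set h

/-- `u + W` is a strict subsolution on the box `(0,1)² × (0,T)`. -/
structure IsPerturbation (T : ℝ) (u : IPMState) (W : ℝ × ℝ × ℝ → IPMState) : Prop where
  isLinearSolution : IsLinearSolution W
  eq_zero : ∀ p, p ∉ spaceTimeBox T → W p = 0
  mem_hull : ∀ p, u + W p ∈ ipmHull

theorem IsLinearSolution.continuous_inner {W : ℝ × ℝ × ℝ → IPMState} (hW : IsLinearSolution W)
    {g : ℝ × ℝ × ℝ → IPMState} (hg : Continuous g) : Continuous fun p => inner ℝ (W p) (g p) :=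
  hW.continuous.inner hg

theorem exists_finset_half_le {T : ℝ} {d : ℝ × ℝ × ℝ → ℝ} (hd : Continuous d) (hd0 : ∀ p, 0 ≤ d p)
    {R : ℝ × ℝ × ℝ → ℝ} (hR : ∀ x, 0 < R x) :
    ∃ (F : Finset (ℝ × ℝ × ℝ)) (r : ℝ × ℝ × ℝ → ℝ),
      (∀ x ∈ F, 0 < r x ∧ r x ≤ R x ∧ Metric.closedBall x (r x) ⊆ spaceTimeBox T) ∧
      (F : Set (ℝ × ℝ × ℝ)).PairwiseDisjoint (fun x => Metric.closedBall x (r x)) ∧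
      (∫ p in spaceTimeBox T, d p) / 2 ≤ ∑ x ∈ F, ∫ p in Metric.closedBall x (r x), d p := by
  classical
  have hbox : ∀ x ∈ spaceTimeBox T, ∃ ε > 0, Metric.closedBall x ε ⊆ spaceTimeBox T := fun x hx =>
    Metric.nhds_basis_closedBall.mem_iff.1 ((isOpen_spaceTimeBox T).mem_nhds hx)
  choose! ε hε hεB using hbox
  obtain ⟨t, r, htc, hts, htr, hcov, hdisj⟩ := Besicovitch.exists_disjoint_closedBall_covering_ae
    (volume : Measure (ℝ × ℝ × ℝ)) (fun _ => Set.univ) (spaceTimeBox T)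
    (fun x _ δ hδ => ⟨δ / 2, trivial, by constructor <;> linarith⟩)
    (fun x => min (R x) (ε x)) (fun x hx => lt_min (hR x) (hε x hx))
  have hsub : ∀ x ∈ t, Metric.closedBall x (r x) ⊆ spaceTimeBox T := fun x hx =>
    (Metric.closedBall_subset_closedBall ((htr x hx).2.2.le.trans (min_le_right _ _))).trans
      (hεB x (hts hx))
  have : Countable t := htc.to_subtype
  have hun : (⋃ x : t, Metric.closedBall (x : ℝ × ℝ × ℝ) (r x)) ⊆ spaceTimeBox T :=
    Set.iUnion_subset fun x => hsub x x.2
  have hsum := hasSum_integral_iUnion (μ := volume) (f := d)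
    (s := fun x : t => Metric.closedBall (x : ℝ × ℝ × ℝ) (r x))
    (fun x => Metric.isClosed_closedBall.measurableSet)
    (fun x y hxy => hdisj x.2 y.2 (fun h => hxy (Subtype.ext h)))
    ((hd.integrableOn_spaceTimeBox T).mono_set hun)
  have hae : ∫ p in (⋃ x : t, Metric.closedBall (x : ℝ × ℝ × ℝ) (r x)), d p =
      ∫ p in spaceTimeBox T, d p := by
    refine setIntegral_congr_set (Filter.EventuallyLE.antisymm hun.eventuallyLE ?_)
    rw [ae_le_set, Set.iUnion_subtype]
    exact hcov
  rw [hae] at hsum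
  obtain ⟨F, hF⟩ : ∃ F : Finset t, (∫ p in spaceTimeBox T, d p) / 2 ≤
      ∑ x ∈ F, ∫ p in Metric.closedBall (x : ℝ × ℝ × ℝ) (r x), d p := by
    rcases (setIntegral_nonneg (μ := volume) (measurableSet_spaceTimeBox T)
      fun p _ => hd0 p).eq_or_lt with h | h
    · exact ⟨∅, by simp [← h]⟩
    · exact ((hsum.eventually (lt_mem_nhds (half_lt_self h))).exists).imp fun F hF => hF.le
  refine ⟨F.map (Function.Embedding.subtype _), r, ?_, ?_, ?_⟩
  · intro x hx
    obtain ⟨y, hy, rfl⟩ := Finset.mem_map.1 hx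
    exact ⟨(htr y y.2).2.1, (htr y y.2).2.2.le.trans (min_le_left _ _), hsub y y.2⟩
  · refine hdisj.subset fun x hx => ?_
    obtain ⟨y, hy, rfl⟩ := Finset.mem_map.1 (Finset.mem_coe.1 hx)
    exact y.2
  · rwa [Finset.sum_map]

theorem IsPerturbation.exists_improvement {T : ℝ} {u : IPMState} {W : ℝ × ℝ × ℝ → IPMState}
    (hW : IsPerturbation T u W) (G : Finset (ℝ × ℝ × ℝ → IPMState)) (hG : ∀ g ∈ G, Continuous g)
    {ε : ℝ} (hε : 0 < ε) :
    ∃ W', IsPerturbation T u W' ∧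
      (∀ g ∈ G, |∫ p in spaceTimeBox T, inner ℝ (W' p - W p) (g p)| ≤ ε) ∧
      (∫ p in spaceTimeBox T, ((u + W p) 0) ^ 2) +
        1 / 8192 * (∫ p in spaceTimeBox T, (1 - ((u + W p) 0) ^ 2) ^ 2) ≤
        ∫ p in spaceTimeBox T, ((u + W' p) 0) ^ 2 := by
  classical
  have hU : Continuous fun p => u + W p := continuous_const.add hW.isLinearSolution.continuous
  have hU0 : Continuous fun p => (u + W p) 0 :=
    (EuclideanSpace.proj (𝕜 := ℝ) (0 : Fin 5)).continuous.comp hU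
  choose R hR hloc using fun x => exists_local_perturbation hU (hW.mem_hull x)
  obtain ⟨F, r, hr, hdisj, hF⟩ := exists_finset_half_le (T := T)
    (d := fun p => (1 - ((u + W p) 0) ^ 2) ^ 2) (by fun_prop) (fun p => sq_nonneg _) hR
  choose! V hVs hV0 hVh hVw hVe using fun x (hx : x ∈ F) => hloc x (r x) (hr x hx).1 (hr x hx).2.1
  have hweak : ∀ g ∈ G, Tendsto (fun n => ∑ x ∈ F, ∫ p, inner ℝ (V x n p) (g p)) atTop
      (nhds 0) := fun g hg => by
    simpa using tendsto_finsetSum F fun x hx => hVw x hx g (hG g hg)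
  have h1 : ∀ᶠ n in atTop, ∀ x ∈ F, ∀ p ∈ Metric.closedBall x (r x), u + W p + V x n p ∈ ipmHull :=
    (Finset.eventually_all F).2 hVh
  have h2 : ∀ᶠ n in atTop, ∀ x ∈ F, ∫ p in Metric.closedBall x (r x),
      (((u + W p) 0) ^ 2 + 1 / 4096 * (1 - ((u + W p) 0) ^ 2) ^ 2) ≤
        ∫ p in Metric.closedBall x (r x), ((u + W p + V x n p) 0) ^ 2 :=
    (Finset.eventually_all F).2 hVe
  have h3 : ∀ᶠ n in atTop, ∀ g ∈ G, |∑ x ∈ F, ∫ p, inner ℝ (V x n p) (g p)| ≤ ε :=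
    (Finset.eventually_all G).2 fun g hg =>
      ((hweak g hg).abs.eventually (gt_mem_nhds (by simpa using hε))).mono fun n hn => hn.le
  obtain ⟨n, h1, h2, h3⟩ := (h1.and (h2.and h3)).exists
  have hsol : IsLinearSolution fun p => ∑ x ∈ F, V x n p :=
    IsLinearSolution.sum F fun x hx => hVs x hx n
  have hin : ∀ x ∈ F, ∀ p ∈ Metric.closedBall x (r x), ∑ y ∈ F, V y n p = V x n p := by
    intro x hx p hp
    refine Finset.sum_eq_single x (fun y hy hyx => hV0 y hy n p fun hp' => ?_)
      (fun h => absurd hx h)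
    exact Set.disjoint_left.1 (hdisj hy hx hyx) hp' hp
  have hout : ∀ p, (∀ x ∈ F, p ∉ Metric.closedBall x (r x)) → ∑ y ∈ F, V y n p = 0 :=
    fun p hp => Finset.sum_eq_zero fun x hx => hV0 x hx n p (hp x hx)
  have houtB : ∀ p, p ∉ spaceTimeBox T → ∑ y ∈ F, V y n p = 0 := fun p hp =>
    hout p fun x hx h => hp ((hr x hx).2.2 h)
  refine ⟨fun p => W p + ∑ x ∈ F, V x n p, ⟨hW.isLinearSolution.add hsol, fun p hp => ?_,
    fun p => ?_⟩, fun g hg => ?_, ?_⟩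
  · rw [hW.eq_zero p hp, houtB p hp, add_zero]
  · by_cases h : ∃ x ∈ F, p ∈ Metric.closedBall x (r x)
    · obtain ⟨x, hx, hp⟩ := h
      rw [hin x hx p hp, ← add_assoc]
      exact h1 x hx p hp
    · push Not at h
      rw [hout p h, add_zero]
      exact hW.mem_hull p
  · simp only [add_sub_cancel_left]
    rw [setIntegral_eq_integral_of_forall_compl_eq_zero fun p hp => by simp [houtB p hp]]
    simp only [sum_inner]
    rw [integral_finsetSum F fun x hx => (hVs x hx n).integrable_of_eq_zero
      ((hVs x hx n).continuous_inner (hG g hg)) fun p hp => by simp [hp]]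
    exact h3 g hg
  · set f : ℝ × ℝ × ℝ → ℝ := fun p => ((u + (W p + ∑ x ∈ F, V x n p)) 0) ^ 2 - ((u + W p) 0) ^ 2
      with hf
    have hU' : Continuous fun p => (u + (W p + ∑ x ∈ F, V x n p)) 0 :=
      (EuclideanSpace.proj (𝕜 := ℝ) (0 : Fin 5)).continuous.comp
        (continuous_const.add (hW.isLinearSolution.continuous.add hsol.continuous))
    have hfc : Continuous f := (hU'.pow 2).sub (hU0.pow 2)
    have hfB : ∫ p in spaceTimeBox T, f p = (∫ p in spaceTimeBox T,
        ((u + (W p + ∑ x ∈ F, V x n p)) 0) ^ 2) - ∫ p in spaceTimeBox T, ((u + W p) 0) ^ 2 :=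
      integral_sub ((hU'.pow 2).integrableOn_spaceTimeBox T)
        ((hU0.pow 2).integrableOn_spaceTimeBox T)
    have hint : ∀ x, ∀ {g : ℝ × ℝ × ℝ → ℝ}, Continuous g →
        IntegrableOn g (Metric.closedBall x (r x)) := fun x g hg =>
      hg.continuousOn.integrableOn_compact (isCompact_closedBall x (r x))
    have hfU : ∫ p in spaceTimeBox T, f p = ∑ x ∈ F, ∫ p in Metric.closedBall x (r x), f p := by
      rw [← integral_biUnion_finset F (fun x _ => Metric.isClosed_closedBall.measurableSet) hdisj
        (fun x _ => hint x hfc)]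
      refine setIntegral_eq_of_subset_of_forall_sdiff_eq_zero (measurableSet_spaceTimeBox T)
        (Set.iUnion₂_subset fun x hx => (hr x hx).2.2) fun p hp => ?_
      have : ∑ y ∈ F, V y n p = 0 := hout p fun x hx h => hp.2 (Set.mem_biUnion hx h)
      simp only [hf, this, add_zero, sub_self]
    have hsq : Continuous fun p => ((u + W p) 0) ^ 2 := hU0.pow 2
    have hfx : ∀ x ∈ F, 1 / 4096 * ∫ p in Metric.closedBall x (r x),
        (1 - ((u + W p) 0) ^ 2) ^ 2 ≤ ∫ p in Metric.closedBall x (r x), f p := by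
      intro x hx
      have e := h2 x hx
      rw [integral_add (hint x hsq) (hint x (by fun_prop)), integral_const_mul] at e
      have e2 : ∫ p in Metric.closedBall x (r x), f p = (∫ p in Metric.closedBall x (r x),
          ((u + W p + V x n p) 0) ^ 2) - ∫ p in Metric.closedBall x (r x), ((u + W p) 0) ^ 2 := by
        rw [← integral_sub]
        · refine setIntegral_congr_fun Metric.isClosed_closedBall.measurableSet fun p hp => ?_
          simp only [hf, hin x hx p hp, add_assoc]
        · exact hint x (((EuclideanSpace.proj (𝕜 := ℝ) (0 : Fin 5)).continuous.comp
            (hU.add (hVs x hx n).continuous)).pow 2)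
        · exact hint x (hU0.pow 2)
      rw [e2]
      linarith
    have := Finset.sum_le_sum hfx
    rw [← Finset.mul_sum, ← hfU, hfB] at this
    linarith

theorem cauchySeq_of_almost_orthogonal {H : Type*} [NormedAddCommGroup H] [InnerProductSpace ℝ H]
    {u : ℕ → H} {M : ℝ} (hM : ∀ n, ‖u n‖ ≤ M)
    (h : ∀ j k, j ≤ k → |inner ℝ (u (k + 1) - u k) (u j)| ≤ (1 / 2 : ℝ) ^ k) : CauchySeq u := by
  have hsum : ∀ m n, m ≤ n →
      |inner ℝ (u n - u m) (u m)| ≤ 2 * (1 / 2 : ℝ) ^ m - 2 * (1 / 2 : ℝ) ^ n := by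
    intro m n hmn
    induction n, hmn using Nat.le_induction with
    | base => simp
    | succ n hmn ih =>
      have e : inner ℝ (u (n + 1) - u m) (u m) =
          inner ℝ (u (n + 1) - u n) (u m) + inner ℝ (u n - u m) (u m) := by
        rw [← inner_add_left, sub_add_sub_cancel]
      rw [e, pow_succ]
      linarith [abs_add_le (inner ℝ (u (n + 1) - u n) (u m)) (inner ℝ (u n - u m) (u m)),
        h m n hmn]
  have hsq : ∀ m n, m ≤ n → ‖u n - u m‖ ^ 2 ≤ ‖u n‖ ^ 2 - ‖u m‖ ^ 2 + 4 * (1 / 2 : ℝ) ^ m -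
      4 * (1 / 2 : ℝ) ^ n := by
    intro m n hmn
    have e : ‖u n‖ ^ 2 = ‖u n - u m‖ ^ 2 + 2 * inner ℝ (u n - u m) (u m) + ‖u m‖ ^ 2 := by
      rw [← norm_add_sq_real, sub_add_cancel]
    linarith [neg_le_of_abs_le (hsum m n hmn)]
  have hmono : Monotone fun n => ‖u n‖ ^ 2 - 4 * (1 / 2 : ℝ) ^ n := by
    refine monotone_nat_of_le_succ fun n => ?_
    linarith [hsq n (n + 1) n.le_succ, sq_nonneg ‖u (n + 1) - u n‖]
  have hbdd : BddAbove (Set.range fun n => ‖u n‖ ^ 2 - 4 * (1 / 2 : ℝ) ^ n) := by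
    refine ⟨M ^ 2, ?_⟩
    rintro _ ⟨n, rfl⟩
    have := pow_le_pow_left₀ (norm_nonneg _) (hM n) 2
    have h2 : (0 : ℝ) ≤ (1 / 2 : ℝ) ^ n := by positivity
    simp only
    linarith
  have hlim := tendsto_atTop_ciSup hmono hbdd
  set L := ⨆ n, ‖u n‖ ^ 2 - 4 * (1 / 2 : ℝ) ^ n
  have hpow : Tendsto (fun n : ℕ => (1 / 2 : ℝ) ^ n) atTop (nhds 0) :=
    tendsto_pow_atTop_nhds_zero_of_lt_one (by norm_num) (by norm_num)
  have hb : Tendsto (fun m => L - (‖u m‖ ^ 2 - 4 * (1 / 2 : ℝ) ^ m) ) atTop (nhds 0) := by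
    simpa using hlim.const_sub L
  refine Metric.cauchySeq_iff'.2 fun ε hε => ?_
  obtain ⟨N, hN⟩ := (hb.eventually (gt_mem_nhds (show (0 : ℝ) < ε ^ 2 by positivity))).exists
  have hN' : ∀ n ≥ N, ‖u n - u N‖ ^ 2 ≤ L - (‖u N‖ ^ 2 - 4 * (1 / 2 : ℝ) ^ N) := fun n hn => by
    have := hsq N n hn
    have h2 : ‖u n‖ ^ 2 - 4 * (1 / 2 : ℝ) ^ n ≤ L := le_ciSup hbdd n
    linarith
  exact ⟨N, fun n hn => by
    rw [dist_eq_norm]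
    exact lt_of_pow_lt_pow_left₀ 2 hε.le ((hN' n hn).trans_lt hN)⟩

theorem exists_seq_of_forall_rel {α : Type*} {P : α → Prop} {r : ℕ → α → α → Prop} {a : α}
    (ha : P a) (h : ∀ n x, P x → ∃ y, P y ∧ r n x y) :
    ∃ f : ℕ → α, f 0 = a ∧ ∀ n, P (f n) ∧ r n (f n) (f (n + 1)) := by
  choose! g hg using h
  let f : ℕ → α := fun n => Nat.rec a (fun k x => g k x) n
  have hf : ∀ n, P (f n) := fun n => by
    induction n with
    | zero => exact ha
    | succ n ih => exact (hg n _ ih).1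
  exact ⟨f, rfl, fun n => ⟨hf n, (hg n _ (hf n)).2⟩⟩

theorem exists_perturbation_seq (T : ℝ) {u : IPMState} (hu : u ∈ ipmHull) :
    ∃ W : ℕ → ℝ × ℝ × ℝ → IPMState, (∀ n, IsPerturbation T u (W n)) ∧
      (∀ j k, j ≤ k → |∫ p in spaceTimeBox T, inner ℝ (W (k + 1) p - W k p) (u + W j p)| ≤
        (1 / 2 : ℝ) ^ k) ∧
      ∀ k, (∫ p in spaceTimeBox T, ((u + W k p) 0) ^ 2) +
        1 / 8192 * (∫ p in spaceTimeBox T, (1 - ((u + W k p) 0) ^ 2) ^ 2) ≤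
        ∫ p in spaceTimeBox T, ((u + W (k + 1) p) 0) ^ 2 := by
  classical
  obtain ⟨f, -, hf⟩ := exists_seq_of_forall_rel
    (P := fun s : (ℝ × ℝ × ℝ → IPMState) × Finset (ℝ × ℝ × ℝ → IPMState) =>
      IsPerturbation T u s.1 ∧ (∀ g ∈ s.2, Continuous g) ∧ (fun p => u + s.1 p) ∈ s.2)
    (r := fun k s s' => s.2 ⊆ s'.2 ∧
      (∀ g ∈ s.2, |∫ p in spaceTimeBox T, inner ℝ (s'.1 p - s.1 p) (g p)| ≤ (1 / 2 : ℝ) ^ k) ∧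
      (∫ p in spaceTimeBox T, ((u + s.1 p) 0) ^ 2) +
        1 / 8192 * (∫ p in spaceTimeBox T, (1 - ((u + s.1 p) 0) ^ 2) ^ 2) ≤
        ∫ p in spaceTimeBox T, ((u + s'.1 p) 0) ^ 2)
    (a := ((fun _ => 0), {fun _ => u + 0}))
    ⟨⟨.zero, fun _ _ => rfl, fun _ => by simpa using hu⟩, by
      simp only [Finset.mem_singleton, forall_eq]; exact continuous_const, by simp⟩ (by
    rintro k ⟨W, G⟩ ⟨hW, hG, hWG⟩
    obtain ⟨W', hW', h1, h2⟩ := hW.exists_improvement G hG (ε := (1 / 2 : ℝ) ^ k) (by positivity)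
    refine ⟨(W', insert (fun p => u + W' p) G), ⟨hW', fun g hg => ?_, Finset.mem_insert_self _ _⟩,
      Finset.subset_insert _ _, h1, h2⟩
    rcases Finset.mem_insert.1 hg with rfl | hg
    · exact continuous_const.add hW'.isLinearSolution.continuous
    · exact hG g hg)
  have hmono : Monotone fun n => (f n).2 := monotone_nat_of_le_succ fun n => (hf n).2.1
  exact ⟨fun n => (f n).1, fun n => (hf n).1.1, fun j k hjk =>
    (hf k).2.2.1 _ (hmono hjk (hf j).1.2.2), fun k => (hf k).2.2.2⟩

theorem tendsto_zero_of_gain {e d : ℕ → ℝ} {c M : ℝ} (hc : 0 < c) (hd : ∀ k, 0 ≤ d k)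
    (he : ∀ k, e k ≤ M) (h : ∀ k, e k + c * d k ≤ e (k + 1)) : Tendsto d atTop (nhds 0) := by
  have hmono : Monotone e := monotone_nat_of_le_succ fun k => by
    have := mul_nonneg hc.le (hd k)
    linarith [h k]
  have hlim := tendsto_atTop_ciSup hmono ⟨M, by rintro _ ⟨k, rfl⟩; exact he k⟩
  have hdiff := (((tendsto_add_atTop_iff_nat 1).2 hlim).sub hlim).div_const c
  rw [sub_self, zero_div] at hdiff
  refine squeeze_zero hd (fun k => ?_) hdiff
  rw [le_div_iff₀ hc]
  linarith [h k]

theorem exists_ae_limit (T : ℝ) {u : IPMState} (hu : u ∈ ipmHull) :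
    ∃ (W : ℕ → ℝ × ℝ × ℝ → IPMState) (z : ℝ × ℝ × ℝ → IPMState),
      (∀ n, IsPerturbation T u (W n)) ∧ Measurable z ∧
      (∀ᵐ p ∂volume.restrict (spaceTimeBox T),
        Tendsto (fun n => u + W n p) atTop (nhds (z p))) ∧
      Tendsto (fun n => ∫ p in spaceTimeBox T, (1 - ((u + W n p) 0) ^ 2) ^ 2) atTop (nhds 0) := by
  obtain ⟨W, hW, horth, hgain⟩ := exists_perturbation_seq T hu
  have : IsFiniteMeasure (volume.restrict (spaceTimeBox T)) :=
    ⟨by simpa using volume_spaceTimeBox_lt_top T⟩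
  have hc : ∀ n, Continuous fun p => u + W n p := fun n =>
    continuous_const.add (hW n).isLinearSolution.continuous
  have hc0 : ∀ n, Continuous fun p => (u + W n p) 0 := fun n =>
    (EuclideanSpace.proj (𝕜 := ℝ) (0 : Fin 5)).continuous.comp (hc n)
  have hmem : ∀ n, MemLp (fun p => u + W n p) 2 (volume.restrict (spaceTimeBox T)) := fun n =>
    MemLp.of_bound (hc n).aestronglyMeasurable 10
      (Eventually.of_forall fun p => (norm_le_of_mem_ipmHull ((hW n).mem_hull p)).2)
  let f : ℕ → Lp IPMState 2 (volume.restrict (spaceTimeBox T)) := fun n => (hmem n).toLp _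
  have hfn : ∀ n, (f n : ℝ × ℝ × ℝ → IPMState) =ᵐ[volume.restrict (spaceTimeBox T)]
      fun p => u + W n p := fun n => (hmem n).coeFn_toLp
  have hcauchy : CauchySeq f := by
    refine cauchySeq_of_almost_orthogonal (fun n => Lp.norm_le_of_ae_bound (C := 10) (by norm_num)
      ?_) fun j k hjk => ?_
    · filter_upwards [hfn n] with p hp
      rw [hp]
      exact (norm_le_of_mem_ipmHull ((hW n).mem_hull p)).2
    · refine le_trans (le_of_eq ?_) (horth j k hjk)
      rw [L2.inner_def]
      congr 1
      refine integral_congr_ae ?_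
      filter_upwards [hfn j, hfn k, hfn (k + 1), Lp.coeFn_sub (f (k + 1)) (f k)] with p h1 h2 h3 h4
      rw [h4, Pi.sub_apply, h1, h2, h3, add_sub_add_left_eq_sub]
  obtain ⟨z, hz⟩ := cauchySeq_tendsto_of_complete hcauchy
  obtain ⟨ns, hns, hae⟩ := (tendstoInMeasure_of_tendsto_Lp hz).exists_seq_tendsto_ae
  have hdef : Tendsto (fun n => ∫ p in spaceTimeBox T, (1 - ((u + W n p) 0) ^ 2) ^ 2) atTop
      (nhds 0) := by
    refine tendsto_zero_of_gain (e := fun n => ∫ p in spaceTimeBox T, ((u + W n p) 0) ^ 2)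
      (c := 1 / 8192) (M := ∫ p in spaceTimeBox T, 1) (by norm_num)
      (fun k => integral_nonneg fun p => sq_nonneg _) (fun k => ?_) hgain
    refine integral_mono (((hc0 k).pow 2).integrableOn_spaceTimeBox T) (integrable_const _)
      fun p => ((hW k).mem_hull p).1.le
  refine ⟨fun n => W (ns n), z, fun n => hW _, (Lp.stronglyMeasurable z).measurable, ?_,
    hdef.comp hns.tendsto_atTop⟩
  filter_upwards [hae, ae_all_iff.2 fun n => hfn (ns n)] with p hp h
  simpa only [h] using hp

theorem inner_vec5 (x : IPMState) (a b c d e : ℝ) :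
    inner ℝ x !₂[a, b, c, d, e] = x 0 * a + x 1 * b + x 2 * c + x 3 * d + x 4 * e := by
  simp [PiLp.inner_apply, Fin.sum_univ_five, mul_comm]

theorem eq_of_mem_closure_hull {x : IPMState} {y : ℕ → IPMState} (hy : ∀ n, y n ∈ ipmHull)
    (hlim : Tendsto y atTop (nhds x)) (hx : x 0 ^ 2 = 1) :
    x 3 = x 0 * x 1 ∧ x 4 = x 0 * x 2 ∧ x 1 ^ 2 + x 2 ^ 2 ≤ 9 := by
  have hc : ∀ i : Fin 5, Tendsto (fun n => y n i) atTop (nhds (x i)) := fun i =>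
    ((EuclideanSpace.proj (𝕜 := ℝ) i).continuous.tendsto x).comp hlim
  have h9 : x 1 ^ 2 + x 2 ^ 2 ≤ 9 :=
    le_of_tendsto (((hc 1).pow 2).add ((hc 2).pow 2))
      (Eventually.of_forall fun n => (norm_le_of_mem_ipmHull (hy n)).1)
  have h2 : (x 3 - x 0 * x 1) ^ 2 + (x 4 - x 0 * x 2 + (1 - x 0 ^ 2) / 2) ^ 2 ≤
      ((1 - x 0 ^ 2) / 2) ^ 2 := by
    have hd := (((hc 0).pow 2).const_sub 1).div_const 2
    exact le_of_tendsto_of_tendsto ((((hc 3).sub ((hc 0).mul (hc 1))).pow 2).add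
      ((((hc 4).sub ((hc 0).mul (hc 2))).add hd).pow 2)) (hd.pow 2)
      (Eventually.of_forall fun n => (hy n).2.2.le)
  rw [hx] at h2
  norm_num at h2
  have h3 : x 3 - x 0 * x 1 = 0 := pow_eq_zero_iff two_ne_zero |>.1
    (le_antisymm (by linarith [sq_nonneg (x 4 - x 0 * x 2)]) (sq_nonneg _))
  have h4 : x 4 - x 0 * x 2 = 0 := pow_eq_zero_iff two_ne_zero |>.1
    (le_antisymm (by linarith [sq_nonneg (x 3 - x 0 * x 1)]) (sq_nonneg _))
  exact ⟨by linarith, by linarith, h9⟩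

theorem exists_box_solution (T : ℝ) {u : IPMState} (hu : u ∈ ipmHull) :
    ∃ z : ℝ × ℝ × ℝ → IPMState, Measurable z ∧
      (∀ᵐ p ∂volume.restrict (spaceTimeBox T), z p 0 ^ 2 = 1 ∧ z p 3 = z p 0 * z p 1 ∧
        z p 4 = z p 0 * z p 2 ∧ z p 1 ^ 2 + z p 2 ^ 2 ≤ 9) ∧
      ∀ g : ℝ × ℝ × ℝ → ℝ, ContDiff ℝ (⊤ : ℕ∞) g →
        (∫ p in spaceTimeBox T, (z p 0 * dt g p + z p 3 * dx1 g p + z p 4 * dx2 g p) =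
          ∫ p in spaceTimeBox T, (u 0 * dt g p + u 3 * dx1 g p + u 4 * dx2 g p)) ∧
        (∫ p in spaceTimeBox T, (z p 1 * dx1 g p + z p 2 * dx2 g p) =
          ∫ p in spaceTimeBox T, (u 1 * dx1 g p + u 2 * dx2 g p)) ∧
        (∫ p in spaceTimeBox T, (z p 1 * -(dx2 g p) + (z p 2 + z p 0) * dx1 g p) =
          ∫ p in spaceTimeBox T, (u 1 * -(dx2 g p) + (u 2 + u 0) * dx1 g p)) := by
  obtain ⟨W, z, hW, hz, hlim, hdef⟩ := exists_ae_limit T hu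
  have : IsFiniteMeasure (volume.restrict (spaceTimeBox T)) :=
    ⟨by simpa using volume_spaceTimeBox_lt_top T⟩
  have hc : ∀ n, Continuous fun p => u + W n p := fun n =>
    continuous_const.add (hW n).isLinearSolution.continuous
  have hc0 : ∀ n, Continuous fun p => (u + W n p) 0 := fun n =>
    (EuclideanSpace.proj (𝕜 := ℝ) (0 : Fin 5)).continuous.comp (hc n)
  have hz0 : Measurable fun p => z p 0 :=
    (EuclideanSpace.proj (𝕜 := ℝ) (0 : Fin 5)).continuous.measurable.comp hz
  have hbd : ∀ n p, (1 - ((u + W n p) 0) ^ 2) ^ 2 ≤ 1 := fun n p => by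
    have h1 := ((hW n).mem_hull p).1
    have h2 := sq_nonneg ((u + W n p) 0)
    exact pow_le_one₀ (by linarith) (by linarith)
  have hlim0 : ∀ᵐ p ∂volume.restrict (spaceTimeBox T),
      Tendsto (fun n => (1 - ((u + W n p) 0) ^ 2) ^ 2) atTop (nhds ((1 - (z p 0) ^ 2) ^ 2)) := by
    filter_upwards [hlim] with p hp
    have h0 := ((EuclideanSpace.proj (𝕜 := ℝ) (0 : Fin 5)).continuous.tendsto (z p)).comp hp
    exact ((h0.pow 2).const_sub 1).pow 2
  have hint0 : ∫ p in spaceTimeBox T, (1 - (z p 0) ^ 2) ^ 2 = 0 := by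
    refine tendsto_nhds_unique (tendsto_integral_of_dominated_convergence (fun _ => (1 : ℝ))
      (fun n => ?_) (integrable_const _) (fun n => Eventually.of_forall fun p => ?_) hlim0) hdef
    · exact (((continuous_const.sub ((hc0 n).pow 2))).pow 2).aestronglyMeasurable
    · rw [Real.norm_eq_abs, abs_of_nonneg (sq_nonneg _)]
      exact hbd n p
  have hsq : ∀ᵐ p ∂volume.restrict (spaceTimeBox T), z p 0 ^ 2 = 1 := by
    have hi : Integrable (fun p => (1 - (z p 0) ^ 2) ^ 2) (volume.restrict (spaceTimeBox T)) := by
      refine Integrable.of_bound ((measurable_const.sub (hz0.pow_const 2)).pow_const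
        2).aestronglyMeasurable 1 ?_
      filter_upwards [hlim0] with p hp
      rw [Real.norm_eq_abs, abs_of_nonneg (sq_nonneg _)]
      exact le_of_tendsto hp (Eventually.of_forall fun n => hbd n p)
    have := (integral_eq_zero_iff_of_nonneg_ae (Eventually.of_forall fun p => sq_nonneg _) hi).1
      hint0
    filter_upwards [this] with p hp
    have := pow_eq_zero_iff (two_ne_zero) |>.1 hp
    linarith
  have hpass : ∀ F : ℝ × ℝ × ℝ → IPMState, Continuous F → (∀ n, ∫ p, inner ℝ (W n p) (F p) = 0) →
      ∫ p in spaceTimeBox T, inner ℝ (z p) (F p) = ∫ p in spaceTimeBox T, inner ℝ u (F p) := by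
    intro F hF h0
    refine tendsto_nhds_unique (tendsto_integral_of_dominated_convergence
      (F := fun n p => inner ℝ (u + W n p) (F p)) (fun p => 10 * ‖F p‖)
      (fun n => ((hc n).inner hF).aestronglyMeasurable)
      ((continuous_const.mul hF.norm).integrableOn_spaceTimeBox T)
      (fun n => Eventually.of_forall fun p => ?_) ?_) ?_
    · refine (norm_inner_le_norm _ _).trans ?_
      gcongr
      exact (norm_le_of_mem_ipmHull ((hW n).mem_hull p)).2
    · filter_upwards [hlim] with p hp
      exact hp.inner tendsto_const_nhds
    · refine tendsto_const_nhds.congr fun n => ?_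
      simp only [inner_add_left]
      rw [integral_add ((continuous_const.inner hF).integrableOn_spaceTimeBox T)
        (((hW n).isLinearSolution.continuous_inner hF).integrableOn_spaceTimeBox T),
        setIntegral_eq_integral_of_forall_compl_eq_zero (f := fun p => inner ℝ (W n p) (F p))
          fun p hp => by simp [(hW n).eq_zero p hp], h0, add_zero]
  refine ⟨z, hz, ?_, fun g hg => ?_⟩
  · filter_upwards [hlim, hsq] with p hp h1
    obtain ⟨h3, h4, h9⟩ := eq_of_mem_closure_hull (fun n => (hW n).mem_hull p) hp h1
    exact ⟨h1, h3, h4, h9⟩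
  have h1 := continuous_dt hg
  have h2 := continuous_dx1 hg
  have h3 := continuous_dx2 hg
  have hvec : ∀ {a b c d e : ℝ × ℝ × ℝ → ℝ}, Continuous a → Continuous b → Continuous c →
      Continuous d → Continuous e →
      Continuous fun p => (!₂[a p, b p, c p, d p, e p] : IPMState) := by
    intro a b c d e ha hb hc hd he
    refine (PiLp.continuous_toLp 2 _).comp (continuous_pi fun i => ?_)
    fin_cases i
    exacts [ha, hb, hc, hd, he]
  have k : Continuous fun _ : ℝ × ℝ × ℝ => (0 : ℝ) := continuous_const
  refine ⟨?_, ?_, ?_⟩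
  · have := hpass (fun p => !₂[dt g p, 0, 0, dx1 g p, dx2 g p]) (hvec h1 k k h2 h3) fun n => by
      simpa [inner_vec5] using (hW n).isLinearSolution.transport g hg
    simpa [inner_vec5] using this
  · have := hpass (fun p => !₂[0, dx1 g p, dx2 g p, 0, 0]) (hvec k h2 h3 k k) fun n => by
      simpa [inner_vec5] using (hW n).isLinearSolution.div_free g hg
    simpa [inner_vec5] using this
  · have e : ∀ (x : IPMState) (a b : ℝ), inner ℝ x !₂[b, -a, b, 0, 0] =
        x 1 * -a + (x 2 + x 0) * b := fun x a b => by rw [inner_vec5]; ring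
    have := hpass (fun p => !₂[dx1 g p, -(dx2 g p), dx1 g p, 0, 0]) (hvec h2 h3.neg h2 k k)
      fun n => by
        simp only [e]
        exact (hW n).isLinearSolution.darcy g hg
    simpa only [e] using this

theorem setIntegral_Ioo_deriv_eq_zero {f : ℝ → ℝ} (hf : ContDiff ℝ (⊤ : ℕ∞) f) (h : f 1 = f 0) :
    ∫ x in Set.Ioo (0 : ℝ) 1, deriv f x = 0 := by
  rw [← integral_Ioc_eq_integral_Ioo, ← intervalIntegral.integral_of_le zero_le_one,
    intervalIntegral.integral_deriv_eq_sub (fun x _ => (hf.differentiable (by simp)) x)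
      ((hf.continuous_deriv (by simp)).intervalIntegrable _ _), h, sub_self]

theorem setIntegral_dx1_eq_zero {φ : ℝ × ℝ × ℝ → ℝ} (hφ : ContDiff ℝ (⊤ : ℕ∞) φ)
    (hper : SpacePeriodic φ) (T : ℝ) : ∫ p in spaceTimeBox T, dx1 φ p = 0 := by
  have hi := (continuous_dx1 hφ).integrableOn_spaceTimeBox T
  rw [IntegrableOn, spaceTimeBox, Measure.volume_eq_prod, ← Measure.prod_restrict] at hi
  rw [spaceTimeBox, Measure.volume_eq_prod, ← Measure.prod_restrict, integral_prod_symm _ hi]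
  refine integral_eq_zero_of_ae (Eventually.of_forall fun q => ?_)
  refine setIntegral_Ioo_deriv_eq_zero (f := fun s => φ (s, q.1, q.2))
    (hφ.comp (contDiff_id.prodMk contDiff_const)) ?_
  simpa using (hper (0, q)).1

theorem setIntegral_dx2_eq_zero {φ : ℝ × ℝ × ℝ → ℝ} (hφ : ContDiff ℝ (⊤ : ℕ∞) φ)
    (hper : SpacePeriodic φ) (T : ℝ) : ∫ p in spaceTimeBox T, dx2 φ p = 0 := by
  have hi := (continuous_dx2 hφ).integrableOn_spaceTimeBox T
  rw [spaceTimeBox, Measure.volume_eq_prod] at hi ⊢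
  rw [setIntegral_prod _ hi]
  refine integral_eq_zero_of_ae (Eventually.of_forall fun x => ?_)
  simp only [Pi.zero_apply]
  have hx : IntegrableOn (fun q : ℝ × ℝ => dx2 φ (x, q))
      (Set.Ioo (0 : ℝ) 1 ×ˢ Set.Ioo (0 : ℝ) T) :=
    (((continuous_dx2 hφ).comp (Continuous.prodMk_right x)).continuousOn.integrableOn_compact
      (isCompact_Icc.prod isCompact_Icc)).mono_set
      (Set.prod_mono Set.Ioo_subset_Icc_self Set.Ioo_subset_Icc_self)
  rw [IntegrableOn, Measure.volume_eq_prod, ← Measure.prod_restrict] at hx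
  rw [Measure.volume_eq_prod, ← Measure.prod_restrict, integral_prod_symm _ hx]
  refine integral_eq_zero_of_ae (Eventually.of_forall fun t => ?_)
  refine setIntegral_Ioo_deriv_eq_zero (f := fun s => φ (x, s, t))
    (hφ.comp (contDiff_const.prodMk (contDiff_id.prodMk contDiff_const))) ?_
  simpa using (hper (x, 0, t)).2

/-- The representative in `[0,1)² × ℝ` of a point of `𝕋² × ℝ`. -/
noncomputable def reduceTorus (p : ℝ × ℝ × ℝ) : ℝ × ℝ × ℝ :=
  (Int.fract p.1, Int.fract p.2.1, p.2.2)

theorem measurable_reduceTorus : Measurable reduceTorus :=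
  (measurable_fract.comp measurable_fst).prodMk
    ((measurable_fract.comp (measurable_fst.comp measurable_snd)).prodMk
      (measurable_snd.comp measurable_snd))

theorem reduceTorus_of_mem {T : ℝ} {p : ℝ × ℝ × ℝ} (hp : p ∈ spaceTimeBox T) :
    reduceTorus p = p := by
  obtain ⟨h1, h2, -⟩ := hp
  simp only [reduceTorus, Int.fract_eq_self.2 ⟨h1.1.le, h1.2⟩, Int.fract_eq_self.2 ⟨h2.1.le, h2.2⟩]

theorem spacePeriodic_comp_reduceTorus {α : Type*} (f : ℝ × ℝ × ℝ → α) :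
    SpacePeriodic fun p => f (reduceTorus p) := fun p => by
  simp [reduceTorus]

theorem ae_reduceTorus {T : ℝ} {P : ℝ × ℝ × ℝ → Prop}
    (h : ∀ᵐ p ∂volume.restrict (spaceTimeBox T), P p) :
    ∀ᵐ p : ℝ × ℝ × ℝ, p.2.2 ∈ Set.Ioo 0 T →
      reduceTorus p ∈ spaceTimeBox T ∧ P (reduceTorus p) := by
  rw [ae_restrict_iff' (measurableSet_spaceTimeBox T)] at h
  have htrans : ∀ᵐ p : ℝ × ℝ × ℝ, ∀ m n : ℤ, p - ((m : ℝ), (n : ℝ), (0 : ℝ)) ∈ spaceTimeBox T →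
      P (p - ((m : ℝ), (n : ℝ), (0 : ℝ))) :=
    ae_all_iff.2 fun m => ae_all_iff.2 fun n =>
      (measurePreserving_sub_right volume ((m : ℝ), (n : ℝ), (0 : ℝ))).quasiMeasurePreserving.ae h
  have hint : ∀ᵐ x : ℝ, x ∉ Set.range ((↑) : ℤ → ℝ) := (Set.countable_range _).ae_notMem _
  have h1 : ∀ᵐ p : ℝ × ℝ × ℝ, p.1 ∉ Set.range ((↑) : ℤ → ℝ) :=
    Measure.quasiMeasurePreserving_fst.ae hint
  have h2 : ∀ᵐ p : ℝ × ℝ × ℝ, p.2.1 ∉ Set.range ((↑) : ℤ → ℝ) :=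
    (Measure.quasiMeasurePreserving_fst.comp Measure.quasiMeasurePreserving_snd).ae hint
  have hfract : ∀ x : ℝ, x ∉ Set.range ((↑) : ℤ → ℝ) → Int.fract x ∈ Set.Ioo (0 : ℝ) 1 :=
    fun x hx => ⟨Int.fract_pos.2 fun e => hx ⟨_, e.symm⟩, Int.fract_lt_one x⟩
  filter_upwards [htrans, h1, h2] with p hp hp1 hp2 hpt
  have e : p - ((⌊p.1⌋ : ℝ), (⌊p.2.1⌋ : ℝ), (0 : ℝ)) = reduceTorus p := by
    ext <;> simp [reduceTorus]
  have hmem : reduceTorus p ∈ spaceTimeBox T := ⟨hfract _ hp1, hfract _ hp2, hpt⟩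
  exact ⟨hmem, e ▸ hp _ _ (e ▸ hmem)⟩

theorem setIntegral_QT_eq {T : ℝ} {f : ℝ × ℝ × ℝ → ℝ} (hf : ∀ p, p.2.2 ∉ Set.Ioo 0 T → f p = 0) :
    ∫ p in QT, f p = ∫ p in spaceTimeBox T, f p :=
  setIntegral_eq_of_subset_of_forall_sdiff_eq_zero
    (measurableSet_Ioo.prod (measurableSet_Ioo.prod MeasurableSet.univ))
    (Set.prod_mono le_rfl (Set.prod_mono le_rfl (Set.subset_univ _)))
    fun p hp => hf p fun ht => hp.2 ⟨hp.1.1, hp.1.2.1, ht⟩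

theorem baseState_mem_ipmHull {c : ℝ} (hc : c ∈ Set.Icc (0 : ℝ) (1 / 2)) :
    (!₂[0, c, 0, 0, -1 / 2] : IPMState) ∈ ipmHull := by
  refine ⟨?_, ?_, ?_⟩ <;> simp <;> nlinarith [hc.1, hc.2]

theorem exists_solution_of_mean (T : ℝ) {c : ℝ} (hc : c ∈ Set.Icc (0 : ℝ) (1 / 2)) :
    ∃ z : (ℝ × ℝ × ℝ → ℝ) × (ℝ × ℝ × ℝ → ℝ × ℝ),
      (∫ p in spaceTimeBox T, (z.2 p).1 = volume.real (spaceTimeBox T) * c) ∧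
      Measurable z.1 ∧ Measurable z.2 ∧ SpacePeriodic z.1 ∧ SpacePeriodic z.2 ∧
      (∃ C : ℝ, ∀ p, |z.1 p| ≤ C) ∧
      (∃ C : ℝ, ∀ p : ℝ × ℝ × ℝ, (z.2 p).1 ^ 2 + (z.2 p).2 ^ 2 ≤ C) ∧
      WeakIPMTorus z.1 z.2 ∧
      (∀ᵐ p : ℝ × ℝ × ℝ, p.2.2 ∈ Set.Ioo 0 T → |z.1 p| = 1) ∧
      (∀ᵐ p : ℝ × ℝ × ℝ, (p.2.2 < 0 ∨ T < p.2.2) → z.1 p = 0 ∧ z.2 p = 0) := by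
  classical
  obtain ⟨z, hz, hae, hweak⟩ := exists_box_solution T (baseState_mem_ipmHull hc)
  have hzi : ∀ i : Fin 5, Measurable fun p => z p i := fun i =>
    (EuclideanSpace.proj (𝕜 := ℝ) i).continuous.measurable.comp hz
  set G : Set (ℝ × ℝ × ℝ) :=
    spaceTimeBox T ∩ ({p | z p 0 ^ 2 = 1} ∩ {p | z p 1 ^ 2 + z p 2 ^ 2 ≤ 9})
  have hGm : MeasurableSet G := (measurableSet_spaceTimeBox T).inter
    ((measurableSet_eq_fun ((hzi 0).pow_const 2) measurable_const).inter
      (measurableSet_le (((hzi 1).pow_const 2).add ((hzi 2).pow_const 2)) measurable_const))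
  let w : Fin 5 → ℝ × ℝ × ℝ → ℝ := fun i p => G.indicator (fun q => z q i) (reduceTorus p)
  have hwm : ∀ i, Measurable (w i) := fun i => ((hzi i).indicator hGm).comp measurable_reduceTorus
  have hw0 : ∀ i p, p.2.2 ∉ Set.Ioo 0 T → w i p = 0 := fun i p hp =>
    Set.indicator_of_notMem (fun h => hp h.1.2.2) _
  have hwz : ∀ᵐ p ∂volume.restrict (spaceTimeBox T), (∀ i, w i p = z p i) ∧
      z p 3 = z p 0 * z p 1 ∧ z p 4 = z p 0 * z p 2 := by
    filter_upwards [hae, ae_restrict_mem (measurableSet_spaceTimeBox T)] with p hp hpB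
    refine ⟨fun i => ?_, hp.2.1, hp.2.2.1⟩
    simp only [w, reduceTorus_of_mem hpB]
    exact Set.indicator_of_mem (show p ∈ G from ⟨hpB, hp.1, hp.2.2.2⟩) _
  have hwsq : ∀ᵐ p : ℝ × ℝ × ℝ, p.2.2 ∈ Set.Ioo 0 T → |w 0 p| = 1 := by
    filter_upwards [ae_reduceTorus hae] with p hp hpt
    obtain ⟨hpB, h1, -, -, h9⟩ := hp hpt
    simp only [w]
    rw [Set.indicator_of_mem (show reduceTorus p ∈ G from ⟨hpB, h1, h9⟩)]
    exact ((sq_eq_sq_iff_abs_eq_abs _ _).1 (h1.trans (one_pow 2).symm)).trans abs_one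
  refine ⟨(w 0, fun p => (w 1 p, w 2 p)), ?_, hwm 0, (hwm 1).prodMk (hwm 2),
    spacePeriodic_comp_reduceTorus (G.indicator fun q => z q 0),
    spacePeriodic_comp_reduceTorus fun q =>
      (G.indicator (fun q => z q 1) q, G.indicator (fun q => z q 2) q),
    ⟨1, fun p => ?_⟩, ⟨9, fun p => ?_⟩, fun φ hφ => ?_, hwsq, Eventually.of_forall fun p hp => ?_⟩
  · have hx := (hweak (fun p => p.1) contDiff_fst).2.1
    have e1 : ∀ p, dx1 (fun p : ℝ × ℝ × ℝ => p.1) p = 1 := fun p => by simp [dx1]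
    have e2 : ∀ p, dx2 (fun p : ℝ × ℝ × ℝ => p.1) p = 0 := fun p => by simp [dx2]
    simp only [e1, e2, mul_one, mul_zero, add_zero, setIntegral_const, smul_eq_mul] at hx
    simp only
    rw [integral_congr_ae (hwz.mono fun p hp => hp.1 1), hx]
    simp
  · simp only [w]
    by_cases h : reduceTorus p ∈ G
    · rw [Set.indicator_of_mem h]
      have h1 : z (reduceTorus p) 0 ^ 2 = 1 := h.2.1
      exact (((sq_eq_sq_iff_abs_eq_abs _ _).1 (h1.trans (one_pow 2).symm)).trans abs_one).le
    · simp [Set.indicator_of_notMem h]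
  · simp only [w]
    by_cases h : reduceTorus p ∈ G
    · simp only [Set.indicator_of_mem h]
      exact h.2.2
    · simp [Set.indicator_of_notMem h]
  · obtain ⟨h1, h2, h3⟩ := hweak φ hφ.1
    have i1 := setIntegral_dx1_eq_zero hφ.1 hφ.2.1 T
    have i2 := setIntegral_dx2_eq_zero hφ.1 hφ.2.1 T
    refine ⟨?_, ?_, ?_⟩
    · rw [setIntegral_QT_eq (T := T) fun p hp => by simp [hw0 _ p hp]]
      refine Eq.trans (integral_congr_ae (hwz.mono fun p hp => ?_)) (h1.trans ?_)
      · simp only [hp.1, hp.2.1, hp.2.2]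
        ring
      · simp [integral_const_mul, i2]
    · rw [setIntegral_QT_eq (T := T) fun p hp => by simp [hw0 _ p hp]]
      refine Eq.trans (integral_congr_ae (hwz.mono fun p hp => ?_)) (h2.trans ?_)
      · simp only [hp.1]
      · simp [integral_const_mul, i1]
    · rw [setIntegral_QT_eq (T := T) fun p hp => by simp [hw0 _ p hp]]
      refine Eq.trans (integral_congr_ae (hwz.mono fun p hp => ?_)) (h3.trans ?_)
      · simp only [hp.1]
      · simp [integral_const_mul, integral_neg, i2]
  · have hp' : p.2.2 ∉ Set.Ioo 0 T := fun h => hp.elim (fun h' => lt_asymm h' h.1)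
      fun h' => lt_asymm h' h.2
    simp [hw0 _ p hp']

theorem stmt10 (T : ℝ) (hT : 0 < T) :
    ∃ S : Set ((ℝ × ℝ × ℝ → ℝ) × (ℝ × ℝ × ℝ → ℝ × ℝ)), S.Infinite ∧
      (∀ z₁ ∈ S, ∀ z₂ ∈ S, z₁ ≠ z₂ →
        ¬ (∀ᵐ p : ℝ × ℝ × ℝ, z₁.1 p = z₂.1 p ∧ z₁.2 p = z₂.2 p)) ∧
      ∀ z ∈ S,
        Measurable z.1 ∧ Measurable z.2 ∧
        SpacePeriodic z.1 ∧ SpacePeriodic z.2 ∧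
        -- ρ ∈ L^∞(𝕋² × ℝ)
        (∃ C : ℝ, ∀ p, |z.1 p| ≤ C) ∧
        -- v ∈ L^∞(𝕋² × ℝ)
        (∃ C : ℝ, ∀ p : ℝ × ℝ × ℝ, (z.2 p).1 ^ 2 + (z.2 p).2 ^ 2 ≤ C) ∧
        WeakIPMTorus z.1 z.2 ∧
        -- |ρ| = 1 a.e. on 𝕋² × (0,T)
        (∀ᵐ p : ℝ × ℝ × ℝ, p.2.2 ∈ Set.Ioo 0 T → |z.1 p| = 1) ∧
        -- ρ = 0 and v = 0 for a.e. t outside [0,T]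
        (∀ᵐ p : ℝ × ℝ × ℝ, (p.2.2 < 0 ∨ T < p.2.2) → z.1 p = 0 ∧ z.2 p = 0) := by
  choose! Z hZ using fun c (hc : c ∈ Set.Icc (0 : ℝ) (1 / 2)) => exists_solution_of_mean T hc
  have hpos : 0 < volume.real (spaceTimeBox T) :=
    ENNReal.toReal_pos ((isOpen_spaceTimeBox T).measure_pos volume
      ⟨(1 / 2, 1 / 2, T / 2), by norm_num, by norm_num,
        by constructor <;> simp only <;> linarith⟩).ne'
      (volume_spaceTimeBox_lt_top T).ne
  have hmean : ∀ c ∈ Set.Icc (0 : ℝ) (1 / 2), ∀ d ∈ Set.Icc (0 : ℝ) (1 / 2),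
      (∀ᵐ p : ℝ × ℝ × ℝ, (Z c).1 p = (Z d).1 p ∧ (Z c).2 p = (Z d).2 p) → c = d := by
    intro c hc d hd h
    refine mul_left_cancel₀ hpos.ne' ?_
    rw [← (hZ c hc).1, ← (hZ d hd).1]
    refine integral_congr_ae (ae_restrict_of_ae (h.mono fun p hp => ?_))
    simp only [hp.2]
  refine ⟨Z '' Set.Icc 0 (1 / 2), (Set.Icc_infinite (by norm_num)).image fun c hc d hd h =>
    hmean c hc d hd (by simp [h]), ?_, ?_⟩
  · rintro _ ⟨c, hc, rfl⟩ _ ⟨d, hd, rfl⟩ hne h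
    exact hne (by rw [hmean c hc d hd h])
  · rintro _ ⟨c, hc, rfl⟩
    exact (hZ c hc).2
end
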